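/- Exponential tail of the effective radius: there exists a constant c > 0 such that for every edge e of Z^d and every real t with 1 ≤ t ≤ exp(c log² n), P( R_e ≥ t ) ≤ c⁻¹ exp(−c t). -/

import Mathlib

open MeasureTheory
open scoped ENNReal NNReal

attribute [local instance] Classical.propDecidable

noncomputable section

namespace Perco

/-- Vertices of the lattice `ℤ^d`. -/
abbrev ZVec (d : ℕ) := Fin d → ℤ

/-- The `ℓ¹` norm of a lattice point (as a natural number). -/
def norm1 (d : ℕ) (x : ZVec d) : ℕ := ∑ i, (x i).natAbs

/-- The `ℓ∞` norm of a lattice point (as a natural number). -/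
def normInf (d : ℕ) (x : ZVec d) : ℕ := Finset.univ.sup fun i => (x i).natAbs

/-- Nearest-neighbour edges of `ℤ^d`, each written `(x_e, y_e)` with `‖x_e‖₁ < ‖y_e‖₁`. -/
def EdgeD (d : ℕ) := {e : ZVec d × ZVec d // norm1 d (e.1 - e.2) = 1 ∧ norm1 d e.1 < norm1 d e.2}

/-- A percolation configuration: each edge is open (`true`) or closed (`false`). -/
abbrev Config (d : ℕ) := EdgeD d → Bool

/-- Adjacency in `ℤ^d`. -/
def Adj (d : ℕ) (x y : ZVec d) : Prop := norm1 d (x - y) = 1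

/-- A (self-avoiding, nearest-neighbour) path, recorded as its list of vertices. -/
def IsPath (d : ℕ) (γ : List (ZVec d)) : Prop :=
  γ ≠ [] ∧ γ.Nodup ∧ γ.Chain' (Adj d)

/-- The (unordered) edge `{x,y}` is open in the configuration `ω`. -/
def EdgeOpen (d : ℕ) (ω : Config d) (x y : ZVec d) : Prop :=
  ∃ e : EdgeD d, (e.val = (x, y) ∨ e.val = (y, x)) ∧ ω e = true

/-- All edges of the path are open. -/
def IsOpenPath (d : ℕ) (ω : Config d) (γ : List (ZVec d)) : Prop :=
  γ.Chain' (EdgeOpen d ω)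

/-- The (unordered) edge `{x,y}` is an edge of the path `γ`. -/
def edgeMemPath (d : ℕ) (x y : ZVec d) (γ : List (ZVec d)) : Prop :=
  (x, y) ∈ γ.zip γ.tail ∨ (y, x) ∈ γ.zip γ.tail

/-- Truncated FPP weight of the edge `{x,y}`: `1` if open, `log² n` if closed. -/
def pairWeight (d n : ℕ) (ω : Config d) (x y : ZVec d) : ℝ :=
  if EdgeOpen d ω x y then 1 else (Real.log n) ^ 2

/-- Total truncated weight of a path. -/
def pathCost (d n : ℕ) (ω : Config d) : List (ZVec d) → ℝ
  | [] => 0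
  | [_] => 0
  | x :: y :: rest => pairWeight d n ω x y + pathCost d n ω (y :: rest)

/-- Truncated first-passage time between `x` and `y`. -/
def passageTime (d n : ℕ) (ω : Config d) (x y : ZVec d) : ℝ :=
  sInf {c : ℝ | ∃ γ : List (ZVec d), IsPath d γ ∧ γ.head? = some x ∧
    γ.getLast? = some y ∧ pathCost d n ω γ = c}

/-- Chemical distance between `x` and `y` using only open paths inside `U`. -/
def chemDistIn (d : ℕ) (ω : Config d) (U : Set (ZVec d)) (x y : ZVec d) : ℕ∞ :=
  sInf {k : ℕ∞ | ∃ γ : List (ZVec d), IsPath d γ ∧ IsOpenPath d ω γ ∧ (∀ v ∈ γ, v ∈ U) ∧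
    γ.head? = some x ∧ γ.getLast? = some y ∧ ((γ.length - 1 : ℕ) : ℕ∞) = k}

/-- Chemical distance in the whole lattice. -/
def chemDist (d : ℕ) (ω : Config d) (x y : ZVec d) : ℕ∞ := chemDistIn d ω Set.univ x y

/-- `x` belongs to an infinite open cluster. -/
def InInfCluster (d : ℕ) (ω : Config d) (x : ZVec d) : Prop :=
  {y | chemDist d ω x y ≠ ⊤}.Infinite

/-- `x*`: a point of the infinite cluster at minimal `ℓ∞`-distance from `x`
(deterministic tie-breaking via choice); `x` itself if there is no infinite cluster. -/
def starPt (d : ℕ) (ω : Config d) (x : ZVec d) : ZVec d :=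
  if h : ∃ y, InInfCluster d ω y ∧ ∀ z, InInfCluster d ω z →
      normInf d (y - x) ≤ normInf d (z - x)
  then h.choose else x

/-- `μ` is the Bernoulli(p) bond-percolation product measure on configurations. -/
def IsBernoulli (d : ℕ) (p : ℝ) (μ : Measure (Config d)) : Prop :=
  IsProbabilityMeasure μ ∧
  ∀ (s : Finset (EdgeD d)) (f : EdgeD d → Bool),
    μ {ω | ∀ e ∈ s, ω e = f e} = ∏ e ∈ s, ENNReal.ofReal (if f e then p else 1 - p)

/-- The critical parameter of Bernoulli bond percolation on `ℤ^d`. -/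
def pc (d : ℕ) : ℝ :=
  sSup {p : ℝ | 0 ≤ p ∧ p ≤ 1 ∧ ∀ μ : Measure (Config d), IsBernoulli d p μ →
    μ {ω | ∃ x, InInfCluster d ω x} = 0}

/-- The point `n·e₁`. -/
def ptE1 (d n : ℕ) : ZVec d := fun i => if (i : ℕ) = 0 then (n : ℤ) else 0

/-- `D*_n = D(0*, (n e₁)*)`, as a real number. -/
def DstarR (d n : ℕ) (ω : Config d) : ℝ :=
  ((chemDist d ω (starPt d ω 0) (starPt d ω (ptE1 d n))).toNat : ℝ)

/-- `T_n = T(0, n e₁)`, the truncated passage time. -/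
def TnR (d n : ℕ) (ω : Config d) : ℝ := passageTime d n ω 0 (ptE1 d n)

/-- The box `Λ_t(z)` with integer radius. -/
def boxZ (d : ℕ) (t : ℕ) (z : ZVec d) : Set (ZVec d) := {y | normInf d (y - z) ≤ t}

/-- The box `Λ_t(z)` with real radius. -/
def boxR (d : ℕ) (t : ℝ) (z : ZVec d) : Set (ZVec d) := {y | (normInf d (y - z) : ℝ) ≤ t}

/-- The annulus `A_N(e) = Λ_{3N}(e) \ Λ_N(e)`. -/
def annulus (d : ℕ) (N : ℕ) (e : EdgeD d) : Set (ZVec d) :=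
  {y | normInf d (y - e.val.1) ≤ 3 * N ∧ N < normInf d (y - e.val.1)}

/-- `π` is a geodesic of the truncated passage time between its endpoints, inside `A`. -/
def IsGeodesicIn (d n : ℕ) (ω : Config d) (A : Set (ZVec d)) (π : List (ZVec d)) : Prop :=
  IsPath d π ∧ (∀ v ∈ π, v ∈ A) ∧
  ∀ π' : List (ZVec d), IsPath d π' → (∀ v ∈ π', v ∈ A) →
    π'.head? = π.head? → π'.getLast? = π.getLast? →
    pathCost d n ω π ≤ pathCost d n ω π'

/-- `γ ∈ 𝔾_*(A)`: a path in `A` obtained from some geodesic in `A` by replacing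
segments by open paths (all edges of `γ` not on the geodesic are open). -/
def GstarIn (d n : ℕ) (ω : Config d) (A : Set (ZVec d)) (γ : List (ZVec d)) : Prop :=
  IsPath d γ ∧ (∀ v ∈ γ, v ∈ A) ∧
  ∃ π : List (ZVec d), IsGeodesicIn d n ω A π ∧
    ∀ x y, edgeMemPath d x y γ → ¬ edgeMemPath d x y π → EdgeOpen d ω x y

/-- `γ` is a crossing path of the annulus `A_N(e)`. -/
def IsCrossing (d : ℕ) (N : ℕ) (e : EdgeD d) (γ : List (ZVec d)) : Prop :=
  IsPath d γ ∧ (∀ v ∈ γ, v ∈ annulus d N e) ∧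
  (∃ v ∈ γ, normInf d (v - e.val.1) = N + 1) ∧ (∃ v ∈ γ, normInf d (v - e.val.1) = 3 * N)

/-- The event `𝒱¹_N(e)`: any two modified geodesics crossing `A_N(e)` are linked by an
open path inside `A_N(e)` of length at most `C_* N`. -/
def V1 (d : ℕ) (Cstar : ℝ) (n : ℕ) (e : EdgeD d) (N : ℕ) (ω : Config d) : Prop :=
  ∀ γ1 γ2 : List (ZVec d),
    GstarIn d n ω (boxR d (Cstar * N) e.val.1) γ1 → IsCrossing d N e γ1 →
    GstarIn d n ω (boxR d (Cstar * N) e.val.1) γ2 → IsCrossing d N e γ2 →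
    ∃ π : List (ZVec d), IsPath d π ∧ IsOpenPath d ω π ∧ (∀ v ∈ π, v ∈ annulus d N e) ∧
      (∃ u, π.head? = some u ∧ u ∈ γ1) ∧ (∃ v, π.getLast? = some v ∧ v ∈ γ2) ∧
      ((π.length : ℝ) - 1 ≤ Cstar * N)

/-- The event `𝒱²_N(e)`: points of `Λ_{3N}(e)` openly connected inside `Λ_{3N}(e)` are
connected inside `Λ_{4N}(e)` by an open path of length at most `C_* N`. -/
def V2 (d : ℕ) (Cstar : ℝ) (e : EdgeD d) (N : ℕ) (ω : Config d) : Prop :=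
  ∀ x y : ZVec d, x ∈ boxZ d (3 * N) e.val.1 → y ∈ boxZ d (3 * N) e.val.1 →
    (∃ γ, IsPath d γ ∧ IsOpenPath d ω γ ∧ (∀ v ∈ γ, v ∈ boxZ d (3 * N) e.val.1) ∧
      γ.head? = some x ∧ γ.getLast? = some y) →
    ∃ γ, IsPath d γ ∧ IsOpenPath d ω γ ∧ (∀ v ∈ γ, v ∈ boxZ d (4 * N) e.val.1) ∧
      γ.head? = some x ∧ γ.getLast? = some y ∧ ((γ.length : ℝ) - 1 ≤ Cstar * N)

/-- The effective radius `R_e` as a natural number (`0` when undefined). -/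
def ReffN (d : ℕ) (Cstar : ℝ) (n : ℕ) (e : EdgeD d) (ω : Config d) : ℕ :=
  sInf {N : ℕ | 1 ≤ N ∧ V1 d Cstar n e N ω ∧ V2 d Cstar e N ω}

/-- The effective radius `R_e`, valued in `ℝ≥0∞` (`∞` when undefined). -/
def ReffENN (d : ℕ) (Cstar : ℝ) (n : ℕ) (e : EdgeD d) (ω : Config d) : ℝ≥0∞ :=
  sInf {r : ℝ≥0∞ | ∃ N : ℕ, r = N ∧ 1 ≤ N ∧ V1 d Cstar n e N ω ∧ V2 d Cstar e N ω}

/-- The truncated effective radius `R̂_e = min (C_* R_e) (log² n)`. -/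
def RhatR (d : ℕ) (Cstar : ℝ) (n : ℕ) (e : EdgeD d) (ω : Config d) : ℝ :=
  (min (ENNReal.ofReal Cstar * ReffENN d Cstar n e ω)
    (ENNReal.ofReal ((Real.log n) ^ 2))).toReal

/-- `diam(γ) ≥ r`. -/
def DiamGE (d : ℕ) (γ : List (ZVec d)) (r : ℝ) : Prop :=
  ∃ i : Fin d, ∃ x ∈ γ, ∃ y ∈ γ, r ≤ |((x i : ℤ) : ℝ) - ((y i : ℤ) : ℝ)|

/-- The boundary `∂Λ_t` (real radius `t`). -/
def bdryR (d : ℕ) (t : ℝ) : Set (ZVec d) :=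
  {x | (normInf d x : ℝ) ≤ t ∧ t - 1 < (normInf d x : ℝ)}

/-- The slab `S(ℓ,t) = {x ∈ Λ_t : 0 ≤ x₁ ≤ ℓ}`. -/
def slab (d : ℕ) (l t : ℝ) : Set (ZVec d) :=
  {x | (normInf d x : ℝ) ≤ t ∧ ∀ i : Fin d, (i : ℕ) = 0 → 0 ≤ x i ∧ ((x i : ℤ) : ℝ) ≤ l}

/-- The open cluster of the vertex `v`. -/
def openClusterOf (d : ℕ) (ω : Config d) (v : ZVec d) : Set (ZVec d) :=
  {y | chemDist d ω v y ≠ ⊤}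

/-- The set `C` crosses the box `Λ_t(z)`: in each direction an open path of `C ∩ Λ_t(z)`
connects the two opposite faces. -/
def CrossesBox (d : ℕ) (ω : Config d) (C : Set (ZVec d)) (t : ℕ) (z : ZVec d) : Prop :=
  ∀ i : Fin d, ∃ γ, IsPath d γ ∧ IsOpenPath d ω γ ∧ (∀ u ∈ γ, u ∈ C ∧ u ∈ boxZ d t z) ∧
    (∃ u ∈ γ, u i = z i - t) ∧ (∃ u ∈ γ, u i = z i + t)

/-- The event `𝓔_N`: some crossing open cluster of `Λ_{2N}` is avoided by a modified
geodesic `π ⊆ Λ_N` of diameter at least `N/2` belonging to `𝔾_*(Λ_{tN})`. -/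
def ENevent (d n : ℕ) (t : ℝ) (N : ℕ) : Set (Config d) :=
  {ω | ∃ v0 : ZVec d, CrossesBox d ω (openClusterOf d ω v0) (2 * N) 0 ∧
    ∃ π : List (ZVec d), IsPath d π ∧ (∀ u ∈ π, u ∈ boxZ d N 0) ∧
      GstarIn d n ω (boxR d (t * N) 0) π ∧ DiamGE d π ((N : ℝ) / 2) ∧
      ∀ u ∈ π, u ∉ openClusterOf d ω v0}

/-- `ρ` is a Garet–Marchand moderate-deviation constant for the chemical distance. -/
def GMprop (d : ℕ) (μ : Measure (Config d)) (ρ : ℝ) : Prop :=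
  1 ≤ ρ ∧ ∃ c : ℝ, 0 < c ∧ ∀ x : ZVec d, ∀ t : ℝ, ρ * (normInf d x : ℝ) ≤ t →
    μ {ω | chemDist d ω 0 x ≠ ⊤ ∧ t ≤ ((chemDist d ω 0 x).toNat : ℝ)}
      ≤ ENNReal.ofReal (c⁻¹ * Real.exp (-c * t)) ∧
    μ {ω | t ≤ ((chemDist d ω (starPt d ω 0) (starPt d ω x)).toNat : ℝ) ∨
        chemDist d ω (starPt d ω 0) (starPt d ω x) = ⊤}
      ≤ ENNReal.ofReal (c⁻¹ * Real.exp (-c * t))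

/-- `cs` is a constant for which the crossing-cluster avoidance lemma holds. -/
def CrossProp (d : ℕ) (μ : Measure (Config d)) (cs : ℝ) : Prop :=
  0 < cs ∧ cs < 1 ∧ ∀ n : ℕ, 2 ≤ n → ∀ t : ℝ, 1 / cs ≤ t → ∀ N : ℕ, 1 ≤ N →
    (N : ℝ) ≤ Real.exp (cs * (Real.log n) ^ 2) →
    μ (ENevent d n t N) ≤ ENNReal.ofReal (cs⁻¹ * Real.exp (-cs * N))

/-- `N_ρ = ⌊N / (16 ρ²)⌋`. -/
def Nrho (ρ : ℝ) (N : ℕ) : ℕ := Nat.floor ((N : ℝ) / (16 * ρ ^ 2))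

/-- The cube of side-length `m` with lower corner `z`. -/
def cube (d : ℕ) (m : ℕ) (z : ZVec d) : Set (ZVec d) :=
  {y | ∀ i, z i ≤ y i ∧ y i ≤ z i + m}

/-- The open cluster of `v` inside `U`. -/
def clusterIn (d : ℕ) (ω : Config d) (U : Set (ZVec d)) (v : ZVec d) : Set (ZVec d) :=
  {y | chemDistIn d ω U v y ≠ ⊤}

/-- `k ≤ r` for `k : ℕ∞` and `r : ℝ` (in particular `k` is finite). -/
def chemLE (k : ℕ∞) (r : ℝ) : Prop := ∃ m : ℕ, k = (m : ℕ∞) ∧ (m : ℝ) ≤ r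

/-- The box `Λ_{3N}(e)` is good (Definition 2.2 of the paper). -/
def GoodBox (d n : ℕ) (ρ Cstar : ℝ) (e : EdgeD d) (N : ℕ) (ω : Config d) : Prop :=
  (∃ v0 ∈ boxZ d (3 * N) e.val.1,
    (∀ z : ZVec d, cube d (Nrho ρ N) z ⊆ boxZ d (3 * N) e.val.1 →
      ∀ i : Fin d, ∃ γ, IsPath d γ ∧ IsOpenPath d ω γ ∧
        (∀ u ∈ γ, u ∈ clusterIn d ω (boxZ d (3 * N) e.val.1) v0 ∧ u ∈ cube d (Nrho ρ N) z) ∧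
        (∃ u ∈ γ, u i = z i) ∧ (∃ u ∈ γ, u i = z i + (Nrho ρ N : ℤ))) ∧
    (∀ π, IsPath d π → (∀ u ∈ π, u ∈ boxZ d (3 * N) e.val.1) →
      GstarIn d n ω (boxR d (Cstar * N) e.val.1) π → DiamGE d π ((Nrho ρ N : ℝ)) →
      ∃ u ∈ π, u ∈ clusterIn d ω (boxZ d (3 * N) e.val.1) v0)) ∧
  (∀ x y : ZVec d, x ∈ boxZ d (3 * N) e.val.1 → y ∈ boxZ d (3 * N) e.val.1 →
    normInf d (x - y) ≤ 2 * Nrho ρ N → chemDist d ω x y ≠ ⊤ →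
    chemDistIn d ω (boxZ d (4 * N) e.val.1) x y = chemDist d ω x y ∧
    chemLE (chemDist d ω x y) (4 * ρ * (Nrho ρ N : ℝ))) ∧
  (∀ x y : ZVec d, x ∈ annulus d N e → y ∈ annulus d N e →
    (∀ b : ZVec d, (normInf d (b - e.val.1) = N ∨ normInf d (b - e.val.1) = 3 * N) →
      (N : ℝ) / 2 ≤ (normInf d (x - b) : ℝ) ∧ (N : ℝ) / 2 ≤ (normInf d (y - b) : ℝ)) →
    normInf d (x - y) ≤ 2 * Nrho ρ N → chemDist d ω x y ≠ ⊤ →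
    chemDistIn d ω (annulus d N e) x y = chemDist d ω x y ∧
    chemLE (chemDist d ω x y) (4 * ρ * (Nrho ρ N : ℝ)))

/-- Evaluate an edge-indexed function at the (unordered) pair `{x,y}`, `0` if not an edge. -/
def edgeFnVal (d : ℕ) (g : EdgeD d → ℝ) (x y : ZVec d) : ℝ :=
  if h : ∃ e : EdgeD d, e.val = (x, y) ∨ e.val = (y, x) then g h.choose else 0

/-- The sum of `g` over the edges of the path `γ`. -/
def pathSum (d : ℕ) (g : EdgeD d → ℝ) (γ : List (ZVec d)) : ℝ :=
  ((γ.zip γ.tail).map fun pr => edgeFnVal d g pr.1 pr.2).sum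

/-- Number of edges of `η` that are not edges of `γ`, i.e. `|η \ γ|`. -/
def diffEdgeCount (d : ℕ) (η γ : List (ZVec d)) : ℕ :=
  ((η.zip η.tail).filter fun pr => decide (¬ edgeMemPath d pr.1 pr.2 γ)).length

/-- Maximal total weight of a lattice animal (path) in `Ξ_L`. -/
def animalMax (d : ℕ) (L : ℕ) (g : EdgeD d → ℝ) : ℝ :=
  sSup {r : ℝ | ∃ γ : List (ZVec d), IsPath d γ ∧ (∀ v ∈ γ, v ∈ boxZ d L 0) ∧
    γ.length ≤ L + 1 ∧ r = pathSum d g γ}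

/-- `m = ⌊n^{1/4}⌋`. -/
def mOf (n : ℕ) : ℕ := Nat.floor ((n : ℝ) ^ ((1 : ℝ) / 4))

/-- The box `Λ_m` as a finite set. -/
def boxFinset (d m : ℕ) : Finset (ZVec d) := Finset.Icc (fun _ => -(m : ℤ)) (fun _ => (m : ℤ))

/-- The spatially averaged passage time `F_m`. -/
def Fm (d n : ℕ) (ω : Config d) : ℝ :=
  (∑ z ∈ boxFinset d (mOf n), passageTime d n ω z (z + ptE1 d n)) / (boxFinset d (mOf n)).card

/-- The σ-algebra generated by the states of the first `i` edges. -/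
def edgeFiltration (d : ℕ) (ε : ℕ ≃ EdgeD d) (i : ℕ) : MeasurableSpace (Config d) :=
  MeasurableSpace.comap (fun ω (j : Fin i) => ω (ε j)) MeasurableSpace.pi

/-- The martingale increment `Δ_i = E[e^{λ F_m} | 𝓕_i] − E[e^{λ F_m} | 𝓕_{i−1}]`. -/
def mgDelta (d n : ℕ) (ε : ℕ ≃ EdgeD d) (lam : ℝ) (μ : Measure (Config d)) (i : ℕ) :
    Config d → ℝ :=
  fun ω => (μ[fun ω' => Real.exp (lam * Fm d n ω') | edgeFiltration d ε i]) ω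
    - (μ[fun ω' => Real.exp (lam * Fm d n ω') | edgeFiltration d ε (i - 1)]) ω

/-- The entropy `Ent[X] = E[X log (X / E[X])]`. -/
def entOf {α : Type*} [MeasurableSpace α] (μ : Measure α) (X : α → ℝ) : ℝ :=
  ∫ ω, X ω * Real.log (X ω / ∫ ω', X ω' ∂μ) ∂μ

end Perco
namespace Perco

/-! ### The lattice norms -/

section Lattice

variable {d : ℕ}

lemma normInf_le_iff {x : ZVec d} {k : ℕ} : normInf d x ≤ k ↔ ∀ i, (x i).natAbs ≤ k := by
  simp [normInf, Finset.sup_le_iff]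

lemma natAbs_le_normInf (x : ZVec d) (i : Fin d) : (x i).natAbs ≤ normInf d x :=
  normInf_le_iff.1 le_rfl i

lemma normInf_neg (x : ZVec d) : normInf d (-x) = normInf d x := by
  simp [normInf]

lemma normInf_sub_comm (x y : ZVec d) : normInf d (x - y) = normInf d (y - x) := by
  rw [← normInf_neg, neg_sub]

lemma normInf_zero : normInf d 0 = 0 := by
  have : normInf d 0 ≤ 0 := normInf_le_iff.2 (by simp)
  omega

lemma normInf_add_le (x y : ZVec d) : normInf d (x + y) ≤ normInf d x + normInf d y := by
  rw [normInf_le_iff]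
  intro i
  have h1 := natAbs_le_normInf x i
  have h2 := natAbs_le_normInf y i
  have h3 := Int.natAbs_add_le (x i) (y i)
  simp only [Pi.add_apply]
  omega

lemma normInf_sub_le (x y z : ZVec d) :
    normInf d (x - z) ≤ normInf d (x - y) + normInf d (y - z) := by
  have := normInf_add_le (x - y) (y - z)
  simpa using this

lemma normInf_eq_zero {x : ZVec d} : normInf d x = 0 ↔ x = 0 := by
  constructor
  · intro h
    ext i
    have := natAbs_le_normInf x i
    simp only [Pi.zero_apply]
    omega
  · rintro rfl
    exact normInf_zero

lemma exists_natAbs_eq_normInf (x : ZVec d) (h : 0 < normInf d x) :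
    ∃ i, (x i).natAbs = normInf d x := by
  by_contra hc
  push Not at hc
  have h1 : normInf d x ≤ normInf d x - 1 := by
    rw [normInf_le_iff]
    intro i
    have := natAbs_le_normInf x i
    have := hc i
    omega
  omega

lemma Adj.normInf_le {x y : ZVec d} (h : Adj d x y) : normInf d (x - y) ≤ 1 := by
  rw [normInf_le_iff]
  intro i
  have : ((x - y) i).natAbs ≤ norm1 d (x - y) :=
    Finset.single_le_sum (f := fun i => ((x - y) i).natAbs) (fun _ _ => Nat.zero_le _)
      (Finset.mem_univ i)
  rw [h] at this
  exact this

lemma norm1_neg (x : ZVec d) : norm1 d (-x) = norm1 d x := by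
  simp [norm1]

lemma Adj.symm {x y : ZVec d} (h : Adj d x y) : Adj d y x := by
  unfold Adj at *
  rw [← norm1_neg, neg_sub, h]

lemma Adj.ne {x y : ZVec d} (h : Adj d x y) : x ≠ y := by
  rintro rfl
  simp [Adj, norm1] at h

lemma EdgeOpen.symm {ω : Config d} {x y : ZVec d} (h : EdgeOpen d ω x y) : EdgeOpen d ω y x := by
  obtain ⟨e, he, ho⟩ := h
  exact ⟨e, he.symm, ho⟩

lemma EdgeOpen.adj {ω : Config d} {x y : ZVec d} (h : EdgeOpen d ω x y) : Adj d x y := by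
  obtain ⟨e, he, -⟩ := h
  have h1 : Adj d e.val.1 e.val.2 := e.2.1
  rcases he with he | he
  · rw [he] at h1
    exact h1
  · rw [he] at h1
    exact h1.symm

lemma mem_boxZ {t : ℕ} {z y : ZVec d} : y ∈ boxZ d t z ↔ normInf d (y - z) ≤ t := Iff.rfl

lemma boxZ_subset_boxZ {s t : ℕ} {x z : ZVec d} (h : normInf d (x - z) + s ≤ t) :
    boxZ d s x ⊆ boxZ d t z := by
  intro y hy
  have := normInf_sub_le y x z
  simp only [mem_boxZ] at *
  omega

lemma finite_boxZ (t : ℕ) (z : ZVec d) : (boxZ d t z).Finite := by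
  apply (Set.finite_Icc (fun i => z i - t : ZVec d) (fun i => z i + t)).subset
  intro y hy
  rw [mem_boxZ, normInf_le_iff] at hy
  simp only [Set.mem_Icc, Pi.le_def]
  constructor <;> intro i <;> have := hy i <;> simp only [Pi.sub_apply] at this <;> omega

lemma ncard_boxZ (t : ℕ) (z : ZVec d) : (boxZ d t z).ncard = (2 * t + 1) ^ d := by
  have h : boxZ d t z = ↑(Finset.Icc (fun i => z i - t : ZVec d) (fun i => z i + t)) := by
    ext y
    rw [mem_boxZ, normInf_le_iff]
    simp only [Finset.coe_Icc, Set.mem_Icc, Pi.le_def]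
    constructor
    · intro hy
      constructor <;> intro i <;> have := hy i <;> simp only [Pi.sub_apply] at this <;> omega
    · rintro ⟨h1, h2⟩ i
      have := h1 i
      have := h2 i
      simp only [Pi.sub_apply]
      omega
  rw [h, Set.ncard_coe_finset, Pi.card_Icc]
  simp only [Int.card_Icc]
  rw [Finset.prod_congr rfl (g := fun _ => 2 * t + 1) (fun i _ => by omega)]
  simp

/-! ### Splitting lists -/

lemma List.exists_prefix_hit {V : Type*} {R : V → V → Prop} (f : V → ℤ)
    (hf : ∀ x y, R x y → |f x - f y| ≤ 1) (t : ℤ) :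
    ∀ l : List V, l.IsChain R → ∀ a, l.head? = some a → f a ≤ t → (∃ b ∈ l, t ≤ f b) →
      ∃ l₁ l₂ b, l = l₁ ++ b :: l₂ ∧ f b = t ∧ (∀ v ∈ l₁, f v < t) ∧
        (l₁ ++ [b]).head? = some a := by
  intro l
  induction l with
  | nil => intro _ a ha; simp at ha
  | cons x l ih =>
    intro hl a ha hat hb
    simp only [List.head?_cons, Option.some.injEq] at ha
    subst ha
    rcases eq_or_lt_of_le hat with h | h
    · exact ⟨[], l, x, by simp, h, by simp, by simp⟩
    · have hb' : ∃ b ∈ l, t ≤ f b := by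
        obtain ⟨b, hb, hb2⟩ := hb
        rcases List.mem_cons.1 hb with rfl | hb
        · omega
        · exact ⟨b, hb, hb2⟩
      cases l with
      | nil => simp at hb'
      | cons y l =>
        rw [List.isChain_cons_cons] at hl
        have h1 := hf _ _ hl.1
        rw [abs_le] at h1
        obtain ⟨l₁, l₂, b, h2, h3, h4, h5⟩ := ih hl.2 y (by simp) (by omega) hb'
        refine ⟨x :: l₁, l₂, b, by simp [h2], h3, ?_, by simp⟩
        intro v hv
        rcases List.mem_cons.1 hv with rfl | hv
        · exact h
        · exact h4 v hv

lemma List.exists_suffix_hit {V : Type*} {R : V → V → Prop} (f : V → ℤ)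
    (hf : ∀ x y, R x y → |f x - f y| ≤ 1) (t : ℤ)
    (l : List V) (hl : l.IsChain R) (a : V) (ha : l.getLast? = some a) (hat : f a ≤ t)
    (hb : ∃ b ∈ l, t ≤ f b) :
    ∃ l₁ l₂ b, l = l₁ ++ b :: l₂ ∧ f b = t ∧ (∀ v ∈ l₂, f v < t) ∧
        (b :: l₂).getLast? = some a := by
  obtain ⟨l₁, l₂, b, h1, h2, h3, h4⟩ := List.exists_prefix_hit (R := fun x y => R y x) f
    (fun x y h => by rw [abs_sub_comm]; exact hf y x h) t l.reverse
    (List.isChain_reverse.2 hl) a (by simpa using ha) hat (by simpa using hb)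
  refine ⟨l₂.reverse, l₁.reverse, b, ?_, h2, by simpa using h3, ?_⟩
  · rw [← List.reverse_reverse l, h1]
    simp
  · rw [← h4, ← List.head?_reverse]
    simp

lemma List.exists_segment_between {V : Type*} {R : V → V → Prop} (f : V → ℤ)
    (hf : ∀ x y, R x y → |f x - f y| ≤ 1) (s t : ℤ) (hst : s ≤ t)
    (l : List V) (hl : l.IsChain R) (a b : V) (ha : l.head? = some a) (hb : l.getLast? = some b)
    (has : f a ≤ s) (hbt : t ≤ f b) :
    ∃ l' u v, l' <:+: l ∧ u ∈ l' ∧ v ∈ l' ∧ f u = s ∧ f v = t ∧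
      (∀ x ∈ l', s ≤ f x ∧ f x ≤ t) := by
  have hbl : b ∈ l := List.mem_of_getLast? hb
  obtain ⟨l₁, l₂, v, h1, h2, h3, h4⟩ := List.exists_prefix_hit f hf t l hl a ha (by omega)
    ⟨b, hbl, hbt⟩
  have hpre : (l₁ ++ [v]).IsChain R := by
    rw [h1, ← List.singleton_append, ← List.append_assoc] at hl
    exact (List.isChain_append.1 hl).1
  obtain ⟨m₁, m₂, u, k1, k2, k3, k4⟩ := List.exists_suffix_hit (R := R) (fun x => - f x)
    (fun x y h => by
      have := hf x y h
      rw [abs_le] at *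
      constructor <;> omega) (-s) (l₁ ++ [v]) hpre v (by simp) (by omega)
    ⟨a, List.mem_of_head? h4, by omega⟩
  refine ⟨u :: m₂, u, v, ?_, by simp, List.mem_of_getLast? k4, by omega, h2, ?_⟩
  · exact ⟨m₁, l₂, by rw [← k1, h1]; simp⟩
  · intro x hx
    have hx' : x ∈ l₁ ++ [v] := by rw [k1]; exact List.mem_append_right _ hx
    constructor
    · rcases List.mem_cons.1 hx with rfl | hx
      · omega
      · have := k3 x hx
        omega
    · rcases List.mem_append.1 hx' with hx' | hx'
      · exact (h3 x hx').le
      · simp at hx'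
        subst hx'
        exact h2.le

/-! ### Open connections of bounded length -/

/-- The graph of open edges with both endpoints in `U`. -/
def openGraph (ω : Config d) (U : Set (ZVec d)) : SimpleGraph (ZVec d) where
  Adj x y := x ∈ U ∧ y ∈ U ∧ EdgeOpen d ω x y
  symm := ⟨fun _ _ h => ⟨h.2.1, h.1, h.2.2.symm⟩⟩
  loopless := ⟨fun _ h => h.2.2.adj.ne rfl⟩

/-- `x` and `y` are joined by an open path inside `U` with at most `L` edges. -/
def OpenConn (ω : Config d) (U : Set (ZVec d)) (x y : ZVec d) (L : ℕ) : Prop :=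
  x ∈ U ∧ ∃ w : (openGraph ω U).Walk x y, w.length ≤ L

namespace OpenConn

variable {ω : Config d} {U U' : Set (ZVec d)} {x y z : ZVec d} {L L' : ℕ}

lemma refl (hx : x ∈ U) (L : ℕ) : OpenConn ω U x x L := ⟨hx, .nil, by simp⟩

lemma mem_of_walk (hx : x ∈ U) (w : (openGraph ω U).Walk x y) : ∀ v ∈ w.support, v ∈ U := by
  induction w with
  | nil => simpa using hx
  | cons h w ih =>
    intro v hv
    rw [SimpleGraph.Walk.support_cons, List.mem_cons] at hv
    rcases hv with rfl | hv
    · exact hx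
    · exact ih h.2.1 v hv

lemma right_mem (h : OpenConn ω U x y L) : y ∈ U := by
  obtain ⟨hx, w, -⟩ := h
  exact mem_of_walk hx w y (by simp)

lemma symm (h : OpenConn ω U x y L) : OpenConn ω U y x L := by
  obtain ⟨w, hw⟩ := h.2
  exact ⟨h.right_mem, w.reverse, by simpa using hw⟩

lemma trans (h : OpenConn ω U x y L) (h' : OpenConn ω U y z L') :
    OpenConn ω U x z (L + L') := by
  obtain ⟨hx, w, hw⟩ := h
  obtain ⟨-, w', hw'⟩ := h'
  exact ⟨hx, w.append w', by rw [SimpleGraph.Walk.length_append]; omega⟩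

lemma mono (h : OpenConn ω U x y L) (hU : U ⊆ U') (hL : L ≤ L') : OpenConn ω U' x y L' := by
  obtain ⟨hx, w, hw⟩ := h
  have hle : openGraph ω U ≤ openGraph ω U' := fun a b hab => ⟨hU hab.1, hU hab.2.1, hab.2.2⟩
  exact ⟨hU hx, w.mapLe hle, by simp; omega⟩

lemma single (hx : x ∈ U) (hy : y ∈ U) (h : EdgeOpen d ω x y) : OpenConn ω U x y 1 :=
by
  have hxy : (openGraph ω U).Adj x y := ⟨hx, hy, h⟩
  exact ⟨hx, hxy.toWalk, by simp⟩

lemma inter_box (h : OpenConn ω U x y L) : OpenConn ω (U ∩ boxZ d L x) x y L := by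
  obtain ⟨hx, w, hw⟩ := h
  have key : ∀ (a b : ZVec d) (w : (openGraph ω U).Walk a b) (n : ℕ), a ∈ U →
      n + w.length ≤ L → normInf d (a - x) ≤ n →
      OpenConn ω (U ∩ boxZ d L x) a b w.length := by
    intro a b w
    induction w with
    | @nil a =>
    intro n ha hn hax
    have hn' : n ≤ L := by omega
    have ha' : a ∈ U ∩ boxZ d L x := ⟨ha, mem_boxZ.2 (hax.trans hn')⟩
    exact OpenConn.refl ha' _
    | @cons a c b hac w ih =>
      intro n ha hn hax
      rw [SimpleGraph.Walk.length_cons] at hn ⊢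
      have hc : normInf d (c - x) ≤ n + 1 := by
        have h1 := normInf_sub_le c a x
        have h2 := hac.2.2.adj.symm.normInf_le
        omega
      have h1 := ih (n + 1) hac.2.1 (by omega) hc
      have h2 : OpenConn ω (U ∩ boxZ d L x) a c 1 :=
        single ⟨ha, mem_boxZ.2 (by omega)⟩ h1.1 hac.2.2
      rw [add_comm]
      exact h2.trans h1
  exact (key x y w 0 hx (by omega) (by simp [normInf_zero])).mono subset_rfl hw

lemma of_chain {γ : List (ZVec d)} (hne : γ ≠ []) (hγ : IsOpenPath d ω γ)
    (hU : ∀ v ∈ γ, v ∈ U) (hx : γ.head? = some x) (hy : γ.getLast? = some y) :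
    OpenConn ω U x y (γ.length - 1) := by
  induction γ generalizing x with
  | nil => simp at hne
  | cons a γ ih =>
    simp only [List.head?_cons, Option.some.injEq] at hx
    subst hx
    cases γ with
    | nil =>
      simp at hy
      subst hy
      exact refl (hU _ (by simp)) _
    | cons b γ =>
      change List.IsChain _ _ at hγ
      rw [List.isChain_cons_cons] at hγ
      have h1 := ih (x := b) (by simp) hγ.2 (fun v hv => hU v (by simp [hv])) (by simp)
        (by simpa using hy)
      have h2 : OpenConn ω U a b 1 := single (hU a (by simp)) (hU b (by simp)) hγ.1
      refine (h2.trans h1).mono subset_rfl ?_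
      simp
      omega

lemma exists_path (h : OpenConn ω U x y L) : ∃ γ : List (ZVec d), IsPath d γ ∧
    IsOpenPath d ω γ ∧ (∀ v ∈ γ, v ∈ U) ∧ γ.head? = some x ∧ γ.getLast? = some y ∧
    γ.length ≤ L + 1 := by
  obtain ⟨hx, w, hw⟩ := h
  have hc := w.bypass.isChain_adj_support
  refine ⟨w.bypass.support, ⟨by simp, w.bypass_isPath.support_nodup, ?_⟩, ?_,
    mem_of_walk hx _, ?_, ?_, ?_⟩
  · exact hc.imp fun a b hab => hab.2.2.adj
  · exact hc.imp fun a b hab => hab.2.2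
  · rw [List.head?_eq_some_head (by simp), SimpleGraph.Walk.head_support]
  · rw [List.getLast?_eq_some_getLast (by simp), SimpleGraph.Walk.getLast_support]
  · rw [SimpleGraph.Walk.length_support]
    have := w.length_bypass_le_length
    omega

lemma of_box (h : OpenConn ω U x y L) (hU : boxZ d L x ⊆ U') : OpenConn ω U' x y L :=
  h.inter_box.mono (Set.inter_subset_right.trans hU) le_rfl

end OpenConn

lemma chemDistIn_ne_top_iff {ω : Config d} {U : Set (ZVec d)} {x y : ZVec d} :
    chemDistIn d ω U x y ≠ ⊤ ↔ ∃ L, OpenConn ω U x y L := by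
  constructor
  · intro h
    have hne : {k : ℕ∞ | ∃ γ : List (ZVec d), IsPath d γ ∧ IsOpenPath d ω γ ∧ (∀ v ∈ γ, v ∈ U) ∧
        γ.head? = some x ∧ γ.getLast? = some y ∧ ((γ.length - 1 : ℕ) : ℕ∞) = k}.Nonempty := by
      by_contra hc
      rw [Set.not_nonempty_iff_eq_empty] at hc
      exact h (by rw [chemDistIn, hc, sInf_empty])
    obtain ⟨k, γ, h1, h2, h3, h4, h5, -⟩ := hne
    exact ⟨_, .of_chain h1.1 h2 h3 h4 h5⟩
  · rintro ⟨L, h⟩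
    obtain ⟨γ, h1, h2, h3, h4, h5, -⟩ := h.exists_path
    have : chemDistIn d ω U x y ≤ ((γ.length - 1 : ℕ) : ℕ∞) :=
      sInf_le ⟨γ, h1, h2, h3, h4, h5, rfl⟩
    exact ne_top_of_le_ne_top (ENat.natCast_ne_top _) this

lemma openConn_chemDistIn {ω : Config d} {U : Set (ZVec d)} {x y : ZVec d}
    (h : chemDistIn d ω U x y ≠ ⊤) : OpenConn ω U x y (chemDistIn d ω U x y).toNat := by
  have hne : {k : ℕ∞ | ∃ γ : List (ZVec d), IsPath d γ ∧ IsOpenPath d ω γ ∧ (∀ v ∈ γ, v ∈ U) ∧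
      γ.head? = some x ∧ γ.getLast? = some y ∧ ((γ.length - 1 : ℕ) : ℕ∞) = k}.Nonempty := by
    by_contra hc
    rw [Set.not_nonempty_iff_eq_empty] at hc
    exact h (by rw [chemDistIn, hc, sInf_empty])
  obtain ⟨γ, h1, h2, h3, h4, h5, h6⟩ := csInf_mem hne
  have h7 := OpenConn.of_chain h1.1 h2 h3 h4 h5
  have : chemDistIn d ω U x y = ((γ.length - 1 : ℕ) : ℕ∞) := h6.symm
  rw [this]
  exact h7

end Lattice

/-! ### Circuits around finite connected sets in the plane -/

section Planar

/-- Nearest-neighbour adjacency on `ℤ²`. -/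
def PlaneAdj (u v : ℤ × ℤ) : Prop := |u.1 - v.1| + |u.2 - v.2| = 1

/-- Adjacency on `ℤ²` including diagonal neighbours. -/
def StarAdj (u v : ℤ × ℤ) : Prop := u ≠ v ∧ |u.1 - v.1| ≤ 1 ∧ |u.2 - v.2| ≤ 1

lemma PlaneAdj.symm {u v : ℤ × ℤ} (h : PlaneAdj u v) : PlaneAdj v u := by
  unfold PlaneAdj at *
  rw [abs_sub_comm v.1, abs_sub_comm v.2]
  exact h

lemma planeAdj_iff {u v : ℤ × ℤ} : PlaneAdj u v ↔
    v = (u.1 + 1, u.2) ∨ u = (v.1 + 1, v.2) ∨ v = (u.1, u.2 + 1) ∨ u = (v.1, v.2 + 1) := by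
  obtain ⟨a, b⟩ := u
  obtain ⟨a', b'⟩ := v
  simp only [PlaneAdj, Prod.mk.injEq]
  constructor
  · intro h
    rcases abs_cases (a - a') with h1 | h1 <;> rcases abs_cases (b - b') with h2 | h2 <;> omega
  · intro h
    rcases abs_cases (a - a') with h1 | h1 <;> rcases abs_cases (b - b') with h2 | h2 <;> omega

/-- The subgraph of the nearest-neighbour lattice `ℤ²` spanned by `S`. -/
def planeGraph (S : Set (ℤ × ℤ)) : SimpleGraph (ℤ × ℤ) where
  Adj u v := u ∈ S ∧ v ∈ S ∧ PlaneAdj u v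
  symm := ⟨fun _ _ h => ⟨h.2.1, h.1, h.2.2.symm⟩⟩
  loopless := ⟨fun u h => by simpa [PlaneAdj] using h.2.2⟩

/-- The subgraph of `ℤ²` with diagonals spanned by `S`. -/
def starGraph (S : Set (ℤ × ℤ)) : SimpleGraph (ℤ × ℤ) where
  Adj u v := u ∈ S ∧ v ∈ S ∧ StarAdj u v
  symm := ⟨fun u v h => ⟨h.2.1, h.1, h.2.2.1.symm, by rw [abs_sub_comm]; exact h.2.2.2.1,
    by rw [abs_sub_comm]; exact h.2.2.2.2⟩⟩
  loopless := ⟨fun _ h => h.2.2.1 rfl⟩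

lemma exists_primitive {G : Type*} [AddCommGroup G] (f : ℤ → G) :
    ∃ F : ℤ → G, F 0 = 0 ∧ ∀ n, F (n + 1) - F n = f n := by
  refine ⟨fun n => (∑ i ∈ Finset.range n.toNat, f i) -
    ∑ i ∈ Finset.range (-n).toNat, f (-(i + 1 : ℕ)), by simp, ?_⟩
  intro n
  rcases le_or_gt 0 n with h | h
  · have h1 : (n + 1).toNat = n.toNat + 1 := by omega
    have h2 : (-n).toNat = 0 := by omega
    have h3 : (-(n + 1)).toNat = 0 := by omega
    have h4 : ((n.toNat : ℕ) : ℤ) = n := by omega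
    simp only [h1, h2, h3, Finset.sum_range_succ, h4]
    simp
  · have h1 : (n + 1).toNat = 0 := by omega
    have h2 : (-n).toNat = (-(n + 1)).toNat + 1 := by omega
    have h3 : n.toNat = 0 := by omega
    have h4 : -(((-(n + 1)).toNat + 1 : ℕ) : ℤ) = n := by omega
    simp only [h1, h2, h3, Finset.sum_range_succ, h4]
    simp

lemma int_const_of_succ_eq {G : Type*} (f : ℤ → G) (h : ∀ n, f (n + 1) = f n) (n : ℤ) :
    f n = f 0 := by
  induction n using Int.induction_on with
  | zero => rfl
  | succ i ih => rw [h, ih]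
  | pred i ih => rw [← ih, ← h (-(i : ℤ) - 1)]; simp

lemma exists_potential {G : Type*} [AddCommGroup G] (h v : ℤ → ℤ → G)
    (hc : ∀ x y, h x y + v (x + 1) y = v x y + h x (y + 1)) :
    ∃ g : ℤ → ℤ → G, (∀ x y, g (x + 1) y - g x y = h x y) ∧
      ∀ x y, g x (y + 1) - g x y = v x y := by
  obtain ⟨H, -, hH⟩ := exists_primitive (fun x => h x 0)
  choose V hV0 hV using fun x => exists_primitive (v x)
  refine ⟨fun x y => H x + V x y, ?_, ?_⟩
  · intro x y
    have key := int_const_of_succ_eq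
      (fun y => H (x + 1) + V (x + 1) y - (H x + V x y) - h x y) (by
        intro n
        have h1 := hV x n
        have h2 := hV (x + 1) n
        have h3 := hc x n
        have e1 : V x (n + 1) = v x n + V x n := by rw [← h1]; abel
        have e2 : V (x + 1) (n + 1) = v (x + 1) n + V (x + 1) n := by rw [← h2]; abel
        have e3 : h x (n + 1) = h x n + v (x + 1) n - v x n := by rw [h3]; abel
        simp only [e1, e2, e3]
        abel) y
    simp only [hV0, add_zero, hH, sub_self] at key
    exact sub_eq_zero.1 key
  · intro x y
    rw [← hV x y, add_sub_add_left_eq_sub]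

lemma reachable_row (S : Set (ℤ × ℤ)) (a b s : ℤ) (hab : a ≤ b)
    (h : ∀ t, a ≤ t → t ≤ b → (t, s) ∈ S) : (planeGraph S).Reachable (a, s) (b, s) := by
  induction b, hab using Int.leInduction with
  | base => rfl
  | succ n hn ih =>
    refine (ih fun t h1 h2 => h t h1 (by omega)).trans (SimpleGraph.Adj.reachable ?_)
    exact ⟨h n hn (by omega), h (n + 1) (by omega) le_rfl, planeAdj_iff.2 (by simp)⟩

lemma reachable_column (S : Set (ℤ × ℤ)) (a b s : ℤ) (hab : a ≤ b)
    (h : ∀ t, a ≤ t → t ≤ b → (s, t) ∈ S) : (planeGraph S).Reachable (s, a) (s, b) := by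
  induction b, hab using Int.leInduction with
  | base => rfl
  | succ n hn ih =>
    refine (ih fun t h1 h2 => h t h1 (by omega)).trans (SimpleGraph.Adj.reachable ?_)
    exact ⟨h n hn (by omega), h (n + 1) (by omega) le_rfl, planeAdj_iff.2 (by simp)⟩

lemma eq_of_reachable {V α : Type*} {G : SimpleGraph V} (g : V → α)
    (h : ∀ u v, G.Adj u v → g u = g v) {u v : V} (huv : G.Reachable u v) : g u = g v := by
  obtain ⟨w⟩ := huv
  induction w with
  | nil => rfl
  | cons h1 _ ih => rw [h _ _ h1, ih]

/-- The outer boundary of a finite connected set containing a horizontal segment contains a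
path (with diagonal steps) from one side of the segment to the other. -/
lemma exists_star_reachable (A Bad : Set (ℤ × ℤ)) (hA : A.Finite) (m : ℕ)
    (hI : ∀ i : ℤ, 0 ≤ i → i ≤ m → (i, 0) ∈ A)
    (hconn : ∀ v ∈ A, (planeGraph A).Reachable (0, 0) v)
    (hout : ∀ u ∈ A, ∀ v ∉ A, PlaneAdj u v → v ∈ Bad) :
    ∃ x y : ℤ, (m : ℤ) < x ∧ y < 0 ∧ (x, 0) ∈ Bad ∧
      (starGraph Bad).Reachable (x, 0) (y, 0) := by
  obtain ⟨N, hN⟩ : ∃ N : ℤ, ∀ v ∈ A, |v.1| < N ∧ |v.2| < N := by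
    obtain ⟨N, hN⟩ := (hA.image fun v => max |v.1| |v.2|).bddAbove
    refine ⟨N + 1, fun v hv => ?_⟩
    have := hN (Set.mem_image_of_mem _ hv)
    omega
  have h00 : ((0 : ℤ), (0 : ℤ)) ∈ A := hI 0 le_rfl (by omega)
  have hN0 := (hN _ h00).1
  simp only [abs_zero] at hN0
  obtain ⟨x₁, hx₁, hx₁max⟩ := Int.exists_greatest_of_bdd (P := fun x => ((x, 0) : ℤ × ℤ) ∈ A)
    ⟨N, fun z hz => by have := (hN _ hz).1; rw [abs_lt] at this; exact this.2.le⟩ ⟨0, h00⟩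
  obtain ⟨y₁, hy₁, hy₁min⟩ := Int.exists_least_of_bdd (P := fun x => ((x, 0) : ℤ × ℤ) ∈ A)
    ⟨-N, fun z hz => by have := (hN _ hz).1; rw [abs_lt] at this; exact this.1.le⟩ ⟨0, h00⟩
  have hxm : (m : ℤ) ≤ x₁ := hx₁max m (hI m (by omega) le_rfl)
  have hx₁N : x₁ < N := by have := (hN _ hx₁).1; rw [abs_lt] at this; exact this.2
  have hy₁N : -N < y₁ := by have := (hN _ hy₁).1; rw [abs_lt] at this; exact this.1
  have hy0 : y₁ ≤ 0 := hy₁min 0 h00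
  have hfar : ∀ v : ℤ × ℤ, (N ≤ v.1 ∨ v.1 ≤ -N ∨ N ≤ v.2) → v ∈ Aᶜ := by
    intro v hv hvA
    have h1 := hN v hvA
    rw [abs_lt, abs_lt] at h1
    omega
  have hxA : ((x₁ + 1, 0) : ℤ × ℤ) ∈ Aᶜ := fun h => by have := hx₁max _ h; omega
  have hyA : ((y₁ - 1, 0) : ℤ × ℤ) ∈ Aᶜ := fun h => by have := hy₁min _ h; omega
  have hreach : (planeGraph Aᶜ).Reachable (x₁ + 1, 0) (y₁ - 1, 0) := by
    have r1 : (planeGraph Aᶜ).Reachable (x₁ + 1, 0) (N, 0) :=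
      reachable_row _ _ _ _ (by omega) fun t h1 h2 h => by have := hx₁max _ h; omega
    have r2 : (planeGraph Aᶜ).Reachable (N, 0) (N, N) :=
      reachable_column _ _ _ _ (by omega) fun t h1 h2 => hfar _ (Or.inl le_rfl)
    have r3 : (planeGraph Aᶜ).Reachable (-N, N) (N, N) :=
      reachable_row _ _ _ _ (by omega) fun t h1 h2 => hfar _ (Or.inr (Or.inr le_rfl))
    have r4 : (planeGraph Aᶜ).Reachable (-N, 0) (-N, N) :=
      reachable_column _ _ _ _ (by omega) fun t h1 h2 => hfar _ (Or.inr (Or.inl le_rfl))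
    have r5 : (planeGraph Aᶜ).Reachable (-N, 0) (y₁ - 1, 0) :=
      reachable_row _ _ _ _ (by omega) fun t h1 h2 h => by have := hy₁min _ h; omega
    exact r1.trans (r2.trans (r3.symm.trans (r4.symm.trans r5)))
  set B : Set (ℤ × ℤ) := {v | v ∈ Aᶜ ∧ (planeGraph Aᶜ).Reachable (x₁ + 1, 0) v} with hB
  have hBA : ∀ v ∈ B, v ∉ A := fun v hv => hv.1
  have hBadj : ∀ u v, PlaneAdj u v → u ∈ B → v ∉ B → v ∈ A := by
    intro u v huv hu hv
    by_contra hvA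
    exact hv ⟨hvA, hu.2.trans (SimpleGraph.Adj.reachable ⟨hu.1, hvA, huv⟩)⟩
  set O : Set (ℤ × ℤ) := {v | v ∈ B ∧ ∃ a ∈ A, PlaneAdj a v} with hO
  have hOBad : O ⊆ Bad := by
    rintro v ⟨hv, a, ha, hav⟩
    exact hout a ha v hv.1 hav
  set W : Set (ℤ × ℤ) := {v | v ∈ O ∧ (starGraph O).Reachable (x₁ + 1, 0) v} with hW
  have hWnear : ∀ u v, |u.1 - v.1| ≤ 1 → |u.2 - v.2| ≤ 1 → u ∈ W → v ∈ O → v ∈ W := by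
    intro u v h1 h2 hu hv
    by_cases huv : u = v
    · exact huv ▸ hu
    · exact ⟨hv, hu.2.trans (SimpleGraph.Adj.reachable ⟨hu.1, hv, huv, h1, h2⟩)⟩
  obtain ⟨cut, hcut⟩ : ∃ cut : ℤ × ℤ → ℤ × ℤ → ZMod 2, ∀ u v, cut u v =
      if (u ∈ A ∧ v ∈ W) ∨ (v ∈ A ∧ u ∈ W) then 1 else 0 := ⟨_, fun _ _ => rfl⟩
  obtain ⟨β, hβ⟩ : ∃ β : ℤ × ℤ → ZMod 2, ∀ u, β u = if u ∈ B then 1 else 0 :=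
    ⟨_, fun _ => rfl⟩
  have hWB : ∀ v ∈ W, v ∈ B := fun v hv => hv.1.1
  have cut_comm : ∀ u v, cut u v = cut v u := by
    intro u v
    simp only [hcut]
    congr 1
    rw [or_comm]
  have cut_near : ∀ w ∈ W, ∀ u v, |w.1 - u.1| ≤ 1 → |w.2 - u.2| ≤ 1 → |w.1 - v.1| ≤ 1 →
      |w.2 - v.2| ≤ 1 → PlaneAdj u v → cut u v = β u + β v := by
    have aux : ∀ w ∈ W, ∀ u v, |w.1 - v.1| ≤ 1 → |w.2 - v.2| ≤ 1 → PlaneAdj u v →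
        u ∉ B → v ∈ B → cut u v = 1 := by
      intro w hw u v h3 h4 huv hu hv
      have huA : u ∈ A := hBadj v u huv.symm hv hu
      have hvW : v ∈ W := hWnear w v h3 h4 hw ⟨hv, u, huA, huv⟩
      simp [hcut, huA, hvW]
    intro w hw u v h1 h2 h3 h4 huv
    by_cases hu : u ∈ B <;> by_cases hv : v ∈ B
    · have e1 : u ∉ A := hBA u hu
      have e2 : v ∉ A := hBA v hv
      simp only [hcut, hβ, e1, e2, hu, hv]
      simp
      decide
    · rw [cut_comm, aux w hw v u h1 h2 huv.symm hv hu]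
      simp [hβ, hu, hv]
    · rw [aux w hw u v h3 h4 huv hu hv]
      simp [hβ, hu, hv]
    · have e1 : u ∉ W := fun h => hu (hWB u h)
      have e2 : v ∉ W := fun h => hv (hWB v h)
      simp [hcut, hβ, e1, e2, hu, hv]
  have cut_zero : ∀ u v, u ∉ W → v ∉ W → cut u v = 0 := by
    intro u v hu hv
    simp [hcut, hu, hv]
  have z2 : ∀ a b c e : ZMod 2, a + b + (b + c) = a + e + (e + c) := by decide
  obtain ⟨g, hg1, hg2⟩ := exists_potential (fun x y => cut (x, y) (x + 1, y))
    (fun x y => cut (x, y) (x, y + 1)) (by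
      intro x y
      by_cases hw : ∃ w ∈ W, (w.1 = x ∨ w.1 = x + 1) ∧ (w.2 = y ∨ w.2 = y + 1)
      · obtain ⟨w, hw, h1, h2⟩ := hw
        have a1 : |w.1 - x| ≤ 1 := by rw [abs_le]; omega
        have a2 : |w.1 - (x + 1)| ≤ 1 := by rw [abs_le]; omega
        have a3 : |w.2 - y| ≤ 1 := by rw [abs_le]; omega
        have a4 : |w.2 - (y + 1)| ≤ 1 := by rw [abs_le]; omega
        change cut (x, y) (x + 1, y) + cut (x + 1, y) (x + 1, y + 1) =
          cut (x, y) (x, y + 1) + cut (x, y + 1) (x + 1, y + 1)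
        rw [cut_near w hw (x, y) (x + 1, y) a1 a3 a2 a3 (planeAdj_iff.2 (by simp)),
          cut_near w hw (x + 1, y) (x + 1, y + 1) a2 a3 a2 a4 (planeAdj_iff.2 (by simp)),
          cut_near w hw (x, y) (x, y + 1) a1 a3 a1 a4 (planeAdj_iff.2 (by simp)),
          cut_near w hw (x, y + 1) (x + 1, y + 1) a1 a4 a2 a4 (planeAdj_iff.2 (by simp))]
        exact z2 _ _ _ _
      · push Not at hw
        have n1 : ((x, y) : ℤ × ℤ) ∉ W := fun h => hw _ h (Or.inl rfl) |>.1 rfl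
        have n2 : ((x + 1, y) : ℤ × ℤ) ∉ W := fun h => hw _ h (Or.inr rfl) |>.1 rfl
        have n3 : ((x, y + 1) : ℤ × ℤ) ∉ W := fun h => hw _ h (Or.inl rfl) |>.2 rfl
        have n4 : ((x + 1, y + 1) : ℤ × ℤ) ∉ W := fun h => hw _ h (Or.inr rfl) |>.2 rfl
        rw [cut_zero _ _ n1 n2, cut_zero _ _ n2 n4, cut_zero _ _ n1 n3, cut_zero _ _ n3 n4])
  have zsub : ∀ a b c : ZMod 2, a - b = c → b + a = c := by decide
  let γ : ℤ × ℤ → ZMod 2 := fun v => g v.1 v.2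
  have hγ : ∀ u v, PlaneAdj u v → γ u + γ v = cut u v := by
    have aux : ∀ u v : ℤ × ℤ, (v = (u.1 + 1, u.2) ∨ v = (u.1, u.2 + 1)) → γ u + γ v = cut u v := by
      rintro ⟨a, b⟩ v (rfl | rfl)
      · exact zsub _ _ _ (hg1 a b)
      · exact zsub _ _ _ (hg2 a b)
    intro u v huv
    rcases planeAdj_iff.1 huv with h | h | h | h
    · exact aux u v (Or.inl h)
    · rw [add_comm, cut_comm]
      exact aux v u (Or.inl h)
    · exact aux u v (Or.inr h)
    · rw [add_comm, cut_comm]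
      exact aux v u (Or.inr h)
  have zeq : ∀ a b : ZMod 2, a + b = 0 → a = b := by decide
  have hγA : ∀ v ∈ A, γ (0, 0) = γ v := fun v hv =>
    eq_of_reachable (G := planeGraph A) γ (by
      rintro u v ⟨hu, hv, huv⟩
      refine zeq _ _ ?_
      rw [hγ u v huv]
      exact cut_zero _ _ (fun h => hBA _ (hWB _ h) hu) (fun h => hBA _ (hWB _ h) hv)) (hconn v hv)
  have hγB : γ (x₁ + 1, 0) = γ (y₁ - 1, 0) :=
    eq_of_reachable (G := planeGraph Aᶜ) γ (by
      rintro u v ⟨hu, hv, huv⟩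
      refine zeq _ _ ?_
      rw [hγ u v huv]
      have hu' : u ∉ A := hu
      have hv' : v ∉ A := hv
      simp [hcut, hu', hv']) hreach
  have hadjx : PlaneAdj (x₁, 0) (x₁ + 1, 0) := planeAdj_iff.2 (by simp)
  have hadjy : PlaneAdj (y₁, 0) (y₁ - 1, 0) := planeAdj_iff.2 (by simp)
  have hxO : ((x₁ + 1, 0) : ℤ × ℤ) ∈ O := ⟨⟨hxA, by rfl⟩, _, hx₁, hadjx⟩
  have hxW : ((x₁ + 1, 0) : ℤ × ℤ) ∈ W := ⟨hxO, by rfl⟩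
  have hcx : cut (x₁, 0) (x₁ + 1, 0) = 1 := by simp [hcut, hx₁, hxW]
  have hcy : cut (y₁, 0) (y₁ - 1, 0) = 1 := by
    rw [← hγ _ _ hadjy, ← hγB, ← hγA _ hy₁, hγA _ hx₁, hγ _ _ hadjx, hcx]
  have hyW : ((y₁ - 1, 0) : ℤ × ℤ) ∈ W := by
    by_contra h
    have hy' : ((y₁ - 1, 0) : ℤ × ℤ) ∉ A := hyA
    simp [hcut, h, hy'] at hcy
  refine ⟨x₁ + 1, y₁ - 1, by omega, by omega, hOBad hxO, hyW.2.mono ?_⟩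
  exact fun u v h => ⟨hOBad h.1, hOBad h.2.1, h.2.2⟩

lemma abs_fst_sub_le_length {S : Set (ℤ × ℤ)} {u v : ℤ × ℤ} (w : (starGraph S).Walk u v) :
    |u.1 - v.1| ≤ w.length := by
  induction w with
  | nil => simp
  | @cons a b c h w ih =>
    have h1 := h.2.2.2.1
    rw [SimpleGraph.Walk.length_cons]
    rw [abs_le] at *
    push_cast
    omega

/-- A long injective sequence of bad sites starting on the right of the segment. -/
lemma exists_star_sequence (A Bad : Set (ℤ × ℤ)) (hA : A.Finite) (m : ℕ)
    (hI : ∀ i : ℤ, 0 ≤ i → i ≤ m → (i, 0) ∈ A)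
    (hconn : ∀ v ∈ A, (planeGraph A).Reachable (0, 0) v)
    (hout : ∀ u ∈ A, ∀ v ∉ A, PlaneAdj u v → v ∈ Bad) :
    ∃ x : ℕ, m < x ∧ ∃ w : ℕ → ℤ × ℤ, w 0 = ((x : ℤ), 0) ∧
      (∀ i < x, |(w (i + 1)).1 - (w i).1| ≤ 1 ∧ |(w (i + 1)).2 - (w i).2| ≤ 1) ∧
      Set.InjOn w (Set.Iic x) ∧ ∀ i ≤ x, w i ∈ Bad := by
  obtain ⟨x, y, hx, hy, hxB, ⟨w⟩⟩ := exists_star_reachable A Bad hA m hI hconn hout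
  lift x to ℕ using by omega
  have hlen := abs_fst_sub_le_length w.bypass
  rw [abs_le] at hlen
  simp only at hlen
  have hlen' : x ≤ w.bypass.length := by omega
  have hadj : ∀ i < x, (starGraph Bad).Adj (w.bypass.getVert i) (w.bypass.getVert (i + 1)) :=
    fun i hi => w.bypass.adj_getVert_succ (by omega)
  refine ⟨x, by omega, w.bypass.getVert, by simp, ?_, ?_, ?_⟩
  · intro i hi
    have h := (hadj i hi).symm.2.2
    exact h.2
  · exact w.bypass_isPath.getVert_injOn.mono fun i hi => le_trans hi hlen'
  · intro i hi
    cases i with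
    | zero => simpa using hxB
    | succ i => exact (hadj i (by omega)).2.1

end Planar

section Probability

variable {d : ℕ}

/-- A set of configurations is determined by the edges in `F`. -/
def LocalOn (F : Set (EdgeD d)) (S : Set (Config d)) : Prop :=
  ∀ ω ω' : Config d, (∀ e ∈ F, ω e = ω' e) → ω ∈ S → ω' ∈ S

lemma LocalOn.inter {F G : Set (EdgeD d)} {S S' : Set (Config d)} (h : LocalOn F S)
    (h' : LocalOn G S') : LocalOn (F ∪ G) (S ∩ S') := fun ω ω' hω hS =>
  ⟨h ω ω' (fun e he => hω e (Or.inl he)) hS.1, h' ω ω' (fun e he => hω e (Or.inr he)) hS.2⟩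

lemma LocalOn.eq_preimage {F : Finset (EdgeD d)} {S : Set (Config d)}
    (h : LocalOn (F : Set (EdgeD d)) S) :
    S = (fun (ω : Config d) (i : F) => ω i) ⁻¹' ((fun (ω : Config d) (i : F) => ω i) '' S) := by
  refine Set.Subset.antisymm (Set.subset_preimage_image _ _) ?_
  rintro ω ⟨ω', hω', he⟩
  exact h ω' ω (fun e he' => congrFun he ⟨e, he'⟩) hω'

lemma LocalOn.measurableSet {F : Set (EdgeD d)} {S : Set (Config d)} (h : LocalOn F S)
    (hF : F.Finite) : MeasurableSet S := by
  lift F to Finset (EdgeD d) using hF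
  rw [h.eq_preimage]
  have hm : Measurable (fun (ω : Config d) (i : F) => ω i) := by fun_prop
  exact hm (Set.to_countable _).measurableSet

lemma IsBernoulli.iIndepFun {p : ℝ} {μ : Measure (Config d)} (hμ : IsBernoulli d p μ) :
    ProbabilityTheory.iIndepFun (fun (e : EdgeD d) (ω : Config d) => ω e) μ := by
  have := hμ.1
  have hm : ∀ e : EdgeD d, MeasurableSpace.comap (fun ω : Config d => ω e) inferInstance =
      MeasurableSpace.generateFrom {{ω : Config d | ω e = true}} := by
    intro e
    rw [MeasurableSpace.generateFrom_singleton]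

    have : (inferInstance : MeasurableSpace Bool) =
        MeasurableSpace.comap (fun b : Bool => b ∈ ({b | b = true} : Set Bool)) ⊤ := by
      refine le_antisymm ?_ ?_
      · intro s hs
        refine ⟨(fun b : Bool => b = true) '' s, trivial, ?_⟩
        ext b
        constructor
        · rintro ⟨b', hb', h⟩
          have : b' = b := by
            have : (b' = true) = (b = true) := h
            cases b <;> cases b' <;> simp_all
          exact this ▸ hb'
        · intro hb
          exact ⟨b, hb, rfl⟩
      · exact fun s _ => trivial
    rw [this, MeasurableSpace.comap_comp]
    rfl
  have hS : ProbabilityTheory.iIndepSets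
      (fun e : EdgeD d => {{ω : Config d | ω e = true}}) μ := by
    rw [ProbabilityTheory.iIndepSets_iff]
    intro s f hf
    have h1 : ⋂ i ∈ s, f i = {ω : Config d | ∀ e ∈ s, ω e = (fun _ => true) e} := by
      ext ω
      simp only [Set.mem_iInter, Set.mem_ofPred_eq]
      refine forall₂_congr fun e he => ?_
      rw [hf e he]; rfl
    rw [h1, hμ.2]
    refine Finset.prod_congr rfl fun e he => ?_
    rw [hf e he]
    have := hμ.2 {e} (fun _ => true)
    simpa using this.symm
  have hle : ∀ e : EdgeD d, MeasurableSpace.comap (fun ω : Config d => ω e) inferInstance ≤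
      (inferInstance : MeasurableSpace (Config d)) :=
    fun e => Measurable.comap_le (measurable_pi_apply e)
  exact ProbabilityTheory.iIndepSets.iIndep hle
    (fun e : EdgeD d => {{ω : Config d | ω e = true}}) (fun e => IsPiSystem.singleton _) hm hS

lemma IsBernoulli.unique {p : ℝ} {μ ν : Measure (Config d)} (hμ : IsBernoulli d p μ)
    (hν : IsBernoulli d p ν) : μ = ν := by
  have := hμ.1
  have := hν.1
  have h1 := (ProbabilityTheory.iIndepFun_iff_map_fun_eq_infinitePi_map
    (fun e => measurable_pi_apply e)).1 hμ.iIndepFun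
  have h2 := (ProbabilityTheory.iIndepFun_iff_map_fun_eq_infinitePi_map
    (fun e => measurable_pi_apply e)).1 hν.iIndepFun
  have h3 : ∀ e : EdgeD d, μ.map (fun ω : Config d => ω e) = ν.map (fun ω : Config d => ω e) := by
    intro e
    refine Measure.ext_of_singleton fun b => ?_
    rw [Measure.map_apply (measurable_pi_apply e) (measurableSet_singleton b),
      Measure.map_apply (measurable_pi_apply e) (measurableSet_singleton b)]
    have h4 := hμ.2 {e} (fun _ => b)
    have h5 := hν.2 {e} (fun _ => b)
    rw [← h5] at h4
    simp only [Finset.mem_singleton, forall_eq] at h4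
    exact h4
  have h4 : μ.map (fun ω : Config d => fun e => ω e) =
      ν.map (fun ω : Config d => fun e => ω e) := by
    rw [h1, h2]
    simp only [h3]
  simpa [Measure.map_id'] using h4

lemma LocalOn.measure_inter {p : ℝ} {μ : Measure (Config d)} (hμ : IsBernoulli d p μ)
    {F G : Set (EdgeD d)} {S S' : Set (Config d)} (h : LocalOn F S) (h' : LocalOn G S')
    (hF : F.Finite) (hG : G.Finite) (hFG : Disjoint F G) :
    μ (S ∩ S') = μ S * μ S' := by
  lift F to Finset (EdgeD d) using hF
  lift G to Finset (EdgeD d) using hG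
  have hi := hμ.iIndepFun.indepFun_finset F G (by exact_mod_cast hFG)
    (fun e => measurable_pi_apply e)
  rw [h.eq_preimage, h'.eq_preimage]
  exact hi.measure_inter_preimage_eq_mul _ _ (Set.to_countable _).measurableSet
    (Set.to_countable _).measurableSet

lemma measure_biInter_local {p : ℝ} {μ : Measure (Config d)} (hμ : IsBernoulli d p μ)
    {ι : Type*} (I : Finset ι) (F : ι → Set (EdgeD d)) (S : ι → Set (Config d))
    (h : ∀ i ∈ I, LocalOn (F i) (S i)) (hF : ∀ i ∈ I, (F i).Finite)
    (hd : ∀ i ∈ I, ∀ j ∈ I, i ≠ j → Disjoint (F i) (F j)) :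
    μ (⋂ i ∈ I, S i) = ∏ i ∈ I, μ (S i) ∧ LocalOn (⋃ i ∈ I, F i) (⋂ i ∈ I, S i) := by
  have := hμ.1
  induction I using Finset.induction_on with
  | empty => simp [LocalOn]
  | insert a I ha ih =>
    obtain ⟨h1, h2⟩ := ih (fun i hi => h i (Finset.mem_insert_of_mem hi))
      (fun i hi => hF i (Finset.mem_insert_of_mem hi))
      (fun i hi j hj => hd i (Finset.mem_insert_of_mem hi) j (Finset.mem_insert_of_mem hj))
    have ha' := h a (Finset.mem_insert_self a I)
    rw [Finset.set_biInter_insert, Finset.prod_insert ha, ← h1, Finset.set_biUnion_insert]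
    refine ⟨LocalOn.measure_inter hμ ha' h2 (hF a (Finset.mem_insert_self a I)) ?_ ?_,
      ha'.inter h2⟩
    · exact Set.Finite.biUnion I.finite_toSet fun i hi => hF i (Finset.mem_insert_of_mem hi)
    · rw [Set.disjoint_iUnion₂_right]
      intro i hi
      refine hd a (Finset.mem_insert_self a I) i (Finset.mem_insert_of_mem hi) ?_
      rintro rfl
      exact ha hi

/-- Edges with both endpoints in the box of radius `L` around `z`. -/
def boxEdges (d L : ℕ) (z : ZVec d) : Set (EdgeD d) :=
  {e | e.val.1 ∈ boxZ d L z ∧ e.val.2 ∈ boxZ d L z}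

lemma finite_boxEdges (L : ℕ) (z : ZVec d) : (boxEdges d L z).Finite := by
  refine Set.Finite.of_finite_image (f := Subtype.val) ?_ Subtype.val_injective.injOn
  refine ((finite_boxZ L z).prod (finite_boxZ L z)).subset ?_
  rintro _ ⟨e, he, rfl⟩
  exact he

lemma disjoint_boxEdges {L : ℕ} {z z' : ZVec d} (h : 2 * L < normInf d (z - z')) :
    Disjoint (boxEdges d L z) (boxEdges d L z') := by
  rw [Set.disjoint_left]
  intro e he he'
  have h1 := he.1
  have h2 := he'.1
  rw [mem_boxZ] at h1 h2
  have := normInf_sub_le z e.val.1 z'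
  rw [normInf_sub_comm z e.val.1] at this
  omega

lemma edgeOpen_congr {ω ω' : Config d} {U : Set (ZVec d)}
    (h : ∀ e : EdgeD d, e.val.1 ∈ U → e.val.2 ∈ U → ω e = ω' e) {x y : ZVec d} (hx : x ∈ U)
    (hy : y ∈ U) (ho : EdgeOpen d ω x y) : EdgeOpen d ω' x y := by
  obtain ⟨e, he, ho⟩ := ho
  refine ⟨e, he, ?_⟩
  rw [← h e, ho] <;> rcases he with he | he <;> rw [he] <;> assumption

lemma openGraph_congr {ω ω' : Config d} {U : Set (ZVec d)}
    (h : ∀ e : EdgeD d, e.val.1 ∈ U → e.val.2 ∈ U → ω e = ω' e) :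
    openGraph ω U = openGraph ω' U := by
  ext x y
  exact ⟨fun hh => ⟨hh.1, hh.2.1, edgeOpen_congr h hh.1 hh.2.1 hh.2.2⟩,
    fun hh => ⟨hh.1, hh.2.1, edgeOpen_congr (fun e h1 h2 => (h e h1 h2).symm) hh.1 hh.2.1 hh.2.2⟩⟩

lemma OpenConn.congr {ω ω' : Config d} {U : Set (ZVec d)}
    (h : ∀ e : EdgeD d, e.val.1 ∈ U → e.val.2 ∈ U → ω e = ω' e) {x y : ZVec d} {L : ℕ} :
    OpenConn ω U x y L ↔ OpenConn ω' U x y L := by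
  unfold OpenConn
  rw [openGraph_congr h]

lemma norm1_emod_two (x : ZVec d) : ((norm1 d x : ℕ) : ℤ) % 2 = (∑ i, x i) % 2 := by
  unfold norm1
  push_cast
  rw [Finset.sum_int_mod, Finset.sum_int_mod _ _ (fun i => x i)]
  congr 1
  refine Finset.sum_congr rfl fun i _ => ?_
  rcases abs_choice (x i) with h | h <;> rw [h]
  omega

lemma Adj.norm1_ne {x y : ZVec d} (h : Adj d x y) : norm1 d x ≠ norm1 d y := by
  intro hxy
  have h1 := norm1_emod_two x
  have h2 := norm1_emod_two y
  have h3 := norm1_emod_two (x - y)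
  have h4 : norm1 d (x - y) = 1 := h
  rw [h4] at h3
  simp only [Pi.sub_apply, Finset.sum_sub_distrib] at h3
  omega

lemma Adj.add_right {x y : ZVec d} (h : Adj d x y) (z : ZVec d) : Adj d (x + z) (y + z) := by
  unfold Adj at *
  rwa [add_sub_add_right_eq_sub]

/-- Translation of edges. -/
def shiftEdge (z : ZVec d) (e : EdgeD d) : EdgeD d :=
  if h : norm1 d (e.val.1 + z) < norm1 d (e.val.2 + z) then
    ⟨(e.val.1 + z, e.val.2 + z), Adj.add_right e.2.1 z, h⟩
  else ⟨(e.val.2 + z, e.val.1 + z), (Adj.add_right e.2.1 z).symm,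
    lt_of_le_of_ne (not_lt.1 h) (Adj.add_right e.2.1 z).symm.norm1_ne⟩

lemma shiftEdge_val (z : ZVec d) (e : EdgeD d) :
    (shiftEdge z e).val = (e.val.1 + z, e.val.2 + z) ∨
      (shiftEdge z e).val = (e.val.2 + z, e.val.1 + z) := by
  by_cases h : norm1 d (e.val.1 + z) < norm1 d (e.val.2 + z)
  · left
    exact congrArg Subtype.val (dif_pos h)
  · right
    exact congrArg Subtype.val (dif_neg h)

lemma EdgeD.ext_swap {e e' : EdgeD d} {x y : ZVec d} (h : e.val = (x, y) ∨ e.val = (y, x))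
    (h' : e'.val = (x, y) ∨ e'.val = (y, x)) : e = e' := by
  apply Subtype.ext
  have h1 := e.2.2
  have h2 := e'.2.2
  rcases h with h | h <;> rcases h' with h' | h' <;> rw [h, h'] <;> rw [h] at h1 <;>
    rw [h'] at h2 <;> exact absurd h1 (not_lt.2 h2.le)

lemma shiftEdge_neg (z : ZVec d) (e : EdgeD d) : shiftEdge z (shiftEdge (-z) e) = e := by
  refine EdgeD.ext_swap (x := e.val.1) (y := e.val.2) ?_ (Or.inl rfl)
  rcases shiftEdge_val z (shiftEdge (-z) e) with h | h <;>
    rcases shiftEdge_val (-z) e with h' | h' <;> rw [h, h'] <;> simp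

/-- Translation of configurations. -/
def shiftCfg (z : ZVec d) (ω : Config d) : Config d := fun e => ω (shiftEdge z e)

lemma edgeOpen_shiftCfg {z : ZVec d} {ω : Config d} {x y : ZVec d} :
    EdgeOpen d (shiftCfg z ω) x y ↔ EdgeOpen d ω (x + z) (y + z) := by
  constructor
  · rintro ⟨e, he, ho⟩
    refine ⟨shiftEdge z e, ?_, ho⟩
    rcases shiftEdge_val z e with h | h <;> rcases he with he | he <;> rw [h, he] <;> simp
  · rintro ⟨e, he, ho⟩
    refine ⟨shiftEdge (-z) e, ?_, ?_⟩
    · rcases shiftEdge_val (-z) e with h | h <;> rcases he with he | he <;> rw [h, he] <;> simp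
    · unfold shiftCfg
      rwa [shiftEdge_neg]

lemma shiftEdge_injective (z : ZVec d) : Function.Injective (shiftEdge z) := by
  intro e e' h
  have h1 := shiftEdge_neg (-z) e
  have h2 := shiftEdge_neg (-z) e'
  rw [neg_neg] at h1 h2
  rw [← h1, h, h2]

lemma measurable_shiftCfg (z : ZVec d) : Measurable (shiftCfg z : Config d → Config d) :=
  measurable_pi_lambda _ fun _ => measurable_pi_apply _

lemma IsBernoulli.map_shiftCfg {p : ℝ} {μ : Measure (Config d)} (hμ : IsBernoulli d p μ)
    (z : ZVec d) : μ.map (shiftCfg z) = μ := by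
  have := hμ.1
  refine IsBernoulli.unique (p := p) ⟨Measure.isProbabilityMeasure_map
    (measurable_shiftCfg z).aemeasurable, fun s f => ?_⟩ hμ
  have hl : LocalOn (s : Set (EdgeD d)) {ω : Config d | ∀ e ∈ s, ω e = f e} := by
    intro ω ω' h h' e he
    rw [← h e he, h' e he]
  rw [Measure.map_apply (measurable_shiftCfg z) (hl.measurableSet s.finite_toSet)]
  have h1 := hμ.2 (s.image (shiftEdge z)) (fun e => f (shiftEdge (-z) e))
  have h2 : ∀ e, shiftEdge (-z) (shiftEdge z e) = e := fun e => by
    have := shiftEdge_neg (-z) e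
    rwa [neg_neg] at this
  rw [Finset.prod_image (shiftEdge_injective z).injOn] at h1
  simp only [h2] at h1
  rw [← h1]
  congr 1
  ext ω
  simp [shiftCfg, h2]

lemma IsBernoulli.measure_shiftCfg_le {p : ℝ} {μ : Measure (Config d)} (hμ : IsBernoulli d p μ)
    (z : ZVec d) (S : Set (Config d)) : μ {ω | shiftCfg z ω ∈ S} ≤ μ S := by
  conv_rhs => rw [← hμ.map_shiftCfg z]
  exact Measure.le_map_apply (measurable_shiftCfg z).aemeasurable S

end Probability

section Clusters

variable {d : ℕ}

/-- `x` and `y` lie in the same open cluster. -/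
def Conn (ω : Config d) (x y : ZVec d) : Prop := ∃ L, OpenConn ω Set.univ x y L

namespace Conn

variable {ω : Config d} {x y z : ZVec d}

lemma refl (x : ZVec d) : Conn ω x x := ⟨0, OpenConn.refl (Set.mem_univ x) 0⟩

lemma symm (h : Conn ω x y) : Conn ω y x := h.imp fun _ h => h.symm

lemma trans (h : Conn ω x y) (h' : Conn ω y z) : Conn ω x z := by
  obtain ⟨L, h⟩ := h
  obtain ⟨L', h'⟩ := h'
  exact ⟨L + L', h.trans h'⟩

end Conn

lemma OpenConn.conn {ω : Config d} {U : Set (ZVec d)} {x y : ZVec d} {L : ℕ}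
    (h : OpenConn ω U x y L) : Conn ω x y := ⟨L, h.mono (Set.subset_univ _) le_rfl⟩

lemma chemDist_ne_top_iff {ω : Config d} {x y : ZVec d} : chemDist d ω x y ≠ ⊤ ↔ Conn ω x y :=
  chemDistIn_ne_top_iff

lemma inInfCluster_iff {ω : Config d} {x : ZVec d} :
    InInfCluster d ω x ↔ {y | Conn ω x y}.Infinite := by
  unfold InInfCluster
  simp only [chemDist_ne_top_iff]

lemma InInfCluster.of_conn {ω : Config d} {x y : ZVec d} (h : InInfCluster d ω x)
    (hxy : Conn ω x y) : InInfCluster d ω y := by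
  rw [inInfCluster_iff] at *
  exact h.mono fun v hv => hxy.symm.trans hv

lemma openConn_of_map {ω ω' : Config d} {U U' : Set (ZVec d)} (f : ZVec d → ZVec d)
    (hU : ∀ v ∈ U, f v ∈ U') (hf : ∀ x y, EdgeOpen d ω x y → EdgeOpen d ω' (f x) (f y))
    {x y : ZVec d} {L : ℕ} (h : OpenConn ω U x y L) : OpenConn ω' U' (f x) (f y) L := by
  obtain ⟨hx, w, hw⟩ := h
  let φ : openGraph ω U →g openGraph ω' U' :=
    ⟨f, fun {a b} hab => ⟨hU _ hab.1, hU _ hab.2.1, hf _ _ hab.2.2⟩⟩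
  exact ⟨hU _ hx, w.map φ, by simpa using hw⟩

lemma openConn_shiftCfg {z : ZVec d} {ω : Config d} {U U' : Set (ZVec d)}
    (hU : ∀ v, v ∈ U ↔ v + z ∈ U') {x y : ZVec d} {L : ℕ} :
    OpenConn (shiftCfg z ω) U x y L ↔ OpenConn ω U' (x + z) (y + z) L := by
  constructor
  · exact openConn_of_map (fun v => v + z) (fun v hv => (hU v).1 hv)
      fun a b h => edgeOpen_shiftCfg.1 h
  · intro h
    have := openConn_of_map (ω' := shiftCfg z ω) (U' := U) (fun v => v - z)
      (fun v hv => (hU _).2 (by simpa using hv))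
      (fun a b h => edgeOpen_shiftCfg.2 (by simpa using h)) h
    simpa using this

lemma conn_shiftCfg {z : ZVec d} {ω : Config d} {x y : ZVec d} :
    Conn (shiftCfg z ω) x y ↔ Conn ω (x + z) (y + z) :=
  exists_congr fun _ => openConn_shiftCfg (by simp)

/-- The point `x` is joined to distance `k` by an open path. -/
def Far (k : ℕ) (x : ZVec d) (ω : Config d) : Prop :=
  ∃ y L, OpenConn ω (boxZ d k x) x y L ∧ normInf d (y - x) = k

lemma normInf_step (o : ZVec d) {x y : ZVec d} (h : Adj d x y) :
    |(normInf d (x - o) : ℤ) - (normInf d (y - o) : ℤ)| ≤ 1 := by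
  have h1 := h.normInf_le
  have h2 := h.symm.normInf_le
  have h3 := normInf_sub_le x y o
  have h4 := normInf_sub_le y x o
  rw [abs_le]
  constructor <;> omega

lemma far_of_conn {ω : Config d} {x y : ZVec d} (k : ℕ) (h : Conn ω x y)
    (hk : k ≤ normInf d (y - x)) : Far k x ω := by
  obtain ⟨L, h⟩ := h
  obtain ⟨γ, hp, ho, -, hx, hy, -⟩ := h.exists_path
  have ho' : List.IsChain (EdgeOpen d ω) γ := ho
  obtain ⟨l₁, l₂, b, hl, hb, hlt, hh⟩ := List.exists_prefix_hit
    (fun v => (normInf d (v - x) : ℤ)) (fun a b hab => normInf_step x hab.adj) k γ ho' x hx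
    (by simp [normInf_zero]) ⟨y, List.mem_of_getLast? hy, by exact_mod_cast hk⟩
  refine ⟨b, _, OpenConn.of_chain (γ := l₁ ++ [b]) (by simp) ?_ ?_ hh (by simp),
    by exact_mod_cast hb⟩
  · rw [hl, ← List.singleton_append, ← List.append_assoc] at ho'
    exact (List.isChain_append.1 ho').1
  · intro v hv
    rw [List.mem_append, List.mem_singleton] at hv
    rw [mem_boxZ]
    rcases hv with hv | rfl
    · have := hlt v hv
      omega
    · omega

lemma Far.mono {ω : Config d} {x : ZVec d} {k l : ℕ} (h : Far l x ω) (hkl : k ≤ l) :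
    Far k x ω := by
  obtain ⟨y, L, hy, h⟩ := h
  exact far_of_conn k hy.conn (h ▸ hkl)

lemma inInfCluster_iff_far {ω : Config d} {x : ZVec d} :
    InInfCluster d ω x ↔ ∀ k, Far k x ω := by
  rw [inInfCluster_iff]
  constructor
  · intro h k
    obtain ⟨y, hy, hyk⟩ := h.exists_notMem_finite (finite_boxZ k x)
    rw [mem_boxZ, not_le] at hyk
    exact far_of_conn k hy hyk.le
  · intro h
    choose y L hy hk using h
    refine Set.infinite_of_injective_forall_mem (f := y) ?_ fun k => (hy k).conn
    intro a b hab
    rw [← hk a, ← hk b, hab]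

lemma localOn_far (k : ℕ) (x : ZVec d) : LocalOn (boxEdges d k x) {ω | Far k x ω} := by
  rintro ω ω' h ⟨y, L, hy, hk⟩
  exact ⟨y, L, (OpenConn.congr fun e h1 h2 => h e ⟨h1, h2⟩).1 hy, hk⟩

lemma measurableSet_far (k : ℕ) (x : ZVec d) : MeasurableSet {ω : Config d | Far k x ω} :=
  (localOn_far k x).measurableSet (finite_boxEdges k x)

lemma measurableSet_inInfCluster (x : ZVec d) :
    MeasurableSet {ω : Config d | InInfCluster d ω x} := by
  simp only [inInfCluster_iff_far, Set.ofPred_forall]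
  exact MeasurableSet.iInter fun k => measurableSet_far k x

lemma far_shiftCfg {z x : ZVec d} {ω : Config d} {k : ℕ} :
    Far k x (shiftCfg z ω) ↔ Far k (x + z) ω := by
  have hU : ∀ v, v ∈ boxZ d k x ↔ v + z ∈ boxZ d k (x + z) := by
    intro v
    rw [mem_boxZ, mem_boxZ, add_sub_add_right_eq_sub]
  constructor
  · rintro ⟨y, L, hy, hk⟩
    exact ⟨y + z, L, (openConn_shiftCfg hU).1 hy, by rwa [add_sub_add_right_eq_sub]⟩
  · rintro ⟨y, L, hy, hk⟩
    refine ⟨y - z, L, (openConn_shiftCfg hU).2 (by simpa using hy), ?_⟩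
    rw [← hk]
    congr 1
    abel

lemma inInfCluster_shiftCfg {z x : ZVec d} {ω : Config d} :
    InInfCluster d (shiftCfg z ω) x ↔ InInfCluster d ω (x + z) := by
  simp only [inInfCluster_iff_far, far_shiftCfg]

lemma ENNReal.le_zero_of_exp {a : ℝ≥0∞} {c t₀ : ℝ} (hc : 0 < c)
    (h : ∀ t : ℝ, t₀ ≤ t → a ≤ ENNReal.ofReal (c⁻¹ * Real.exp (-c * t))) : a = 0 := by
  have h1 : Filter.Tendsto (fun t : ℝ => ENNReal.ofReal (c⁻¹ * Real.exp (-c * t)))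
      Filter.atTop (nhds (ENNReal.ofReal (c⁻¹ * 0))) := by
    refine ENNReal.tendsto_ofReal (Filter.Tendsto.const_mul _ ?_)
    refine Real.tendsto_exp_atBot.comp ?_
    exact Filter.tendsto_id.const_mul_atTop_of_neg (by linarith)
  have h2 := ge_of_tendsto h1 (Filter.eventually_atTop.2 ⟨t₀, h⟩)
  simpa using h2

lemma starPt_eq_self {ω : Config d} {y : ZVec d} (hy : InInfCluster d ω y) :
    starPt d ω y = y := by
  have h : ∃ u, InInfCluster d ω u ∧ ∀ z, InInfCluster d ω z →
      normInf d (u - y) ≤ normInf d (z - y) :=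
    ⟨y, hy, fun z _ => by simp [normInf_zero]⟩
  unfold starPt
  rw [dif_pos h]
  have := h.choose_spec.2 y hy
  rw [sub_self, normInf_zero, Nat.le_zero, normInf_eq_zero, sub_eq_zero] at this
  exact this

lemma starPt_eq_of_forall_not {ω : Config d} (h : ∀ y, ¬ InInfCluster d ω y) (x : ZVec d) :
    starPt d ω x = x := by
  unfold starPt
  rw [dif_neg]
  rintro ⟨y, hy, -⟩
  exact h y hy

lemma ae_unique_infinite_cluster (hd : 1 ≤ d) {p ρ : ℝ} {μ : Measure (Config d)}
    (_ : IsBernoulli d p μ) (hρ : GMprop d μ ρ) :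
    ∀ᵐ ω ∂μ, (∃ x, InInfCluster d ω x) ∧
      ∀ x y, InInfCluster d ω x → InInfCluster d ω y → Conn ω x y := by
  obtain ⟨-, c, hc, h⟩ := hρ
  have h1 : ∀ x : ZVec d, ∀ᵐ ω ∂μ, Conn ω (starPt d ω 0) (starPt d ω x) := by
    intro x
    have : μ {ω | ¬ Conn ω (starPt d ω 0) (starPt d ω x)} = 0 := by
      refine ENNReal.le_zero_of_exp (t₀ := ρ * normInf d x) hc fun t ht => ?_
      refine le_trans (measure_mono ?_) (h x t ht).2
      intro ω hω
      right
      by_contra hne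
      exact hω (chemDist_ne_top_iff.1 hne)
    exact this
  have h2 := ae_all_iff.2 h1
  filter_upwards [h2] with ω hω
  have hex : ∃ x, InInfCluster d ω x := by
    by_contra hno
    push Not at hno
    simp only [starPt_eq_of_forall_not hno] at hω
    refine hno 0 (inInfCluster_iff.2 ?_)
    have : {y | Conn ω 0 y} = Set.univ := Set.eq_univ_of_forall hω
    rw [this]
    have : Nonempty (Fin d) := ⟨⟨0, hd⟩⟩
    exact Set.infinite_univ
  refine ⟨hex, fun x y hx hy => ?_⟩
  have hx' := hω x
  have hy' := hω y
  rw [starPt_eq_self hx] at hx'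
  rw [starPt_eq_self hy] at hy'
  exact hx'.symm.trans hy'

/-- Moderate deviations for the chemical distance between two arbitrary points. -/
lemma exists_chemical_deviation {p ρ : ℝ} {μ : Measure (Config d)} (hμ : IsBernoulli d p μ)
    (hρ : GMprop d μ ρ) : ∃ c : ℝ, 0 < c ∧ ∀ (u v : ZVec d) (s : ℕ),
      ρ * (normInf d (v - u) : ℝ) ≤ s →
      μ {ω | Conn ω u v ∧ ¬ OpenConn ω Set.univ u v s}
        ≤ ENNReal.ofReal (c⁻¹ * Real.exp (-c * s)) := by
  obtain ⟨-, c, hc, h⟩ := hρ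
  refine ⟨c, hc, fun u v s hs => ?_⟩
  refine le_trans (le_trans (measure_mono ?_) (hμ.measure_shiftCfg_le u _)) (h (v - u) s hs).1
  rintro ω ⟨h1, h2⟩
  have h3 : Conn (shiftCfg u ω) 0 (v - u) := by
    rw [conn_shiftCfg]
    simpa using h1
  have h4 := chemDist_ne_top_iff.2 h3
  refine ⟨h4, ?_⟩
  by_contra hlt
  push Not at hlt
  have h5 := openConn_chemDistIn h4
  rw [openConn_shiftCfg (U' := Set.univ) (by simp)] at h5
  simp only [zero_add, sub_add_cancel] at h5
  exact h2 (h5.mono le_rfl (by exact_mod_cast hlt.le))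

lemma tendsto_far_diff {p : ℝ} {μ : Measure (Config d)} (hμ : IsBernoulli d p μ) :
    Filter.Tendsto (fun k => μ {ω | Far k 0 ω ∧ ¬ InInfCluster d ω 0}) Filter.atTop (nhds 0) := by
  have := hμ.1
  have h := tendsto_measure_iInter_atTop (μ := μ)
    (s := fun k => {ω : Config d | Far k 0 ω ∧ ¬ InInfCluster d ω 0})
    (fun k =>
      ((measurableSet_far k 0).inter (measurableSet_inInfCluster 0).compl).nullMeasurableSet)
    (fun k l hkl ω hω => ⟨hω.1.mono hkl, hω.2⟩) ⟨0, measure_ne_top _ _⟩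
  have h2 : ⋂ k, {ω : Config d | Far k 0 ω ∧ ¬ InInfCluster d ω 0} = ∅ := by
    rw [Set.eq_empty_iff_forall_notMem]
    intro ω hω
    rw [Set.mem_iInter] at hω
    exact (hω 0).2 (inInfCluster_iff_far.2 fun k => (hω k).1)
  rwa [h2, measure_empty] at h

lemma measure_far_diff_le {p : ℝ} {μ : Measure (Config d)} (hμ : IsBernoulli d p μ) (k : ℕ)
    (z : ZVec d) : μ {ω | Far k z ω ∧ ¬ InInfCluster d ω z} ≤
      μ {ω | Far k 0 ω ∧ ¬ InInfCluster d ω 0} := by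
  refine le_trans (measure_mono ?_) (hμ.measure_shiftCfg_le z _)
  intro ω hω
  refine ⟨?_, ?_⟩
  · rw [far_shiftCfg]; simpa using hω.1
  · rw [inInfCluster_shiftCfg]; simpa using hω.2

/-- The infinite cluster misses the box of radius `j` around `z`. -/
def Hole (j : ℕ) (z : ZVec d) (ω : Config d) : Prop := ∀ x ∈ boxZ d j z, ¬ InInfCluster d ω x

lemma tendsto_hole (hd : 1 ≤ d) {p ρ : ℝ} {μ : Measure (Config d)} (hμ : IsBernoulli d p μ)
    (hρ : GMprop d μ ρ) :
    Filter.Tendsto (fun j => μ {ω | Hole j 0 ω}) Filter.atTop (nhds 0) := by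
  have := hμ.1
  have hm : ∀ j, MeasurableSet {ω : Config d | Hole j 0 ω} := by
    intro j
    simp only [Hole, Set.ofPred_forall]
    exact MeasurableSet.biInter (Set.to_countable _) fun x _ => (measurableSet_inInfCluster x).compl
  have h := tendsto_measure_iInter_atTop (μ := μ) (s := fun j => {ω : Config d | Hole j 0 ω})
    (fun k => (hm k).nullMeasurableSet)
    (fun k l hkl ω hω x hx => hω x (le_trans hx hkl)) ⟨0, measure_ne_top _ _⟩
  have h2 : μ (⋂ j, {ω : Config d | Hole j 0 ω}) = 0 := by
    refine measure_mono_null ?_ (ae_iff.1 (ae_unique_infinite_cluster hd hμ hρ))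
    intro ω hω hc
    obtain ⟨⟨x, hx⟩, -⟩ := hc
    rw [Set.mem_iInter] at hω
    refine hω (normInf d x) x ?_ hx
    rw [mem_boxZ, sub_zero]
  rwa [h2] at h

lemma measure_hole_le {p : ℝ} {μ : Measure (Config d)} (hμ : IsBernoulli d p μ) (j : ℕ)
    (z : ZVec d) : μ {ω | Hole j z ω} ≤ μ {ω | Hole j 0 ω} := by
  refine le_trans (measure_mono ?_) (hμ.measure_shiftCfg_le z _)
  intro ω hω x hx
  rw [inInfCluster_shiftCfg]
  refine hω _ ?_
  rw [mem_boxZ] at *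
  simpa using hx

end Clusters

section Renormalization

variable {d : ℕ}

/-- Embedding of the coarse plane `K ℤ²` into the first two coordinates. -/
def site (d K : ℕ) (u : ℤ × ℤ) : ZVec d :=
  fun i => if (i : ℕ) = 0 then K * u.1 else if (i : ℕ) = 1 then K * u.2 else 0

lemma normInf_site_le {K N : ℕ} {u v : ℤ × ℤ} (h1 : |u.1 - v.1| ≤ N) (h2 : |u.2 - v.2| ≤ N) :
    normInf d (site d K u - site d K v) ≤ K * N := by
  rw [normInf_le_iff]
  intro i
  zify
  have key : ∀ a b : ℤ, |a - b| ≤ N → |K * a - K * b| ≤ K * N := by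
    intro a b h
    rw [← mul_sub, abs_mul, Nat.abs_cast]
    exact mul_le_mul_of_nonneg_left h (by positivity)
  simp only [site, Pi.sub_apply]
  split_ifs
  · exact key _ _ h1
  · exact key _ _ h2
  · simp; positivity

lemma le_normInf_site (hd : 2 ≤ d) {K N : ℕ} {u v : ℤ × ℤ}
    (h : N ≤ |u.1 - v.1| ∨ N ≤ |u.2 - v.2|) :
    K * N ≤ normInf d (site d K u - site d K v) := by
  have key : ∀ a b : ℤ, N ≤ |a - b| → K * N ≤ |K * a - K * b| := by
    intro a b h
    rw [← mul_sub, abs_mul, Nat.abs_cast]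
    exact mul_le_mul_of_nonneg_left h (by positivity)
  rcases h with h | h
  · refine le_trans ?_ (natAbs_le_normInf _ (⟨0, by omega⟩ : Fin d))
    zify
    simpa [site] using key _ _ h
  · refine le_trans ?_ (natAbs_le_normInf _ (⟨1, by omega⟩ : Fin d))
    zify
    simpa [site] using key _ _ h

/-- A block is good if it is reached by a long open path and all such points of the block and its
neighbours are joined locally. -/
def GoodBlock (j k K L : ℕ) (z : ℤ × ℤ) (ω : Config d) : Prop :=
  (∃ v ∈ boxZ d j (site d K z), Far k v ω) ∧
    ∀ z', (z' = z ∨ PlaneAdj z z') → ∀ u ∈ boxZ d j (site d K z), ∀ v ∈ boxZ d j (site d K z'),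
      Far k u ω → Far k v ω → OpenConn ω (boxZ d L (site d K z)) u v L

lemma planeAdj_abs_le {z z' : ℤ × ℤ} (h : z' = z ∨ PlaneAdj z z') :
    |z.1 - z'.1| ≤ 1 ∧ |z.2 - z'.2| ≤ 1 := by
  rcases h with rfl | h
  · simp
  · have h1 := abs_nonneg (z.1 - z'.1)
    have h2 := abs_nonneg (z.2 - z'.2)
    unfold PlaneAdj at h
    constructor <;> linarith

lemma localOn_goodBlock {j k K L : ℕ} (hL : K + j + k ≤ L) (z : ℤ × ℤ) :
    LocalOn (boxEdges d L (site d K z)) {ω | GoodBlock j k K L z ω} := by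
  have hfar : ∀ ω ω' : Config d, (∀ e ∈ boxEdges d L (site d K z), ω e = ω' e) →
      ∀ z', (z' = z ∨ PlaneAdj z z') → ∀ v ∈ boxZ d j (site d K z'), Far k v ω → Far k v ω' := by
    intro ω ω' h z' hz' v hv
    refine localOn_far k v ω ω' fun e he => h e ?_
    have h1 := planeAdj_abs_le hz'
    have h2 := normInf_site_le (d := d) (K := K) (N := 1) (by exact_mod_cast h1.1)
      (by exact_mod_cast h1.2)
    have h3 : boxZ d k v ⊆ boxZ d L (site d K z) := by
      apply boxZ_subset_boxZ
      have h4 := normInf_sub_le v (site d K z') (site d K z)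
      rw [mem_boxZ] at hv
      rw [normInf_sub_comm (site d K z')] at h4
      omega
    exact ⟨h3 he.1, h3 he.2⟩
  rintro ω ω' h ⟨⟨v, hv, hvf⟩, h2⟩
  refine ⟨⟨v, hv, hfar ω ω' h z (Or.inl rfl) v hv hvf⟩, ?_⟩
  intro z' hz' u hu v hv huf hvf
  have h' : ∀ e ∈ boxEdges d L (site d K z), ω' e = ω e := fun e he => (h e he).symm
  exact (OpenConn.congr fun e h1 h2 => h e ⟨h1, h2⟩).1
    (h2 z' hz' u hu v hv (hfar ω' ω h' z (Or.inl rfl) u hu huf) (hfar ω' ω h' z' hz' v hv hvf))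

lemma measure_bad_le {p : ℝ} {μ : Measure (Config d)} (hμ : IsBernoulli d p μ) (j k K L s : ℕ)
    (hL : s + j ≤ L) (e : ℝ≥0∞)
    (hun : ∀ᵐ ω ∂μ, ∀ x y, InInfCluster d ω x → InInfCluster d ω y → Conn ω x y)
    (hdev : ∀ u v : ZVec d, normInf d (v - u) ≤ 2 * j + K →
      μ {ω | Conn ω u v ∧ ¬ OpenConn ω Set.univ u v s} ≤ e) (z : ℤ × ℤ) :
    μ {ω | ¬ GoodBlock j k K L z ω} ≤ μ {ω | Hole j 0 ω} +
      (9 * ((2 * j + 1) ^ d * (2 * j + 1) ^ d) : ℕ) *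
        (μ {ω | Far k 0 ω ∧ ¬ InInfCluster d ω 0} +
          μ {ω | Far k 0 ω ∧ ¬ InInfCluster d ω 0} + e) := by
  set ε := μ {ω | Far k 0 ω ∧ ¬ InInfCluster d ω 0} with hε
  let B : ℤ × ℤ → Finset (ZVec d) := fun z => (finite_boxZ j (site d K z)).toFinset
  have hB : ∀ z, (B z).card = (2 * j + 1) ^ d := by
    intro z
    rw [← ncard_boxZ j (site d K z), Set.ncard_eq_toFinset_card _ (finite_boxZ j (site d K z))]
  let N : Finset (ℤ × ℤ) := (Finset.Icc (z.1 - 1) (z.1 + 1) ×ˢ Finset.Icc (z.2 - 1) (z.2 + 1))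
  have hN : N.card = 9 := by
    have h1 : (z.1 + 1 + 1 - (z.1 - 1)).toNat = 3 := by omega
    have h2 : (z.2 + 1 + 1 - (z.2 - 1)).toNat = 3 := by omega
    simp [N, Finset.card_product, h1, h2]
  let N' := N.filter fun z' => z' = z ∨ PlaneAdj z z'
  have hN' : N'.card ≤ 9 := hN ▸ Finset.card_filter_le _ _
  let E : ZVec d → ZVec d → Set (Config d) := fun u v =>
    ({ω | Far k u ω ∧ ¬ InInfCluster d ω u} ∪ {ω | Far k v ω ∧ ¬ InInfCluster d ω v}) ∪
      {ω | Conn ω u v ∧ ¬ OpenConn ω Set.univ u v s}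
  have hE : ∀ z' ∈ N', ∀ u ∈ B z, ∀ v ∈ B z', μ (E u v) ≤ ε + ε + e := by
    intro z' hz' u hu v hv
    refine (measure_union_le _ _).trans (add_le_add ((measure_union_le _ _).trans (add_le_add
      (measure_far_diff_le hμ k u) (measure_far_diff_le hμ k v))) (hdev u v ?_))
    have h1 := planeAdj_abs_le (Finset.mem_filter.1 hz').2
    have h2 := normInf_site_le (d := d) (K := K) (N := 1) (by exact_mod_cast h1.1)
      (by exact_mod_cast h1.2)
    have hu' : normInf d (u - site d K z) ≤ j := by simpa [B, mem_boxZ] using hu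
    have hv' : normInf d (v - site d K z') ≤ j := by simpa [B, mem_boxZ] using hv
    have h3 := normInf_sub_le v (site d K z') u
    have h4 := normInf_sub_le (site d K z') (site d K z) u
    rw [normInf_sub_comm (site d K z') (site d K z), normInf_sub_comm (site d K z) u] at h4
    omega
  have hsub : {ω | ¬ GoodBlock j k K L z ω} ⊆ {ω | Hole j (site d K z) ω} ∪
      {ω | ¬ ∀ x y, InInfCluster d ω x → InInfCluster d ω y → Conn ω x y} ∪
      ⋃ z' ∈ N', ⋃ u ∈ B z, ⋃ v ∈ B z', E u v := by
    intro ω hω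
    by_contra hc
    simp only [Set.mem_union, not_or, Set.mem_iUnion, not_exists] at hc
    obtain ⟨⟨hc1, hc2⟩, hc3⟩ := hc
    apply hω
    constructor
    · have hc1' : ¬ Hole j (site d K z) ω := hc1
      unfold Hole at hc1'
      push Not at hc1'
      obtain ⟨x, hx, hxi⟩ := hc1'
      exact ⟨x, hx, inInfCluster_iff_far.1 hxi k⟩
    · intro z' hz' u hu v hv huf hvf
      have hz'N : z' ∈ N' := by
        refine Finset.mem_filter.2 ⟨?_, hz'⟩
        have h1 := planeAdj_abs_le hz'
        simp only [abs_le] at h1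
        simp only [N, Finset.mem_product, Finset.mem_Icc]
        omega
      have h :=
        hc3 z' hz'N u ((Set.Finite.mem_toFinset _).2 hu) v ((Set.Finite.mem_toFinset _).2 hv)
      simp only [E, Set.mem_union, not_or] at h
      obtain ⟨⟨h1, h2⟩, h3⟩ := h
      have h1' : InInfCluster d ω u := by
        by_contra hh
        exact h1 ⟨huf, hh⟩
      have h2' : InInfCluster d ω v := by
        by_contra hh
        exact h2 ⟨hvf, hh⟩
      have h4 : Conn ω u v := (not_not.1 hc2) u v h1' h2'
      have h5 : OpenConn ω Set.univ u v s := by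
        by_contra hh
        exact h3 ⟨h4, hh⟩
      refine (h5.of_box (U' := boxZ d L (site d K z)) (boxZ_subset_boxZ ?_)).mono le_rfl (by omega)
      rw [mem_boxZ] at hu
      omega
  refine (measure_mono hsub).trans ((measure_union_le _ _).trans (add_le_add
    ((measure_union_le _ _).trans ?_) ?_))
  · have : μ {ω | ¬ ∀ x y, InInfCluster d ω x → InInfCluster d ω y → Conn ω x y} = 0 :=
      ae_iff.1 hun
    rw [this, add_zero]
    exact measure_hole_le hμ j _
  · calc μ (⋃ z' ∈ N', ⋃ u ∈ B z, ⋃ v ∈ B z', E u v)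
        ≤ ∑ z' ∈ N', ∑ u ∈ B z, ∑ v ∈ B z', (ε + ε + e) := by
          refine (measure_biUnion_finset_le _ _).trans (Finset.sum_le_sum fun z' hz' => ?_)
          refine (measure_biUnion_finset_le _ _).trans (Finset.sum_le_sum fun u hu => ?_)
          exact (measure_biUnion_finset_le _ _).trans (Finset.sum_le_sum fun v hv =>
            hE z' hz' u hu v hv)
      _ = (N'.card * ((2 * j + 1) ^ d * (2 * j + 1) ^ d) : ℕ) * (ε + ε + e) := by
          simp only [Finset.sum_const, hB, nsmul_eq_mul]
          push_cast
          ring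
      _ ≤ _ := by
          gcongr

lemma exists_separated_subset (R : ℕ) (hR : 0 < R) (S : Finset (ℤ × ℤ)) :
    ∃ S' ⊆ S, S.card ≤ R ^ 2 * S'.card ∧ ∀ u ∈ S', ∀ v ∈ S', u ≠ v →
      (R : ℤ) ≤ |u.1 - v.1| ∨ (R : ℤ) ≤ |u.2 - v.2| := by
  let f : ℤ × ℤ → ℤ × ℤ := fun u => (u.1 % R, u.2 % R)
  let T : Finset (ℤ × ℤ) := Finset.Ico 0 (R : ℤ) ×ˢ Finset.Ico 0 (R : ℤ)
  have hR' : (0 : ℤ) < R := by exact_mod_cast hR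
  have hT : T.card = R ^ 2 := by simp [T, Finset.card_product, sq]
  have hf : ∀ u ∈ S, f u ∈ T := by
    intro u _
    simp only [f, T, Finset.mem_product, Finset.mem_Ico]
    exact ⟨⟨Int.emod_nonneg _ hR'.ne', Int.emod_lt_of_pos _ hR'⟩,
      Int.emod_nonneg _ hR'.ne', Int.emod_lt_of_pos _ hR'⟩
  have hex : ∃ t ∈ T, S.card ≤ R ^ 2 * (S.filter fun u => f u = t).card := by
    by_contra hc
    push Not at hc
    have hne : T.Nonempty := by
      rw [← Finset.card_pos, hT]; positivity
    have h1 := Finset.card_eq_sum_card_fiberwise hf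
    have h2 : ∑ t ∈ T, R ^ 2 * (S.filter fun u => f u = t).card < ∑ t ∈ T, S.card :=
      Finset.sum_lt_sum_of_nonempty hne hc
    rw [← Finset.mul_sum, ← h1, Finset.sum_const, hT, smul_eq_mul] at h2
    exact lt_irrefl _ h2
  obtain ⟨t, -, ht⟩ := hex
  refine ⟨S.filter fun u => f u = t, Finset.filter_subset _ _, ht, ?_⟩
  intro u hu v hv huv
  have h1 : f u = f v := (Finset.mem_filter.1 hu).2.trans (Finset.mem_filter.1 hv).2.symm
  simp only [f, Prod.mk.injEq] at h1
  have key : ∀ a b : ℤ, a % R = b % R → a ≠ b → (R : ℤ) ≤ |a - b| := by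
    intro a b h hab
    have h2 : (R : ℤ) ∣ a - b := Int.ModEq.dvd (show b ≡ a [ZMOD R] from h.symm)
    exact Int.le_of_dvd (abs_pos.2 (sub_ne_zero.2 hab)) ((dvd_abs _ _).2 h2)
  by_cases h3 : u.1 = v.1
  · right
    exact key _ _ h1.2 fun h4 => huv (Prod.ext h3 h4)
  · exact Or.inl (key _ _ h1.1 h3)

lemma measure_all_bad_le (hd : 2 ≤ d) {p : ℝ} {μ : Measure (Config d)} (hμ : IsBernoulli d p μ)
    {j k K L R : ℕ} (hL : K + j + k ≤ L) (hR : 2 * L < K * R) (hR0 : 0 < R)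
    (q : ℝ≥0∞) (hq : q ≤ 1) (hbad : ∀ z, μ {ω | ¬ GoodBlock j k K L z ω} ≤ q ^ (R ^ 2))
    (S : Finset (ℤ × ℤ)) :
    μ {ω | ∀ z ∈ S, ¬ GoodBlock j k K L z ω} ≤ q ^ S.card := by
  obtain ⟨S', hS', hcard, hsep⟩ := exists_separated_subset R hR0 S
  have hloc : ∀ z, LocalOn (boxEdges d L (site d K z)) {ω | ¬ GoodBlock j k K L z ω} := by
    intro z ω ω' h hb hg
    exact hb (localOn_goodBlock hL z ω' ω (fun e he => (h e he).symm) hg)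
  have h1 := (measure_biInter_local hμ S' (fun z => boxEdges d L (site d K z))
    (fun z => {ω | ¬ GoodBlock j k K L z ω}) (fun z _ => hloc z) (fun z _ => finite_boxEdges _ _)
    (fun z hz z' hz' hne => disjoint_boxEdges
      (lt_of_lt_of_le hR (le_normInf_site hd (hsep z hz z' hz' hne))))).1
  calc μ {ω | ∀ z ∈ S, ¬ GoodBlock j k K L z ω}
      ≤ μ (⋂ z ∈ S', {ω | ¬ GoodBlock j k K L z ω}) := by
        refine measure_mono fun ω hω => ?_
        simp only [Set.mem_iInter]
        exact fun z hz => hω z (hS' hz)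
    _ ≤ (q ^ (R ^ 2)) ^ S'.card := by
        rw [h1]
        exact (Finset.prod_le_prod' fun z _ => hbad z).trans (by simp)
    _ ≤ q ^ S.card := by
        rw [← pow_mul]
        exact pow_le_pow_right_of_le_one' hq hcard

/-- The walk from `(x, 0)` with prescribed steps in `{-1, 0, 1}²`. -/
def stepWalk (x : ℕ) (s : Fin x → Fin 3 × Fin 3) : ℕ → ℤ × ℤ
  | 0 => (x, 0)
  | i + 1 =>
    if h : i < x then
      stepWalk x s i + ((((s ⟨i, h⟩).1 : ℕ) : ℤ) - 1, (((s ⟨i, h⟩).2 : ℕ) : ℤ) - 1)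
    else stepWalk x s i

lemma exists_stepWalk_eq (x : ℕ) (w : ℕ → ℤ × ℤ) (h0 : w 0 = ((x : ℤ), 0))
    (hw : ∀ i < x, |(w (i + 1)).1 - (w i).1| ≤ 1 ∧ |(w (i + 1)).2 - (w i).2| ≤ 1) :
    ∃ s, ∀ i ≤ x, stepWalk x s i = w i := by
  have key : ∀ a : ℤ, |a| ≤ 1 → (a + 1).toNat < 3 := by
    intro a ha
    rw [abs_le] at ha
    omega
  refine ⟨fun i => (⟨((w (i + 1)).1 - (w i).1 + 1).toNat, key _ (hw i i.2).1⟩,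
    ⟨((w (i + 1)).2 - (w i).2 + 1).toNat, key _ (hw i i.2).2⟩), ?_⟩
  intro i hi
  induction i with
  | zero => simp [stepWalk, h0]
  | succ i ih =>
    have hlt : i < x := hi
    obtain ⟨h1, h2⟩ := hw i hlt
    rw [abs_le] at h1 h2
    rw [stepWalk, dif_pos hlt, ih hlt.le]
    ext
    · simp only [Prod.fst_add]; omega
    · simp only [Prod.snd_add]; omega

lemma measure_exists_bad_sequence_le {μ : Measure (Config d)} (Bad : ℤ × ℤ → Config d → Prop)
    (h : ∀ S : Finset (ℤ × ℤ), μ {ω | ∀ z ∈ S, Bad z ω} ≤ ENNReal.ofReal ((1 / 18) ^ S.card))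
    (m : ℕ) :
    μ {ω | ∃ x : ℕ, m < x ∧ ∃ w : ℕ → ℤ × ℤ, w 0 = ((x : ℤ), 0) ∧
      (∀ i < x, |(w (i + 1)).1 - (w i).1| ≤ 1 ∧ |(w (i + 1)).2 - (w i).2| ≤ 1) ∧
      Set.InjOn w (Set.Iic x) ∧ ∀ i ≤ x, Bad (w i) ω} ≤ ENNReal.ofReal ((1 / 2) ^ m) := by
  let E : (x : ℕ) → (Fin x → Fin 3 × Fin 3) → Set (Config d) := fun x s =>
    {ω | Set.InjOn (stepWalk x s) (Set.Iic x) ∧ ∀ i ≤ x, Bad (stepWalk x s i) ω}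
  have hE : ∀ x s, μ (E x s) ≤ ENNReal.ofReal ((1 / 18) ^ (x + 1)) := by
    intro x s
    by_cases hinj : Set.InjOn (stepWalk x s) (Set.Iic x)
    · have hc : ((Finset.Iic x).image (stepWalk x s)).card = x + 1 := by
        rw [Finset.card_image_of_injOn (by simpa using hinj), Nat.card_Iic]
      rw [← hc]
      refine (measure_mono ?_).trans (h _)
      rintro ω ⟨-, hω⟩ z hz
      obtain ⟨i, hi, rfl⟩ := Finset.mem_image.1 hz
      exact hω i (Finset.mem_Iic.1 hi)
    · have : E x s = ∅ := Set.eq_empty_of_forall_notMem fun ω hω => hinj hω.1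
      rw [this, measure_empty]
      exact bot_le
  have hsub : {ω | ∃ x : ℕ, m < x ∧ ∃ w : ℕ → ℤ × ℤ, w 0 = ((x : ℤ), 0) ∧
      (∀ i < x, |(w (i + 1)).1 - (w i).1| ≤ 1 ∧ |(w (i + 1)).2 - (w i).2| ≤ 1) ∧
      Set.InjOn w (Set.Iic x) ∧ ∀ i ≤ x, Bad (w i) ω} ⊆ ⋃ i : ℕ, ⋃ s, E (m + 1 + i) s := by
    rintro ω ⟨x, hx, w, h0, hw, hinj, hb⟩
    obtain ⟨s, hs⟩ := exists_stepWalk_eq x w h0 hw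
    obtain ⟨i, rfl⟩ := Nat.exists_eq_add_of_le (show m + 1 ≤ x from hx)
    rw [Set.mem_iUnion₂]
    refine ⟨i, s, ?_, fun a ha => ?_⟩
    · intro a ha b hb hab
      rw [hs a ha, hs b hb] at hab
      exact hinj ha hb hab
    · rw [hs a ha]
      exact hb a ha
  refine (measure_mono hsub).trans ((measure_iUnion_le _).trans ?_)
  have hterm : ∀ i : ℕ, μ (⋃ s, E (m + 1 + i) s) ≤
      ENNReal.ofReal ((1 / 2) ^ (m + 2)) * ENNReal.ofReal (1 / 2) ^ i := by
    intro i
    refine (measure_iUnion_le _).trans ?_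
    rw [tsum_fintype]
    refine (Finset.sum_le_sum fun s _ => hE _ s).trans ?_
    rw [Finset.sum_const, Finset.card_univ, Fintype.card_fun, Fintype.card_prod, Fintype.card_fin,
      Fintype.card_fin, nsmul_eq_mul, ← ENNReal.ofReal_natCast, ← ENNReal.ofReal_mul (by positivity),
      ← ENNReal.ofReal_pow (by norm_num), ← ENNReal.ofReal_mul (by positivity)]
    apply ENNReal.ofReal_le_ofReal
    push_cast
    have h1 : (9 : ℝ) ^ (m + 1 + i) * (1 / 18) ^ (m + 1 + i + 1) =
        (1 / 2) ^ (m + 1 + i) * (1 / 18) := by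
      rw [pow_succ (1 / 18 : ℝ), ← mul_assoc, ← mul_pow]
      norm_num
    have h2 : (1 / 2 : ℝ) ^ (m + 2) * (1 / 2) ^ i = (1 / 2) ^ (m + 1 + i) * (1 / 2) := by
      ring
    rw [h1, h2]
    gcongr
    norm_num
  refine (ENNReal.tsum_le_tsum hterm).trans ?_
  rw [ENNReal.tsum_mul_left, ENNReal.tsum_geometric]
  have h3 : (1 - ENNReal.ofReal (1 / 2))⁻¹ = ENNReal.ofReal 2 := by
    rw [← ENNReal.ofReal_one, ← ENNReal.ofReal_sub _ (by norm_num),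
      ← ENNReal.ofReal_inv_of_pos (by norm_num)]
    norm_num
  rw [h3, ← ENNReal.ofReal_mul (by positivity)]
  apply ENNReal.ofReal_le_ofReal
  rw [pow_add]
  have : (0 : ℝ) < (1 / 2) ^ m := by positivity
  linarith

end Renormalization

section HoleTail

variable {d : ℕ}

lemma exists_bad_sequence_of_hole (hd : 2 ≤ d) {ω : Config d} {j k K L : ℕ} (hjK : 2 * j < K)
    (m : ℕ) (hole : Hole (K * (m + 2)) 0 ω) :
    ∃ x : ℕ, m < x ∧ ∃ w : ℕ → ℤ × ℤ, w 0 = ((x : ℤ), 0) ∧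
      (∀ i < x, |(w (i + 1)).1 - (w i).1| ≤ 1 ∧ |(w (i + 1)).2 - (w i).2| ≤ 1) ∧
      Set.InjOn w (Set.Iic x) ∧ ∀ i ≤ x, ¬ GoodBlock j k K L (w i) ω := by
  let step : ℤ × ℤ → ℤ × ℤ → Prop := fun u v => PlaneAdj u v ∧ GoodBlock j k K L v ω
  let A : Set (ℤ × ℤ) := {v | ∃ i : ℤ, 0 ≤ i ∧ i ≤ m ∧ Relation.ReflTransGen step (i, 0) v}
  have hIA : ∀ i : ℤ, 0 ≤ i → i ≤ m → ((i, 0) : ℤ × ℤ) ∈ A := fun i h0 hm =>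
    ⟨i, h0, hm, Relation.ReflTransGen.refl⟩
  have hA : A.Finite := by
    by_contra hinf
    let N : Set (ℤ × ℤ) := Set.Icc (-1) (m + 1 : ℤ) ×ˢ Set.Icc (-1 : ℤ) 1
    have hN : N.Finite := (Set.finite_Icc _ _).prod (Set.finite_Icc _ _)
    have hsub : A ⊆ N ∪ ⋃ s ∈ N, {v | GoodBlock j k K L s ω ∧ Relation.ReflTransGen step s v} := by
      rintro v ⟨i, h0, hm, hv⟩
      rcases Relation.ReflTransGen.cases_head hv with rfl | ⟨s, hs, hsv⟩
      · left
        simp only [N, Set.mem_prod, Set.mem_Icc]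
        omega
      · right
        rw [Set.mem_iUnion₂]
        refine ⟨s, ?_, hs.2, hsv⟩
        have := planeAdj_abs_le (Or.inr hs.1)
        simp only [abs_le] at this
        simp only [N, Set.mem_prod, Set.mem_Icc]
        omega
    have hex : ∃ s ∈ N, {v | GoodBlock j k K L s ω ∧ Relation.ReflTransGen step s v}.Infinite := by
      by_contra hc
      push Not at hc
      exact hinf ((hN.union (hN.biUnion fun s hs => hc s hs)).subset hsub)
    obtain ⟨s, hsN, hs⟩ := hex
    obtain ⟨v₀, hgood, -⟩ := hs.nonempty
    obtain ⟨⟨x, hx, hxf⟩, -⟩ := id hgood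
    have hconn : ∀ v, Relation.ReflTransGen step s v → GoodBlock j k K L v ω ∧
        ∃ y ∈ boxZ d j (site d K v), Far k y ω ∧ Conn ω x y := by
      intro v hv
      induction hv with
      | refl => exact ⟨hgood, x, hx, hxf, Conn.refl x⟩
      | tail _ hst ih =>
        obtain ⟨hb, y, hy, hyf, hxy⟩ := ih
        obtain ⟨y', hy', hyf'⟩ := hst.2.1
        exact ⟨hst.2, y', hy', hyf',
          hxy.trans (hb.2 _ (Or.inr hst.1) y hy y' hy' hyf hyf').conn⟩
    choose! y hy using fun v hv => (hconn v hv).2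
    have hxi : InInfCluster d ω x := by
      rw [inInfCluster_iff]
      have hinj : Set.InjOn y {v | GoodBlock j k K L s ω ∧ Relation.ReflTransGen step s v} := by
        intro u hu v hv huv
        by_contra hne
        have h1 := (hy u hu.2).1
        have h2 := (hy v hv.2).1
        rw [← huv, mem_boxZ] at h2
        rw [mem_boxZ] at h1
        have h3 : (1 : ℕ) ≤ |u.1 - v.1| ∨ (1 : ℕ) ≤ |u.2 - v.2| := by
          by_contra hh
          push Not at hh
          refine hne (Prod.ext ?_ ?_)
          · have := abs_lt.1 hh.1
            push_cast at this
            omega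
          · have := abs_lt.1 hh.2
            push_cast at this
            omega
        have h4 := le_normInf_site hd (K := K) h3
        have h5 := normInf_sub_le (site d K u) (y u) (site d K v)
        rw [normInf_sub_comm (site d K u) (y u)] at h5
        omega
      refine (hs.image hinj).mono ?_
      rintro _ ⟨v, hv, rfl⟩
      exact (hy v hv.2).2.2
    refine hole x ?_ hxi
    rw [mem_boxZ] at *
    simp only [N, Set.mem_prod, Set.mem_Icc] at hsN
    have h1 := normInf_site_le (d := d) (K := K) (N := m + 1) (u := s) (v := (0, 0))
      (by rw [abs_le]; push_cast; omega) (by rw [abs_le]; push_cast; omega)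
    have h2 : site d K (0, 0) = 0 := by ext i; simp [site]
    have h3 := normInf_sub_le x (site d K s) 0
    rw [h2] at h1
    rw [mul_add] at *
    omega
  refine exists_star_sequence A {v | ¬ GoodBlock j k K L v ω} hA m hIA ?_ ?_
  · rintro v ⟨i, h0, hm, hv⟩
    have h1 := reachable_row A 0 i 0 h0 (fun x hx hxi => hIA x hx (hxi.trans hm))
    refine h1.trans ?_
    induction hv with
    | refl => exact SimpleGraph.Reachable.refl _
    | tail hu hst ih =>
      have hadj : (planeGraph A).Adj _ _ := ⟨⟨i, h0, hm, hu⟩, ⟨i, h0, hm, hu.tail hst⟩, hst.1⟩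
      exact ih.trans hadj.reachable
  · rintro u ⟨i, h0, hm, hu⟩ v hv huv hg
    exact hv ⟨i, h0, hm, hu.tail ⟨huv, hg⟩⟩

/-- Holes of the infinite cluster have exponential tails. -/
theorem exists_hole_tail (hd : 2 ≤ d) {p ρ : ℝ} {μ : Measure (Config d)} (hμ : IsBernoulli d p μ)
    (hρ : GMprop d μ ρ) : ∃ c : ℝ, 0 < c ∧ ∀ (M : ℕ) (z : ZVec d),
      μ {ω | Hole M z ω} ≤ ENNReal.ofReal (c⁻¹ * Real.exp (-c * M)) := by
  have := hμ.1
  obtain ⟨c₀, hc₀, hdev⟩ := exists_chemical_deviation hμ hρ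
  have hun : ∀ᵐ ω ∂μ, ∀ x y, InInfCluster d ω x → InInfCluster d ω y → Conn ω x y :=
    (ae_unique_infinite_cluster (by omega) hμ hρ).mono fun ω h => h.2
  obtain ⟨r, hr⟩ := exists_nat_ge ρ
  have hr1 : 1 ≤ r := by
    have := hρ.1.trans hr
    exact_mod_cast this
  set R := 4 * r + 3 with hRdef
  set δ : ℝ≥0∞ := ENNReal.ofReal (1 / 18) ^ (R ^ 2) with hδ
  have hδ0 : 0 < δ := ENNReal.pow_pos (by simp) _
  obtain ⟨j, hj⟩ := ((tendsto_hole (by omega) hμ hρ).eventually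
    (gt_mem_nhds (ENNReal.half_pos hδ0.ne'))).exists
  set n : ℕ := 9 * ((2 * j + 1) ^ d * (2 * j + 1) ^ d) with hn
  have hn0 : 0 < n := by positivity
  set δ' : ℝ≥0∞ := δ / 2 / (n * 3 : ℕ) with hδ'
  have hδ'0 : 0 < δ' := ENNReal.div_pos (ENNReal.half_pos hδ0.ne').ne' (ENNReal.natCast_ne_top _)
  obtain ⟨k, hk⟩ := ((tendsto_far_diff hμ).eventually (gt_mem_nhds hδ'0)).exists
  have hexp : Filter.Tendsto (fun K : ℕ => ENNReal.ofReal (c₀⁻¹ * Real.exp (-c₀ * (2 * r * K : ℕ))))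
      Filter.atTop (nhds (ENNReal.ofReal (c₀⁻¹ * 0))) := by
    refine ENNReal.tendsto_ofReal (Filter.Tendsto.const_mul _ (Real.tendsto_exp_atBot.comp ?_))
    refine Filter.Tendsto.const_mul_atTop_of_neg (by linarith) ?_
    refine tendsto_natCast_atTop_atTop.comp ?_
    exact Filter.tendsto_id.const_mul_atTop' (by positivity)
  rw [mul_zero, ENNReal.ofReal_zero] at hexp
  obtain ⟨K, hK1, hK2⟩ := ((hexp.eventually (gt_mem_nhds hδ'0)).and
    (Filter.eventually_ge_atTop (2 * j + k + 1))).exists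
  set L := (2 * r + 1) * K with hL
  have hKr : K ≤ r * K := Nat.le_mul_of_pos_left K hr1
  have hLK : L = 2 * (r * K) + K := by rw [hL]; ring
  have hbad : ∀ z, μ {ω | ¬ GoodBlock j k K L z ω} ≤ ENNReal.ofReal (1 / 18) ^ (R ^ 2) := by
    intro z
    refine (measure_bad_le hμ j k K L (2 * r * K) (by rw [mul_assoc]; omega) _ hun
      (fun u v huv => hdev u v (2 * r * K) ?_) z).trans ?_
    · have h1 : (normInf d (v - u) : ℝ) ≤ 2 * K := by
        have : normInf d (v - u) ≤ 2 * K := by omega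
        exact_mod_cast this
      push_cast
      have h2 : (0 : ℝ) ≤ normInf d (v - u) := by positivity
      nlinarith [hρ.1]
    · rw [← hδ, ← ENNReal.add_halves δ]
      refine add_le_add hj.le ?_
      calc (n : ℝ≥0∞) * _ ≤ n * (δ' + δ' + δ') := by gcongr
        _ = δ' * (n * 3 : ℕ) := by push_cast; ring
        _ ≤ δ / 2 := (ENNReal.div_mul_cancel (by
            have : n * 3 ≠ 0 := by omega
            exact_mod_cast this) (ENNReal.natCast_ne_top _)).le
  have hseq : ∀ m : ℕ, μ {ω | Hole (K * (m + 2)) 0 ω} ≤ ENNReal.ofReal ((1 / 2) ^ m) := by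
    intro m
    refine le_trans (measure_mono ?_) (measure_exists_bad_sequence_le
      (fun z ω => ¬ GoodBlock j k K L z ω) (fun S => ?_) m)
    · exact fun ω hω => exists_bad_sequence_of_hole hd (by omega) m hω
    rw [ENNReal.ofReal_pow (by norm_num)]
    refine measure_all_bad_le hd hμ (R := R) (by omega) ?_ (by omega) _ ?_ hbad S
    · have : K * R = 4 * (r * K) + 3 * K := by rw [hRdef]; ring
      omega
    · rw [← ENNReal.ofReal_one]
      exact ENNReal.ofReal_le_ofReal (by norm_num)
  have hK0 : (0 : ℝ) < K := by
    have : 0 < K := by omega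
    exact_mod_cast this
  set b := Real.log 2 / K with hb
  have hb0 : 0 < b := div_pos (Real.log_pos (by norm_num)) hK0
  refine ⟨min b (1 / 8), lt_min hb0 (by norm_num), fun M z => ?_⟩
  set c := min b (1 / 8) with hc
  have hc0 : 0 < c := lt_min hb0 (by norm_num)
  have hc8 : 8 ≤ c⁻¹ := by
    rw [le_inv_comm₀ (by norm_num) hc0]
    exact (min_le_right _ _).trans (by norm_num)
  refine (measure_hole_le hμ M z).trans ?_
  have hdiv : M / K - 2 + 3 ≥ M / K + 1 := by omega
  have hbound : (1 / 2 : ℝ) ^ (M / K - 2) ≤ 8 * Real.exp (-c * M) := by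
    have h1 : Real.exp (-b * M) ≤ Real.exp (-c * M) := by
      apply Real.exp_le_exp.2
      have : c ≤ b := min_le_left _ _
      have hM : (0 : ℝ) ≤ M := by positivity
      nlinarith
    have h2 : (M : ℝ) ≤ K * (M / K - 2 + 3 : ℕ) := by
      have h3 := Nat.lt_mul_div_succ M (show 0 < K by omega)
      have h4 : K * (M / K + 1) ≤ K * (M / K - 2 + 3) := Nat.mul_le_mul_left K hdiv
      exact_mod_cast h3.le.trans h4
    have h5 : (1 / 2 : ℝ) ^ (M / K - 2 + 3) ≤ Real.exp (-b * M) := by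
      have h6 : (1 / 2 : ℝ) = Real.exp (-Real.log 2) := by
        rw [Real.exp_neg, Real.exp_log (by norm_num)]; norm_num
      rw [h6, ← Real.exp_nat_mul]
      apply Real.exp_le_exp.2
      have h7 : b * M ≤ b * (K * (M / K - 2 + 3 : ℕ)) := mul_le_mul_of_nonneg_left h2 hb0.le
      have h8 : b * K = Real.log 2 := by rw [hb]; field_simp
      rw [← mul_assoc, h8] at h7
      linarith
    rw [pow_add] at h5
    linarith
  rcases lt_or_ge (M / K) 2 with h | h
  · refine prob_le_one.trans ?_
    rw [← ENNReal.ofReal_one]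
    apply ENNReal.ofReal_le_ofReal
    have h0 : M / K - 2 = 0 := by omega
    rw [h0, pow_zero] at hbound
    exact hbound.trans (mul_le_mul_of_nonneg_right hc8 (Real.exp_pos _).le)
  · have h9 : K * (M / K - 2 + 2) ≤ M := by
      rw [Nat.sub_add_cancel h]
      exact Nat.mul_div_le M K
    refine (measure_mono fun ω hω => ?_).trans ((hseq (M / K - 2)).trans
      (ENNReal.ofReal_le_ofReal (hbound.trans (mul_le_mul_of_nonneg_right hc8 (Real.exp_pos _).le))))
    exact fun x hx => hω x (le_trans hx h9)

end HoleTail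

section Cost

variable {d n : ℕ} {ω : Config d}

lemma pairWeight_nonneg (x y : ZVec d) : 0 ≤ pairWeight d n ω x y := by
  rw [pairWeight]
  split_ifs <;> positivity

lemma one_le_pairWeight (hn : 1 ≤ Real.log n ^ 2) (x y : ZVec d) : 1 ≤ pairWeight d n ω x y := by
  rw [pairWeight]
  split_ifs
  · exact le_rfl
  · exact hn

lemma pathCost_nonneg (γ : List (ZVec d)) : 0 ≤ pathCost d n ω γ := by
  induction γ with
  | nil => exact le_rfl
  | cons x γ ih =>
    cases γ with
    | nil => exact le_rfl
    | cons y γ => exact add_nonneg (pairWeight_nonneg x y) ih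

lemma pathCost_append_cons (l₁ l₂ : List (ZVec d)) (w : ZVec d) :
    pathCost d n ω (l₁ ++ w :: l₂) = pathCost d n ω (l₁ ++ [w]) + pathCost d n ω (w :: l₂) := by
  induction l₁ with
  | nil => simp [pathCost]
  | cons x l₁ ih =>
    cases l₁ with
    | nil => simp [pathCost]
    | cons y l₁ =>
      simp only [List.cons_append, pathCost] at ih ⊢
      rw [ih]
      ring

lemma pathCost_append_left {ζ : List (ZVec d)} {a : ZVec d} (h : ζ.head? = some a)
    (l : List (ZVec d)) :
    pathCost d n ω (l ++ ζ) = pathCost d n ω (l ++ [a]) + pathCost d n ω ζ := by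
  obtain ⟨t, rfl⟩ := List.head?_eq_some_iff.1 h
  exact pathCost_append_cons l t a

lemma pathCost_append_right {ζ : List (ZVec d)} {b : ZVec d} (h : ζ.getLast? = some b)
    (l : List (ZVec d)) :
    pathCost d n ω (ζ ++ l) = pathCost d n ω ζ + pathCost d n ω (b :: l) := by
  obtain ⟨t, rfl⟩ := List.getLast?_eq_some_iff.1 h
  rw [List.append_assoc]
  exact pathCost_append_cons t l b

lemma pathCost_eq_of_isOpenPath {γ : List (ZVec d)} (h : IsOpenPath d ω γ) :
    pathCost d n ω γ = (γ.length - 1 : ℕ) := by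
  induction γ with
  | nil => simp [pathCost]
  | cons x γ ih =>
    cases γ with
    | nil => simp [pathCost]
    | cons y γ =>
      obtain ⟨h1, h2⟩ := List.isChain_cons_cons.1 h
      rw [pathCost, ih h2, pairWeight, if_pos h1]
      simp only [List.length_cons, Nat.add_sub_cancel, Nat.cast_add, Nat.cast_one]
      ring

lemma normInf_le_pathCost (hn : 1 ≤ Real.log n ^ 2) {γ : List (ZVec d)} (hγ : γ.IsChain (Adj d))
    {a b : ZVec d} (ha : γ.head? = some a) (hb : γ.getLast? = some b) :
    (normInf d (a - b) : ℝ) ≤ pathCost d n ω γ := by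
  induction γ generalizing a with
  | nil => simp at ha
  | cons x γ ih =>
    simp only [List.head?_cons, Option.some.injEq] at ha
    subst ha
    cases γ with
    | nil =>
      simp only [List.getLast?_singleton, Option.some.injEq] at hb
      subst hb
      simp [normInf_zero, pathCost]
    | cons y γ =>
      obtain ⟨h1, h2⟩ := List.isChain_cons_cons.1 hγ
      have h3 := ih h2 rfl (by simpa using hb)
      have h4 : (normInf d (x - b) : ℝ) ≤ normInf d (x - y) + normInf d (y - b) := by
        exact_mod_cast normInf_sub_le x y b
      have h5 : (normInf d (x - y) : ℝ) ≤ 1 := by exact_mod_cast h1.normInf_le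
      have h6 := one_le_pairWeight (ω := ω) hn x y
      rw [pathCost]
      linarith

/-- Loop erasure does not increase the cost. -/
lemma exists_path_pathCost_le {γ : List (ZVec d)} (hne : γ ≠ []) (hγ : γ.IsChain (Adj d)) :
    ∃ γ', IsPath d γ' ∧ (∀ v ∈ γ', v ∈ γ) ∧ γ'.head? = γ.head? ∧ γ'.getLast? = γ.getLast? ∧
      pathCost d n ω γ' ≤ pathCost d n ω γ := by
  induction γ with
  | nil => exact absurd rfl hne
  | cons x γ ih =>
    cases γ with
    | nil =>
      exact ⟨[x], ⟨by simp, by simp, List.isChain_singleton x⟩, by simp, rfl, rfl, le_rfl⟩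
    | cons y γ =>
      obtain ⟨h1, h2⟩ := List.isChain_cons_cons.1 hγ
      obtain ⟨γ', ⟨hne', hnd, hch⟩, hsub, hhead, hlast, hcost⟩ := ih (by simp) h2
      have hcost' := hcost.trans (le_add_of_nonneg_left (pairWeight_nonneg (n := n) (ω := ω) x y))
      by_cases hx : x ∈ γ'
      · obtain ⟨s, t, rfl⟩ := List.append_of_mem hx
        refine ⟨x :: t, ⟨by simp, (List.nodup_append.1 hnd).2.1, (List.isChain_append.1 hch).2.1⟩,
          fun v hv => List.mem_cons_of_mem _ (hsub v (List.mem_append_right _ hv)), rfl, ?_, ?_⟩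
        · rw [List.getLast?_cons_cons, ← hlast, List.getLast?_append, List.getLast?_cons,
            Option.some_or]
        · rw [pathCost_append_cons] at hcost'
          exact (le_add_of_nonneg_left (pathCost_nonneg _)).trans hcost'
      · obtain ⟨t, rfl⟩ := List.head?_eq_some_iff.1 hhead
        refine ⟨x :: y :: t, ⟨by simp, List.nodup_cons.2 ⟨hx, hnd⟩,
          List.isChain_cons_cons.2 ⟨h1, hch⟩⟩, ?_, rfl, ?_, ?_⟩
        · intro v hv
          rcases List.mem_cons.1 hv with rfl | hv
          · simp
          · exact List.mem_cons_of_mem _ (hsub v hv)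
        · rw [List.getLast?_cons_cons, hlast, List.getLast?_cons_cons]
        · exact add_le_add le_rfl hcost

lemma IsPath.segment {γ l₁ l₂ : List (ZVec d)} (h : IsPath d (l₁ ++ γ ++ l₂)) (hne : γ ≠ []) :
    IsPath d γ :=
  ⟨hne, (List.nodup_append.1 (List.nodup_append.1 h.2.1).1).2.1,
    (List.isChain_append.1 (List.isChain_append.1 h.2.2).1).2.1⟩

/-- A nonempty segment of a geodesic is a geodesic. -/
lemma IsGeodesicIn.segment {A : Set (ZVec d)} {γ l₁ l₂ : List (ZVec d)}
    (h : IsGeodesicIn d n ω A (l₁ ++ γ ++ l₂)) (hne : γ ≠ []) : IsGeodesicIn d n ω A γ := by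
  obtain ⟨hp, hA, hmin⟩ := h
  refine ⟨hp.segment hne, fun v hv => hA v (by simp [hv]), fun ζ hζ hζA hhead hlast => ?_⟩
  obtain ⟨a, ha⟩ : ∃ a, γ.head? = some a := ⟨γ.head hne, List.head?_eq_some_head hne⟩
  obtain ⟨b, hb⟩ : ∃ b, γ.getLast? = some b := ⟨γ.getLast hne, List.getLast?_eq_some_getLast hne⟩
  have hch : (l₁ ++ ζ ++ l₂).IsChain (Adj d) := by
    have h1 := hp.2.2
    rw [List.append_assoc] at h1 ⊢
    obtain ⟨h2, h3, h4⟩ := List.isChain_append.1 h1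
    obtain ⟨h5, h6, h7⟩ := List.isChain_append.1 h3
    refine List.isChain_append.2 ⟨h2, List.isChain_append.2 ⟨hζ.2.2, h6, ?_⟩, ?_⟩
    · rwa [hlast]
    · have : (ζ ++ l₂).head? = (γ ++ l₂).head? := by rw [List.head?_append, List.head?_append, hhead]
      rwa [this]
  obtain ⟨γ', h1, h2, h3, h4, h5⟩ := exists_path_pathCost_le (n := n) (ω := ω)
    (γ := l₁ ++ ζ ++ l₂) (by simp [hζ.1]) hch
  have h6 := hmin γ' h1 ?_ ?_ ?_
  · have h7 := h6.trans h5
    rw [List.append_assoc, List.append_assoc,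
      pathCost_append_left (a := a) (by rw [List.head?_append, ha]; rfl),
      pathCost_append_left (ζ := ζ ++ l₂) (a := a) (by rw [List.head?_append, hhead, ha]; rfl),
      pathCost_append_right hb, pathCost_append_right (ζ := ζ) (hlast.trans hb)] at h7
    linarith
  · intro v hv
    have h8 := h2 v hv
    simp only [List.mem_append] at h8
    rcases h8 with (h8 | h8) | h8
    · exact hA v (by simp [h8])
    · exact hζA v h8
    · exact hA v (by simp [h8])
  · rw [h3, List.append_assoc, List.append_assoc, List.head?_append, List.head?_append,
      List.head?_append, List.head?_append, hhead]
  · rw [h4, List.getLast?_append, List.getLast?_append, List.getLast?_append,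
      List.getLast?_append, hlast]

lemma IsGeodesicIn.mono {A B : Set (ZVec d)} {γ : List (ZVec d)} (h : IsGeodesicIn d n ω A γ)
    (hB : ∀ v ∈ γ, v ∈ B) (hBA : B ⊆ A) : IsGeodesicIn d n ω B γ :=
  ⟨h.1, hB, fun γ' h1 h2 => h.2.2 γ' h1 fun v hv => hBA (h2 v hv)⟩

/-- A geodesic cannot make a detour between two points which are joined by a short open path. -/
lemma IsGeodesicIn.normInf_add_le {A : Set (ZVec d)} (hn : 1 ≤ Real.log n ^ 2)
    {P Q : List (ZVec d)} {w a b : ZVec d} {L : ℕ} (h : IsGeodesicIn d n ω A (P ++ w :: Q))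
    (ha : a ∈ P) (hb : b ∈ Q) (hab : OpenConn ω A a b L) :
    normInf d (a - w) + normInf d (w - b) ≤ L := by
  obtain ⟨P₁, P₂, rfl⟩ := List.append_of_mem ha
  obtain ⟨Q₁, Q₂, rfl⟩ := List.append_of_mem hb
  have h1 : IsGeodesicIn d n ω A ((a :: P₂) ++ (w :: (Q₁ ++ [b]))) := by
    refine IsGeodesicIn.segment (l₁ := P₁) (l₂ := Q₂) ?_ (by simp)
    simpa using h
  obtain ⟨ζ, hζ, hζo, hζA, hhead, hlast, hlen⟩ := hab.exists_path
  have h2 := h1.2.2 ζ hζ hζA (by rw [hhead]; rfl)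
    (by rw [hlast, List.getLast?_append, ← List.cons_append, List.getLast?_concat, Option.some_or])
  rw [pathCost_eq_of_isOpenPath hζo, pathCost_append_cons] at h2
  have hch := h1.1.2.2
  have h3 : (a :: P₂ ++ [w]).IsChain (Adj d) := by
    have : (a :: P₂ ++ [w]) ++ (Q₁ ++ [b]) = a :: P₂ ++ (w :: (Q₁ ++ [b])) := by simp
    rw [← this] at hch
    exact (List.isChain_append.1 hch).1
  have h4 := normInf_le_pathCost (ω := ω) hn h3 (a := a) (b := w) rfl
    List.getLast?_concat
  have h5 := normInf_le_pathCost (ω := ω) hn (List.isChain_append.1 hch).2.1 (a := w) (b := b) rfl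
    (by rw [← List.cons_append, List.getLast?_concat])
  have h6 : ((ζ.length - 1 : ℕ) : ℝ) ≤ L := by
    have : ζ.length - 1 ≤ L := by omega
    exact_mod_cast this
  have h7 : (normInf d (a - w) : ℝ) + normInf d (w - b) ≤ L := by linarith
  exact_mod_cast h7

end Cost

section EdgeMem

variable {V : Type*}

lemma List.mem_zip_tail_of_append_left {x y : V} {l₁ l : List V}
    (h : (x, y) ∈ (l₁ ++ l).zip (l₁ ++ l).tail) (hx : x ∉ l₁) : (x, y) ∈ l.zip l.tail := by
  induction l₁ with
  | nil => exact h
  | cons a l₁ ih =>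
    rw [List.mem_cons, not_or] at hx
    refine ih ?_ hx.2
    rw [List.cons_append, List.tail_cons] at h
    generalize l₁ ++ l = m at h ⊢
    cases m with
    | nil => simp at h
    | cons c m =>
      rw [List.zip_cons_cons, List.mem_cons] at h
      rcases h with h | h
      · exact absurd (Prod.ext_iff.1 h).1 hx.1
      · exact h

lemma List.mem_zip_tail_of_append_right {x y : V} {l l₂ : List V}
    (h : (x, y) ∈ (l ++ l₂).zip (l ++ l₂).tail) (hy : y ∉ l₂) : (x, y) ∈ l.zip l.tail := by
  induction l with
  | nil => exact absurd (List.mem_of_mem_tail (List.of_mem_zip h).2) hy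
  | cons a l ih =>
    cases l with
    | nil =>
      exact absurd (List.of_mem_zip h).2 hy
    | cons c l =>
      rw [List.cons_append, List.cons_append, List.tail_cons, List.zip_cons_cons,
        List.mem_cons] at h
      rw [List.tail_cons, List.zip_cons_cons, List.mem_cons]
      exact h.imp id ih

lemma List.mem_zip_tail_append {x y : V} {l₁ l₂ l : List V}
    (h : (x, y) ∈ l.zip l.tail) : (x, y) ∈ (l₁ ++ l ++ l₂).zip (l₁ ++ l ++ l₂).tail := by
  have h1 : (x, y) ∈ (l ++ l₂).zip (l ++ l₂).tail := by
    induction l with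
    | nil => simp at h
    | cons a l ih =>
      cases l with
      | nil => simp at h
      | cons c l =>
        rw [List.tail_cons, List.zip_cons_cons, List.mem_cons] at h
        rw [List.cons_append, List.cons_append, List.tail_cons, List.zip_cons_cons,
          List.mem_cons]
        exact h.imp id ih
  rw [List.append_assoc]
  induction l₁ with
  | nil => exact h1
  | cons a l₁ ih =>
    rw [List.cons_append, List.tail_cons]
    generalize l₁ ++ (l ++ l₂) = m at ih ⊢
    cases m with
    | nil => simp at ih
    | cons c m =>
      rw [List.zip_cons_cons, List.mem_cons]
      exact Or.inr ih

variable {d : ℕ}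

lemma edgeMemPath.mem {x y : ZVec d} {γ : List (ZVec d)} (h : edgeMemPath d x y γ) :
    x ∈ γ ∧ y ∈ γ := by
  rcases h with h | h
  · exact ⟨(List.of_mem_zip h).1, List.mem_of_mem_tail (List.of_mem_zip h).2⟩
  · exact ⟨List.mem_of_mem_tail (List.of_mem_zip h).2, (List.of_mem_zip h).1⟩

lemma edgeMemPath.append {x y : ZVec d} {γ : List (ZVec d)} (h : edgeMemPath d x y γ)
    (l₁ l₂ : List (ZVec d)) : edgeMemPath d x y (l₁ ++ γ ++ l₂) :=
  h.imp List.mem_zip_tail_append List.mem_zip_tail_append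

lemma edgeMemPath.of_append {x y : ZVec d} {γ l₁ l₂ : List (ZVec d)}
    (h : edgeMemPath d x y (l₁ ++ γ ++ l₂)) (hx : x ∉ l₁ ∧ x ∉ l₂) (hy : y ∉ l₁ ∧ y ∉ l₂) :
    edgeMemPath d x y γ := by
  rw [edgeMemPath, List.append_assoc] at h
  refine h.imp (fun h => ?_) (fun h => ?_)
  · exact List.mem_zip_tail_of_append_right (List.mem_zip_tail_of_append_left h hx.1) hy.2
  · exact List.mem_zip_tail_of_append_right (List.mem_zip_tail_of_append_left h hy.1) hx.2

end EdgeMem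

section Translation

variable {d n : ℕ} {ω : Config d}

lemma adj_add_right_iff {x y z : ZVec d} : Adj d (x + z) (y + z) ↔ Adj d x y := by
  rw [Adj, Adj, add_sub_add_right_eq_sub]

lemma isPath_map_add {γ : List (ZVec d)} (z : ZVec d) :
    IsPath d (γ.map (· + z)) ↔ IsPath d γ := by
  have h1 : (γ.map (· + z)).IsChain (Adj d) ↔ γ.IsChain (Adj d) := by
    rw [List.isChain_map]
    simp only [adj_add_right_iff]
  have h2 : (γ.map (· + z)).Nodup ↔ γ.Nodup := List.nodup_map_iff (add_left_injective z)
  exact and_congr (by simp) (and_congr h2 h1)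

lemma isOpenPath_shiftCfg {γ : List (ZVec d)} (z : ZVec d) :
    IsOpenPath d (shiftCfg z ω) γ ↔ IsOpenPath d ω (γ.map (· + z)) := by
  have h1 : γ.IsChain (EdgeOpen d (shiftCfg z ω)) ↔ (γ.map (· + z)).IsChain (EdgeOpen d ω) := by
    rw [List.isChain_map]
    exact ⟨fun h => h.imp fun _ _ => edgeOpen_shiftCfg.1,
      fun h => h.imp fun _ _ => edgeOpen_shiftCfg.2⟩
  exact h1

lemma pathCost_shiftCfg (γ : List (ZVec d)) (z : ZVec d) :
    pathCost d n (shiftCfg z ω) γ = pathCost d n ω (γ.map (· + z)) := by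
  induction γ with
  | nil => rfl
  | cons x γ ih =>
    cases γ with
    | nil => rfl
    | cons y γ =>
      simp only [List.map_cons, pathCost] at ih ⊢
      rw [ih, pairWeight, pairWeight]
      simp only [edgeOpen_shiftCfg]

lemma edgeMemPath_map_add {x y : ZVec d} {γ : List (ZVec d)} (z : ZVec d) :
    edgeMemPath d (x + z) (y + z) (γ.map (· + z)) ↔ edgeMemPath d x y γ := by
  have h : ∀ x y : ZVec d, (x + z, y + z) ∈ (γ.map (· + z)).zip (γ.map (· + z)).tail ↔
      (x, y) ∈ γ.zip γ.tail := by
    intro x y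
    rw [← List.map_tail, List.zip_map, List.mem_map]
    constructor
    · rintro ⟨⟨a, b⟩, h1, h2⟩
      simp only [Prod.map_apply, Prod.mk.injEq, add_left_inj] at h2
      rw [← h2.1, ← h2.2]
      exact h1
    · exact fun h => ⟨(x, y), h, rfl⟩
  exact or_congr (h x y) (h y x)

lemma isGeodesicIn_shiftCfg {A A' : Set (ZVec d)} {γ : List (ZVec d)} {z : ZVec d}
    (hA : ∀ v, v ∈ A ↔ v + z ∈ A') (h : IsGeodesicIn d n ω A' (γ.map (· + z))) :
    IsGeodesicIn d n (shiftCfg z ω) A γ := by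
  obtain ⟨h1, h2, h3⟩ := h
  refine ⟨(isPath_map_add z).1 h1, fun v hv => (hA v).2 (h2 _ (List.mem_map_of_mem hv)), ?_⟩
  intro ζ hζ hζA hhead hlast
  rw [pathCost_shiftCfg, pathCost_shiftCfg]
  refine h3 _ ((isPath_map_add z).2 hζ) ?_ ?_ ?_
  · intro v hv
    obtain ⟨u, hu, rfl⟩ := List.mem_map.1 hv
    exact (hA u).1 (hζA u hu)
  · rw [List.head?_map, List.head?_map, hhead]
  · rw [List.getLast?_map, List.getLast?_map, hlast]

lemma gstarIn_shiftCfg {A A' : Set (ZVec d)} {γ : List (ZVec d)} {z : ZVec d}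
    (hA : ∀ v, v ∈ A ↔ v + z ∈ A') (h : GstarIn d n ω A' (γ.map (· + z))) :
    GstarIn d n (shiftCfg z ω) A γ := by
  obtain ⟨h1, h2, π, h3, h4⟩ := h
  refine ⟨(isPath_map_add z).1 h1, fun v hv => (hA v).2 (h2 _ (List.mem_map_of_mem hv)),
    π.map (· + -z), ?_, ?_⟩
  · refine isGeodesicIn_shiftCfg hA ?_
    rw [List.map_map]
    convert h3
    simp [Function.comp_def]
  · intro x y hxy hxy'
    rw [edgeOpen_shiftCfg]
    refine h4 _ _ ((edgeMemPath_map_add z).2 hxy) fun hc => hxy' ?_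
    have := (edgeMemPath_map_add (-z)).2 hc
    simpa using this

end Translation

section Local

variable {d n : ℕ} {ω : Config d}

/-- A chain containing a point far away from `z` contains a segment which runs from `z` to
distance `M` inside the box of radius `M`. -/
lemma exists_local_segment {γ : List (ZVec d)} (hch : γ.IsChain (Adj d)) {z v : ZVec d}
    (hz : z ∈ γ) (hv : v ∈ γ) {M : ℕ} (hM : M ≤ normInf d (v - z)) :
    ∃ l₁ γ' l₂, γ = l₁ ++ γ' ++ l₂ ∧ z ∈ γ' ∧ (∀ u ∈ γ', u ∈ boxZ d M z) ∧
      ∃ u ∈ γ', normInf d (u - z) = M := by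
  obtain ⟨P, Q, rfl⟩ := List.append_of_mem hz
  have h0 : ((normInf d (z - z) : ℕ) : ℤ) ≤ M := by
    rw [sub_self, normInf_zero]
    positivity
  have hv' : v ∈ P ++ [z] ∨ v ∈ z :: Q := by
    rcases List.mem_append.1 hv with h | h
    · exact Or.inl (List.mem_append_left _ h)
    · exact Or.inr h
  rcases hv' with h | h
  · have hch' : (P ++ [z]).IsChain (Adj d) := by
      rw [← List.singleton_append, ← List.append_assoc] at hch
      exact (List.isChain_append.1 hch).1
    obtain ⟨l₁, l₂, b, h1, h2, h3, h4⟩ := List.exists_suffix_hit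
      (fun u => (normInf d (u - z) : ℤ)) (fun _ _ h => normInf_step z h) M (P ++ [z]) hch' z
      List.getLast?_concat h0 ⟨v, h, by exact_mod_cast hM⟩
    refine ⟨l₁, b :: l₂, Q, ?_, List.mem_of_getLast? h4, ?_, b, by simp, by exact_mod_cast h2⟩
    · rw [← h1]
      simp
    · intro u hu
      rw [mem_boxZ]
      rcases List.mem_cons.1 hu with rfl | hu
      · exact_mod_cast h2.le
      · exact_mod_cast (h3 u hu).le
  · obtain ⟨l₁, l₂, b, h1, h2, h3, h4⟩ := List.exists_prefix_hit
      (fun u => (normInf d (u - z) : ℤ)) (fun _ _ h => normInf_step z h) M (z :: Q)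
      (List.isChain_append.1 hch).2.1 z rfl h0 ⟨v, h, by exact_mod_cast hM⟩
    refine ⟨P, l₁ ++ [b], l₂, ?_, List.mem_of_head? h4, ?_, b, by simp, by exact_mod_cast h2⟩
    · rw [h1]
      simp
    · intro u hu
      rw [mem_boxZ]
      rcases List.mem_append.1 hu with hu | hu
      · exact_mod_cast (h3 u hu).le
      · rw [List.mem_singleton] at hu
        subst hu
        exact_mod_cast h2.le

/-- The crossing cluster cannot be avoided by a modified geodesic outside the exceptional event. -/
lemma exists_mem_infCluster {z : ZVec d} {T M : ℕ}
    (huniq : ∀ x y, InInfCluster d ω x → InInfCluster d ω y → Conn ω x y)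
    (hd : 1 ≤ d) (hcross : CrossesBox d ω {x | InInfCluster d ω x} (2 * M) z)
    (havoid : shiftCfg z ω ∉ ENevent d n T M) {γ : List (ZVec d)}
    (hγ : GstarIn d n ω (boxZ d (T * M) z) γ) (hbox : ∀ u ∈ γ, u ∈ boxZ d M z)
    (hz : z ∈ γ) (hdiam : ∃ u ∈ γ, normInf d (u - z) = M) : ∃ u ∈ γ, InInfCluster d ω u := by
  by_contra hno
  push Not at hno
  obtain ⟨η, -, -, hη, ⟨v₀, hv₀, -⟩, -⟩ := hcross ⟨0, hd⟩
  have hv₀I : InInfCluster d ω v₀ := (hη v₀ hv₀).1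
  have hcl : ∀ x, x ∈ openClusterOf d (shiftCfg z ω) (v₀ - z) ↔ InInfCluster d ω (x + z) := by
    intro x
    rw [openClusterOf, Set.mem_ofPred_eq, chemDist_ne_top_iff, conn_shiftCfg, sub_add_cancel]
    exact ⟨fun h => hv₀I.of_conn h, fun h => huniq _ _ hv₀I h⟩
  have hback : ∀ l : List (ZVec d), (l.map (· - z)).map (· + z) = l := by
    intro l
    simp [List.map_map, Function.comp_def]
  apply havoid
  refine ⟨v₀ - z, ?_, γ.map (· - z), ?_, ?_, ?_, ?_, ?_⟩
  · intro i
    obtain ⟨ζ, h1, h2, h3, ⟨u, hu, hui⟩, ⟨v, hv, hvi⟩⟩ := hcross i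
    refine ⟨ζ.map (· - z), ?_, ?_, ?_, ⟨u - z, List.mem_map_of_mem hu, ?_⟩,
      ⟨v - z, List.mem_map_of_mem hv, ?_⟩⟩
    · rwa [← isPath_map_add z, hback]
    · rwa [isOpenPath_shiftCfg, hback]
    · intro w hw
      obtain ⟨w, hmem, rfl⟩ := List.mem_map.1 hw
      rw [hcl, mem_boxZ, sub_add_cancel, sub_zero]
      exact h3 w hmem
    · rw [Pi.sub_apply, hui, Pi.zero_apply]
      ring
    · rw [Pi.sub_apply, hvi, Pi.zero_apply]
      ring
  · rw [← isPath_map_add z, hback]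
    exact hγ.1
  · intro w hw
    obtain ⟨w, hmem, rfl⟩ := List.mem_map.1 hw
    rw [mem_boxZ, sub_zero]
    exact hbox w hmem
  · refine gstarIn_shiftCfg (A' := boxZ d (T * M) z) (fun v => ?_) (by rwa [hback])
    rw [mem_boxZ, boxR, Set.mem_ofPred_eq, sub_zero, add_sub_cancel_right]
    exact_mod_cast Iff.rfl
  · obtain ⟨u, hu, huM⟩ := hdiam
    rcases Nat.eq_zero_or_pos M with rfl | hM
    · exact ⟨⟨0, hd⟩, z - z, List.mem_map_of_mem hz, z - z, List.mem_map_of_mem hz, by simp⟩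
    obtain ⟨i, hi⟩ := exists_natAbs_eq_normInf (u - z) (by omega)
    refine ⟨i, u - z, List.mem_map_of_mem hu, z - z, List.mem_map_of_mem hz, ?_⟩
    have h1 : (((u - z) i).natAbs : ℝ) = M := by
      rw [hi, huM]
    rw [Nat.cast_natAbs, Int.cast_abs] at h1
    simp only [sub_self, Pi.zero_apply, Int.cast_zero, sub_zero]
    rw [h1]
    have : (0 : ℝ) ≤ M := by positivity
    linarith
  · intro w hw
    obtain ⟨w, hmem, rfl⟩ := List.mem_map.1 hw
    rw [hcl, sub_add_cancel]
    exact hno w hmem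

/-- Chaining open connections along a sequence of points. -/
lemma openConn_of_sequence {U : Set (ZVec d)} {L : ℕ} (a : ℕ → ZVec d) (k : ℕ) (h0 : a 0 ∈ U)
    (h : ∀ i < k, OpenConn ω U (a i) (a (i + 1)) L) : OpenConn ω U (a 0) (a k) (k * L) := by
  induction k with
  | zero => exact OpenConn.refl h0 _
  | succ k ih =>
    rw [add_mul, one_mul]
    exact (ih fun i hi => h i (by omega)).trans (h k (by omega))

/-- If the infinite cluster has no large holes and short chemical distances, it crosses boxes. -/
lemma crossesBox_infCluster {z : ZVec d} {r m M K : ℕ} (hM : r * (3 * m + 1) + 2 * m ≤ 2 * M)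
    (hK : 2 * M + m ≤ K)
    (huniq : ∀ x y, InInfCluster d ω x → InInfCluster d ω y → Conn ω x y)
    (hhole : ∀ u ∈ boxZ d K z, ¬ Hole m u ω)
    (hdev : ∀ u ∈ boxZ d (K + m) z, ∀ v ∈ boxZ d (K + m) z, Conn ω u v →
      OpenConn ω Set.univ u v (r * (normInf d (u - v) + m))) :
    CrossesBox d ω {x | InInfCluster d ω x} (2 * M) z := by
  intro i
  let p : ℕ → ZVec d := fun k j =>
    if j = i then z j - (2 * M + m : ℕ) + min k (4 * M + 2 * m) else z j
  have hpi : ∀ k, p k i = z i - (2 * M + m : ℕ) + min k (4 * M + 2 * m) := fun k => by simp [p]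
  have hpj : ∀ k, ∀ j ≠ i, p k j = z j := fun k j hj => by simp [p, hj]
  have hpK : ∀ k, normInf d (p k - z) ≤ 2 * M + m := by
    intro k
    rw [normInf_le_iff]
    intro j
    rw [Pi.sub_apply]
    rcases eq_or_ne j i with rfl | hj
    · rw [hpi]; omega
    · rw [hpj k j hj]; omega
  have hstep : ∀ k, normInf d (p k - p (k + 1)) ≤ 1 := by
    intro k
    rw [normInf_le_iff]
    intro j
    rw [Pi.sub_apply]
    rcases eq_or_ne j i with rfl | hj
    · rw [hpi, hpi]; omega
    · rw [hpj k j hj, hpj (k + 1) j hj]; omega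
  have hex : ∀ k, ∃ a, normInf d (a - p k) ≤ m ∧ InInfCluster d ω a := by
    intro k
    have := hhole (p k) ((hpK k).trans hK)
    rw [Hole] at this
    push Not at this
    exact this
  choose a ha haI using hex
  have haK : ∀ k, a k ∈ boxZ d (K + m) z := by
    intro k
    rw [mem_boxZ]
    have := normInf_sub_le (a k) (p k) z
    have := ha k
    have := hpK k
    omega
  let U : Set (ZVec d) := {y | ∀ j ≠ i, (y j - z j).natAbs ≤ 2 * M}
  have hconn : ∀ k, OpenConn ω U (a k) (a (k + 1)) (r * (3 * m + 1)) := by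
    intro k
    have h1 : normInf d (a k - a (k + 1)) ≤ 2 * m + 1 := by
      have h2 := normInf_sub_le (a k) (p k) (a (k + 1))
      have h3 := normInf_sub_le (p k) (p (k + 1)) (a (k + 1))
      have h4 := ha (k + 1)
      rw [normInf_sub_comm] at h4
      have := ha k
      have := hstep k
      omega
    refine ((hdev _ (haK k) _ (haK (k + 1)) (huniq _ _ (haI k) (haI (k + 1)))).mono
      le_rfl (Nat.mul_le_mul_left r (show _ ≤ 3 * m + 1 by omega))).of_box ?_
    intro y hy j hj
    have h5 := (natAbs_le_normInf (y - a k) j).trans hy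
    have h6 := (natAbs_le_normInf (a k - p k) j).trans (ha k)
    rw [Pi.sub_apply] at h5 h6
    rw [hpj k j hj] at h6
    omega
  have h0 : a 0 ∈ U := (hconn 0).1
  have hall := openConn_of_sequence a (4 * M + 2 * m) h0 fun k _ => hconn k
  obtain ⟨γ, hγ, hγo, hγU, hhead, hlast, -⟩ := hall.exists_path
  have hstepi : ∀ x y : ZVec d, EdgeOpen d ω x y → |x i - y i| ≤ 1 := by
    intro x y h
    have := (natAbs_le_normInf (x - y) i).trans h.adj.normInf_le
    rw [Pi.sub_apply] at this
    rw [abs_le]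
    omega
  obtain ⟨γ', u, v, ⟨l₁, l₂, hl⟩, hu, hv, hui, hvi, hbd⟩ :=
    List.exists_segment_between (fun x => x i) hstepi
    (z i - (2 * M : ℕ)) (z i + (2 * M : ℕ)) (by omega) γ hγo _ _ hhead hlast
    (by
      have h6 := (natAbs_le_normInf (a 0 - p 0) i).trans (ha 0)
      rw [Pi.sub_apply, hpi] at h6
      omega)
    (by
      have h6 := (natAbs_le_normInf _ i).trans (ha (4 * M + 2 * m))
      rw [Pi.sub_apply, hpi] at h6
      omega)
  have hne : γ' ≠ [] := List.ne_nil_of_mem hu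
  subst hl
  refine ⟨γ', hγ.segment hne, (List.isChain_append.1 (List.isChain_append.1 hγo).1).2.1, ?_,
    ⟨u, hu, hui⟩, ⟨v, hv, hvi⟩⟩
  intro w hw
  have hwγ : w ∈ l₁ ++ γ' ++ l₂ := by simp [hw]
  refine ⟨?_, ?_⟩
  · obtain ⟨s, t, hst⟩ := List.append_of_mem hwγ
    rw [hst] at hγo hhead
    have h7 : (s ++ [w]).IsChain (EdgeOpen d ω) := by
      have hg : (s ++ w :: t).IsChain (EdgeOpen d ω) := hγo
      rw [← List.singleton_append, ← List.append_assoc] at hg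
      exact (List.isChain_append.1 hg).1
    have h8 : OpenConn ω Set.univ (a 0) w _ := OpenConn.of_chain (by simp) h7
      (fun _ _ => Set.mem_univ _) (by cases s <;> simpa using hhead) List.getLast?_concat
    exact (haI 0).of_conn h8.conn
  · rw [mem_boxZ, normInf_le_iff]
    intro j
    rw [Pi.sub_apply]
    rcases eq_or_ne j i with rfl | hj
    · have := hbd w hw
      omega
    · exact hγU w hwγ j hj

end Local

section Hits

lemma List.exists_first {V : Type*} (S : V → Prop) (l : List V) (h : ∃ a ∈ l, S a) :
    ∃ l₁ a l₂, l = l₁ ++ a :: l₂ ∧ S a ∧ ∀ x ∈ l₁, ¬ S x := by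
  induction l with
  | nil => simp at h
  | cons c l ih =>
    by_cases hc : S c
    · exact ⟨[], c, l, rfl, hc, by simp⟩
    · obtain ⟨a, ha, haS⟩ := h
      rcases List.mem_cons.1 ha with rfl | ha
      · exact absurd haS hc
      obtain ⟨l₁, b, l₂, h1, h2, h3⟩ := ih ⟨a, ha, haS⟩
      refine ⟨c :: l₁, b, l₂, by rw [h1, List.cons_append], h2, ?_⟩
      intro x hx
      rcases List.mem_cons.1 hx with rfl | hx
      · exact hc
      · exact h3 x hx

/-- The segment of a list between the first and the last element satisfying `S`. -/
lemma List.exists_trim {V : Type*} (S : V → Prop) (l : List V) (h : ∃ a ∈ l, S a) :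
    ∃ l₁ l' l₂, l = l₁ ++ l' ++ l₂ ∧ (∀ x ∈ l₁, ¬ S x) ∧ (∀ x ∈ l₂, ¬ S x) ∧ l' ≠ [] ∧
      ∀ w ∈ l', S w ∨ ∃ P Q, l = P ++ w :: Q ∧ (∃ a ∈ P, S a) ∧ ∃ b ∈ Q, S b := by
  obtain ⟨l₁, a, l₂, rfl, ha, hl₁⟩ := List.exists_first S l h
  obtain ⟨m₁, b, m₂, hm, hb, hm₁⟩ := List.exists_first S (a :: l₂).reverse ⟨a, by simp, ha⟩
  have hm' : a :: l₂ = m₂.reverse ++ b :: m₁.reverse := by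
    rw [← List.reverse_reverse (a :: l₂), hm]
    simp
  refine ⟨l₁, m₂.reverse ++ [b], m₁.reverse, ?_, hl₁, ?_, by simp, ?_⟩
  · rw [hm']
    simp
  · intro x hx
    exact hm₁ x (List.mem_reverse.1 hx)
  · intro w hw
    rcases List.mem_append.1 hw with hw | hw
    · obtain ⟨u, u', hu⟩ := List.append_of_mem hw
      cases u with
      | nil =>
        rw [hu, List.nil_append, List.cons_append, List.cons.injEq] at hm'
        exact Or.inl (hm'.1 ▸ ha)
      | cons c u =>
        rw [hu, List.cons_append, List.cons_append, List.cons.injEq] at hm'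
        refine Or.inr ⟨l₁ ++ c :: u, u' ++ b :: m₁.reverse, ?_, ⟨a, ?_, ha⟩, b, by simp, hb⟩
        · rw [hm'.1, hm'.2]
          simp
        · rw [hm'.1]
          simp
    · rw [List.mem_singleton] at hw
      exact Or.inl (hw ▸ hb)

lemma List.exists_hit {V : Type*} {R : V → V → Prop} (f : V → ℤ)
    (hf : ∀ x y, R x y → |f x - f y| ≤ 1) (t : ℤ) (l : List V) (hl : l.IsChain R) {v v' : V}
    (hv : v ∈ l) (hv' : v' ∈ l) (h : f v ≤ t) (h' : t ≤ f v') : ∃ u ∈ l, f u = t := by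
  obtain ⟨P, Q, rfl⟩ := List.append_of_mem hv
  rcases List.mem_append.1 hv' with hm | hm
  · have hl' : (P ++ [v]).IsChain R := by
      rw [← List.singleton_append, ← List.append_assoc] at hl
      exact (List.isChain_append.1 hl).1
    obtain ⟨l₁, l₂, b, h1, h2, -⟩ := List.exists_suffix_hit f hf t (P ++ [v]) hl' v
      List.getLast?_concat h ⟨v', List.mem_append_left _ hm, h'⟩
    have hb : b ∈ P ++ [v] := by rw [h1]; simp
    refine ⟨b, ?_, h2⟩
    rcases List.mem_append.1 hb with hb | hb
    · exact List.mem_append_left _ hb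
    · rw [List.mem_singleton] at hb
      simp [hb]
  · obtain ⟨l₁, l₂, b, h1, h2, -⟩ := List.exists_prefix_hit f hf t (v :: Q)
      (List.isChain_append.1 hl).2.1 v rfl h ⟨v', hm, h'⟩
    exact ⟨b, List.mem_append_right _ (by rw [h1]; simp), h2⟩

variable {d : ℕ}

/-- The configuration is well behaved around `o` at scale `N`: the infinite cluster is unique and
has no holes of radius `m`, chemical distances are at most `r` times the lattice distance, and no
modified geodesic of diameter of order `M` avoids the infinite cluster. -/
structure GoodAt (n r m M T N : ℕ) (o : ZVec d) (ω : Config d) : Prop where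
  uniq : ∀ x y, InInfCluster d ω x → InInfCluster d ω y → Conn ω x y
  hole : ∀ u ∈ boxZ d (5 * N) o, ¬ Hole m u ω
  dev : ∀ u ∈ boxZ d (10 * N) o, ∀ v ∈ boxZ d (10 * N) o, Conn ω u v →
    OpenConn ω Set.univ u v (r * (normInf d (u - v) + m))
  avoid : ∀ z ∈ boxZ d (4 * N) o, shiftCfg z ω ∉ ENevent d n T M

/-- Compatibility of the scales in `GoodAt`. -/
structure ScaleOK (r m M T N : ℕ) : Prop where
  one_le_r : 1 ≤ r
  one_le_m : 1 ≤ m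
  eq_M : 8 * (r * m) = M
  le_T : 4 * r + 4 ≤ T
  le_N : T * M ≤ N

lemma ScaleOK.bounds {r m M T N : ℕ} (h : ScaleOK r m M T N) :
    8 * m ≤ M ∧ M ≤ r * M ∧ 4 * (r * M) + 4 * M ≤ T * M ∧ 1 ≤ M := by
  obtain ⟨h1, h2, h3, h4, -⟩ := h
  have h5 : m ≤ r * m := Nat.le_mul_of_pos_left m h1
  have h6 : (4 * r + 4) * M ≤ T * M := Nat.mul_le_mul_right M h4
  have h7 : (4 * r + 4) * M = 4 * (r * M) + 4 * M := by ring
  exact ⟨by omega, Nat.le_mul_of_pos_left M h1, by omega, by omega⟩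

variable {n r m M T N : ℕ} {o : ZVec d} {ω : Config d}

lemma GoodAt.exists_mem (hd : 1 ≤ d) (h : GoodAt n r m M T N o ω) (hs : ScaleOK r m M T N)
    {z : ZVec d} (hz : z ∈ boxZ d (4 * N) o) {γ : List (ZVec d)}
    (hγ : GstarIn d n ω (boxZ d (T * M) z) γ) (hbox : ∀ u ∈ γ, u ∈ boxZ d M z)
    (hzγ : z ∈ γ) (hdiam : ∃ u ∈ γ, normInf d (u - z) = M) : ∃ u ∈ γ, InInfCluster d ω u := by
  obtain ⟨h1, h2, h3, h4⟩ := hs.bounds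
  have h5 := hs.le_N
  have h6 := hs.eq_M
  rw [mem_boxZ] at hz
  refine exists_mem_infCluster h.uniq hd (crossesBox_infCluster (r := r) (m := m)
    (K := 2 * M + m) ?_ le_rfl h.uniq ?_ ?_) (h.avoid z hz) hγ hbox hzγ hdiam
  · rw [mul_add, mul_left_comm]
    have := Nat.le_mul_of_pos_right r hs.one_le_m
    omega
  · exact fun u hu => h.hole u (boxZ_subset_boxZ (by omega) hu)
  · exact fun u hu v hv => h.dev u (boxZ_subset_boxZ (by omega) hu) v
      (boxZ_subset_boxZ (by omega) hv)

/-- A geodesic segment of diameter at least `M` meets the infinite cluster. -/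
lemma GoodAt.exists_mem_geodesic (hd : 1 ≤ d) (h : GoodAt n r m M T N o ω)
    (hs : ScaleOK r m M T N) {A : Set (ZVec d)} {l₁ σ l₂ : List (ZVec d)}
    (hπ : IsGeodesicIn d n ω A (l₁ ++ σ ++ l₂)) {z v : ZVec d} (hz : z ∈ boxZ d (4 * N) o)
    (hA : boxZ d (T * M) z ⊆ A) (hzσ : z ∈ σ) (hv : v ∈ σ) (hM : M ≤ normInf d (v - z)) :
    ∃ u ∈ σ, InInfCluster d ω u ∧ u ∈ boxZ d M z := by
  obtain ⟨h1, h2, h3, h4⟩ := hs.bounds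
  have hσ := hπ.segment (List.ne_nil_of_mem hzσ)
  obtain ⟨k₁, γ, k₂, rfl, hzγ, hbox, hdiam⟩ := exists_local_segment hσ.1.2.2 hzσ hv hM
  have hbox' : ∀ u ∈ γ, u ∈ boxZ d (T * M) z := fun u hu =>
    (hbox u hu).trans (show M ≤ T * M by omega)
  have hγ := (hσ.segment (List.ne_nil_of_mem hzγ)).mono hbox' hA
  obtain ⟨u, hu, huI⟩ := h.exists_mem hd hs hz
    ⟨hγ.1, hγ.2.1, γ, hγ, fun x y h1 h2 => absurd h1 h2⟩ hbox hzγ hdiam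
  exact ⟨u, by simp [hu], huI, hbox u hu⟩

/-- A modified geodesic of diameter at least `M` meets the infinite cluster. -/
lemma GoodAt.exists_mem_gstar (hd : 1 ≤ d) (hn : 1 ≤ Real.log n ^ 2)
    (h : GoodAt n r m M T N o ω) (hs : ScaleOK r m M T N) {A : Set (ZVec d)} {γ : List (ZVec d)}
    (hγ : GstarIn d n ω A γ) (hA : boxZ d (10 * N) o ⊆ A) {z v : ZVec d}
    (hz : z ∈ boxZ d (3 * N) o) (hzγ : z ∈ γ) (hv : v ∈ γ) (hM : M ≤ normInf d (v - z)) :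
    ∃ u ∈ γ, InInfCluster d ω u ∧ u ∈ boxZ d M z := by
  obtain ⟨h1, h2, h3, h4⟩ := hs.bounds
  have h5 := hs.le_N
  have h6 := hs.eq_M
  rw [mem_boxZ] at hz
  obtain ⟨hγp, hγA, π, hπ, hopen⟩ := hγ
  obtain ⟨k₁, γ', k₂, rfl, hzγ', hbox, hdiam⟩ := exists_local_segment hγp.2.2 hzγ hv hM
  have hne : γ' ≠ [] := List.ne_nil_of_mem hzγ'
  have hbox' : ∀ u ∈ γ', u ∈ boxZ d (T * M) z := fun u hu =>
    (hbox u hu).trans (show M ≤ T * M by omega)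
  have hsub : boxZ d (T * M) z ⊆ A := (boxZ_subset_boxZ (by omega)).trans hA
  suffices hg : GstarIn d n ω (boxZ d (T * M) z) γ' by
    obtain ⟨u, hu, huI⟩ := h.exists_mem hd hs (hz.trans (by omega)) hg hbox hzγ' hdiam
    exact ⟨u, by simp [hu], huI, hbox u hu⟩
  refine ⟨hγp.segment hne, hbox', ?_⟩
  by_cases hvis : ∃ a ∈ π, a ∈ boxZ d M z
  · obtain ⟨l₁, σ, l₂, hl, hl₁, hl₂, hσne, hσ⟩ := List.exists_trim (· ∈ boxZ d M z) π hvis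
    refine ⟨σ, ?_, ?_⟩
    · refine IsGeodesicIn.mono (IsGeodesicIn.segment (hl ▸ hπ) hσne) (fun w hw => ?_) hsub
      rcases hσ w hw with hwS | ⟨P, Q, hPQ, ⟨a, haP, ha⟩, ⟨b, hbQ, hb⟩⟩
      · exact hwS.trans (show M ≤ T * M by omega)
      by_contra hwT
      rw [mem_boxZ, not_le] at hwT
      rw [mem_boxZ] at ha hb
      rw [hPQ] at hπ
      have haw := normInf_sub_le w a z
      have hbw := normInf_sub_le w b z
      have hao := normInf_sub_le a z o
      have hbo := normInf_sub_le b z o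
      obtain ⟨a', ha'P, ha'I, ha'⟩ : ∃ a' ∈ P, InInfCluster d ω a' ∧ a' ∈ boxZ d M a := by
        obtain ⟨P₁, P₂, rfl⟩ := List.append_of_mem haP
        have hπ' : IsGeodesicIn d n ω A (P₁ ++ (a :: P₂ ++ [w]) ++ Q) := by simpa using hπ
        obtain ⟨u, hu, huI, huM⟩ := h.exists_mem_geodesic hd hs hπ' (z := a) (v := w)
          (mem_boxZ.2 (by omega)) ((boxZ_subset_boxZ (by omega)).trans hA) (by simp) (by simp)
          (by omega)
        rcases List.mem_append.1 hu with hu | hu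
        · exact ⟨u, List.mem_append_right _ hu, huI, huM⟩
        · rw [List.mem_singleton] at hu
          rw [hu, mem_boxZ] at huM
          omega
      obtain ⟨b', hb'Q, hb'I, hb'⟩ : ∃ b' ∈ Q, InInfCluster d ω b' ∧ b' ∈ boxZ d M b := by
        obtain ⟨Q₁, Q₂, rfl⟩ := List.append_of_mem hbQ
        have hπ' : IsGeodesicIn d n ω A (P ++ (w :: (Q₁ ++ [b])) ++ Q₂) := by simpa using hπ
        obtain ⟨u, hu, huI, huM⟩ := h.exists_mem_geodesic hd hs hπ' (z := b) (v := w)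
          (mem_boxZ.2 (by omega)) ((boxZ_subset_boxZ (by omega)).trans hA) (by simp) (by simp)
          (by omega)
        rcases List.mem_cons.1 hu with hu | hu
        · rw [hu, mem_boxZ] at huM
          omega
        · refine ⟨u, ?_, huI, huM⟩
          rcases List.mem_append.1 hu with hu | hu
          · exact List.mem_append_left _ hu
          · rw [List.mem_singleton] at hu
            simp [hu]
      rw [mem_boxZ] at ha' hb'
      have e1 := normInf_sub_le a' a b'
      have e2 := normInf_sub_le a z b'
      have e3 := normInf_sub_le z b b'
      have e4 := normInf_sub_comm z b
      have e5 := normInf_sub_comm b b'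
      have e6 := normInf_sub_le a' a o
      have e7 := normInf_sub_le b' b o
      have e8 := normInf_sub_le w a' z
      have e9 := normInf_sub_le a' a z
      have e10 := normInf_sub_comm w a'
      have e11 := normInf_sub_le w b' z
      have e12 := normInf_sub_le b' b z
      have hconn : OpenConn ω A a' b' (r * (4 * M + m)) := by
        refine ((h.dev a' (mem_boxZ.2 (by omega)) b' (mem_boxZ.2 (by omega))
          (h.uniq _ _ ha'I hb'I)).mono le_rfl
          (Nat.mul_le_mul_left r (show _ ≤ 4 * M + m by omega))).of_box
          ((boxZ_subset_boxZ ?_).trans hA)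
        rw [mul_add, mul_left_comm]
        omega
      have hdet := hπ.normInf_add_le hn ha'P hb'Q hconn
      rw [mul_add, mul_left_comm] at hdet
      omega
    · intro x y hxy hxy'
      refine hopen x y (hxy.append k₁ k₂) fun hc => hxy' ?_
      rw [hl] at hc
      have hx := hbox x hxy.mem.1
      have hy := hbox y hxy.mem.2
      exact hc.of_append ⟨fun hm => hl₁ x hm hx, fun hm => hl₂ x hm hx⟩
        ⟨fun hm => hl₁ y hm hy, fun hm => hl₂ y hm hy⟩
  · refine ⟨[z], ⟨⟨by simp, by simp, List.isChain_singleton z⟩, ?_, ?_⟩, ?_⟩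
    · intro u hu
      rw [List.mem_singleton] at hu
      rw [hu, mem_boxZ, sub_self, normInf_zero]
      exact bot_le
    · exact fun γ₂ _ _ _ _ => pathCost_nonneg γ₂
    · intro x y hxy _
      exact hopen x y (hxy.append k₁ k₂) fun hc => hvis ⟨x, hc.mem.1, hbox x hxy.mem.1⟩

end Hits

section Annulus

variable {d : ℕ} {n r m M T N : ℕ} {o : ZVec d} {ω : Config d}

/-- Points of the infinite cluster close to `s` and `s'` are joined by open paths of length at
most `L` inside the annulus of radii `N` and `3 * N` around `o`. -/
def Link (M N : ℕ) (o : ZVec d) (ω : Config d) (s s' : ZVec d) (L : ℕ) : Prop :=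
  ∀ a a', InInfCluster d ω a → InInfCluster d ω a' → a ∈ boxZ d M s → a' ∈ boxZ d M s' →
    OpenConn ω {y | normInf d (y - o) ≤ 3 * N ∧ N < normInf d (y - o)} a a' L

lemma Link.mono {s s' : ZVec d} {L L' : ℕ} (h : Link M N o ω s s' L) (hL : L ≤ L') :
    Link M N o ω s s' L' :=
  fun a a' ha ha' hs hs' => (h a a' ha ha' hs hs').mono le_rfl hL

lemma GoodAt.link_trans (h : GoodAt n r m M T N o ω) (hs : ScaleOK r m M T N) {s s' s'' : ZVec d}
    {L L' : ℕ} (h1 : Link M N o ω s s' L) (h2 : Link M N o ω s' s'' L')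
    (hs' : normInf d (s' - o) = 2 * N) : Link M N o ω s s'' (L + L') := by
  obtain ⟨e1, e2, e3, e4⟩ := hs.bounds
  intro a a' ha ha' has has'
  have := h.hole s' (mem_boxZ.2 (by omega))
  rw [Hole] at this
  push Not at this
  obtain ⟨b, hb, hbI⟩ := this
  have hb' : b ∈ boxZ d M s' := mem_boxZ.2 ((mem_boxZ.1 hb).trans (by omega))
  exact (h1 a b ha hbI has hb').trans (h2 b a' hbI ha' hb' has')

lemma GoodAt.link_single (h : GoodAt n r m M T N o ω) (hs : ScaleOK r m M T N) {s s' : ZVec d}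
    (hso : normInf d (s - o) = 2 * N) (hss : normInf d (s - s') ≤ M) :
    Link M N o ω s s' (r * (3 * M + m)) := by
  obtain ⟨e1, e2, e3, e4⟩ := hs.bounds
  have e5 := hs.le_N
  have e6 := hs.eq_M
  intro a a' ha ha' has has'
  rw [mem_boxZ] at has has'
  have f1 := normInf_sub_le a s a'
  have f2 := normInf_sub_le s s' a'
  have f3 := normInf_sub_comm s' a'
  have f4 := normInf_sub_le a s o
  have f5 := normInf_sub_le a' a o
  have f6 := normInf_sub_comm a' a
  have f7 := normInf_sub_le s a o
  have f8 := normInf_sub_comm s a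
  refine ((h.dev a (mem_boxZ.2 (by omega)) a' (mem_boxZ.2 (by omega)) (h.uniq _ _ ha ha')).mono
    le_rfl (Nat.mul_le_mul_left r (show _ ≤ 3 * M + m by omega))).of_box ?_
  intro y hy
  rw [mem_boxZ, mul_add, mul_left_comm] at hy
  have f9 := normInf_sub_le y a o
  have f10 := normInf_sub_le a y o
  have f11 := normInf_sub_comm a y
  exact ⟨by omega, by omega⟩

lemma GoodAt.link_face (h : GoodAt n r m M T N o ω) (hs : ScaleOK r m M T N) {s s' : ZVec d}
    (hso : normInf d (s - o) = 2 * N) (hso' : normInf d (s' - o) = 2 * N) (i : Fin d)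
    (hi : s i = s' i) (hio : (s i - o i).natAbs = 2 * N) :
    Link M N o ω s s' ((4 * N / M + 1) * (r * (3 * M + m))) := by
  obtain ⟨e1, e2, e3, e4⟩ := hs.bounds
  let p : ℕ → ZVec d := fun k j =>
    s j + max (-((k * M : ℕ) : ℤ)) (min ((k * M : ℕ) : ℤ) (s' j - s j))
  have hp : ∀ k j, p k j = s j + max (-((k * M : ℕ) : ℤ)) (min ((k * M : ℕ) : ℤ) (s' j - s j)) :=
    fun k j => rfl
  have hsj : ∀ j, (s j - o j).natAbs ≤ 2 * N := fun j => hso ▸ natAbs_le_normInf (s - o) j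
  have hsj' : ∀ j, (s' j - o j).natAbs ≤ 2 * N := fun j => hso' ▸ natAbs_le_normInf (s' - o) j
  have hpo : ∀ k, normInf d (p k - o) = 2 * N := by
    intro k
    apply le_antisymm
    · rw [normInf_le_iff]
      intro j
      have := hsj j
      have := hsj' j
      rw [Pi.sub_apply, hp]
      generalize k * M = q
      omega
    · have h1 := natAbs_le_normInf (p k - o) i
      rw [Pi.sub_apply, hp, hi] at h1
      rw [hi] at hio
      have h2 : s' i + max (-((k * M : ℕ) : ℤ)) (min ((k * M : ℕ) : ℤ) (s' i - s' i)) = s' i := by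
        generalize k * M = q
        omega
      rw [h2] at h1
      omega
  have hstep : ∀ k, normInf d (p k - p (k + 1)) ≤ M := by
    intro k
    rw [normInf_le_iff]
    intro j
    rw [Pi.sub_apply, hp, hp, add_mul, one_mul]
    generalize k * M = q
    omega
  have hp0 : p 0 = s := by
    ext j
    rw [hp, zero_mul]
    omega
  have hend : p (4 * N / M + 1) = s' := by
    ext j
    have h1 := Nat.lt_mul_div_succ (4 * N) (show 0 < M by omega)
    rw [mul_comm M] at h1
    have := hsj j
    have := hsj' j
    rw [hp]
    generalize (4 * N / M + 1) * M = q at h1 ⊢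
    omega
  have hall : ∀ k, Link M N o ω s (p (k + 1)) ((k + 1) * (r * (3 * M + m))) := by
    intro k
    induction k with
    | zero =>
      have h1 := hstep 0
      rw [hp0] at h1
      rw [zero_add, one_mul]
      exact h.link_single hs hso h1
    | succ k ih =>
      rw [add_mul (k + 1) 1, one_mul]
      exact h.link_trans hs ih (h.link_single hs (hpo _) (hstep _)) (hpo _)
  rw [← hend]
  exact hall _

lemma normInf_update_sub {s : ZVec d} {R : ℕ} {j : Fin d} {v : ℤ}
    (hso : normInf d (s - o) ≤ R) (hv : (v - o j).natAbs = R) :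
    normInf d (Function.update s j v - o) = R := by
  apply le_antisymm
  · rw [normInf_le_iff] at hso ⊢
    intro k
    rcases eq_or_ne k j with rfl | hk
    · rw [Pi.sub_apply, Function.update_self, hv]
    · rw [Pi.sub_apply, Function.update_of_ne hk]
      exact hso k
  · have := natAbs_le_normInf (Function.update s j v - o) j
    rwa [Pi.sub_apply, Function.update_self, hv] at this

lemma GoodAt.link_corner (h : GoodAt n r m M T N o ω) (hs : ScaleOK r m M T N) {s s' : ZVec d}
    (hso : normInf d (s - o) = 2 * N) (hso' : normInf d (s' - o) = 2 * N) {i i' : Fin d}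
    (hii : i ≠ i') (hio : (s i - o i).natAbs = 2 * N) (hio' : (s' i' - o i').natAbs = 2 * N) :
    Link M N o ω s s' (2 * ((4 * N / M + 1) * (r * (3 * M + m)))) := by
  have hq := normInf_update_sub hso.le hio'
  rw [two_mul]
  exact h.link_trans hs
    (h.link_face hs hso hq i (Function.update_of_ne hii _ _).symm hio)
    (h.link_face hs hq hso' i' (Function.update_self _ _ _)
      (by rw [Function.update_self]; exact hio')) hq

lemma GoodAt.link_sphere (hd : 2 ≤ d) (h : GoodAt n r m M T N o ω) (hs : ScaleOK r m M T N)
    {s s' : ZVec d} (hso : normInf d (s - o) = 2 * N) (hso' : normInf d (s' - o) = 2 * N) :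
    Link M N o ω s s' (3 * ((4 * N / M + 1) * (r * (3 * M + m)))) := by
  obtain ⟨e1, e2, e3, e4⟩ := hs.bounds
  have e5 := hs.le_N
  obtain ⟨i, hi⟩ := exists_natAbs_eq_normInf (s - o) (by omega)
  obtain ⟨i', hi'⟩ := exists_natAbs_eq_normInf (s' - o) (by omega)
  rw [Pi.sub_apply, hso] at hi
  rw [Pi.sub_apply, hso'] at hi'
  rcases ne_or_eq i i' with hii | rfl
  · exact (h.link_corner hs hso hso' hii hi hi').mono (Nat.mul_le_mul_right _ (by norm_num))
  · have : Nontrivial (Fin d) := Fin.nontrivial_iff_two_le.2 hd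
    obtain ⟨j, hj⟩ := exists_ne i
    have hv : (o j + (2 * N : ℕ) - o j).natAbs = 2 * N := by omega
    have hq := normInf_update_sub hso.le hv
    rw [show 3 = 1 + 2 from rfl, add_mul 1 2, one_mul]
    exact h.link_trans hs
      (h.link_face hs hso hq i (Function.update_of_ne hj.symm _ _).symm hi)
      (h.link_corner hs hq hso' hj (by rw [Function.update_self]; exact hv) hi') hq

/-- Good configurations satisfy `V1`. -/
theorem GoodAt.v1 (hd : 2 ≤ d) (hn : 1 ≤ Real.log n ^ 2) {e : EdgeD d} {Cstar : ℝ}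
    (h : GoodAt n r m M T N e.val.1 ω) (hs : ScaleOK r m M T N) (hC10 : 10 ≤ Cstar)
    (hC : 60 * (r : ℝ) ≤ Cstar) : V1 d Cstar n e N ω := by
  obtain ⟨e1, e2, e3, e4⟩ := hs.bounds
  have e5 := hs.le_N
  have hA : boxZ d (10 * N) e.val.1 ⊆ boxR d (Cstar * N) e.val.1 := by
    intro y hy
    have h1 : (normInf d (y - e.val.1) : ℝ) ≤ 10 * N := by exact_mod_cast hy
    have h2 : (0 : ℝ) ≤ N := by positivity
    exact h1.trans (mul_le_mul_of_nonneg_right hC10 h2)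
  have hhit : ∀ γ, GstarIn d n ω (boxR d (Cstar * N) e.val.1) γ → IsCrossing d N e γ →
      ∃ z a, normInf d (z - e.val.1) = 2 * N ∧ a ∈ γ ∧ InInfCluster d ω a ∧ a ∈ boxZ d M z := by
    rintro γ hγ ⟨hγp, -, ⟨v, hv, hvN⟩, ⟨v', hv', hvN'⟩⟩
    obtain ⟨z, hz, hzN⟩ := List.exists_hit (fun u => (normInf d (u - e.val.1) : ℤ))
      (fun _ _ h => normInf_step _ h) (2 * N : ℕ) γ hγp.2.2 hv hv' (by omega) (by omega)
    have hzN' : normInf d (z - e.val.1) = 2 * N := by exact_mod_cast hzN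
    have h1 := normInf_sub_le v' z e.val.1
    obtain ⟨a, ha, haI, haM⟩ := h.exists_mem_gstar (by omega) hn hs hγ hA
      (mem_boxZ.2 (by omega)) hz hv' (by omega)
    exact ⟨z, a, hzN', ha, haI, haM⟩
  intro γ1 γ2 hγ1 hc1 hγ2 hc2
  obtain ⟨z1, a1, hz1, ha1, haI1, haM1⟩ := hhit γ1 hγ1 hc1
  obtain ⟨z2, a2, hz2, ha2, haI2, haM2⟩ := hhit γ2 hγ2 hc2
  obtain ⟨π, hp, ho, hU, hhead, hlast, hlen⟩ :=
    (h.link_sphere hd hs hz1 hz2 a1 a2 haI1 haI2 haM1 haM2).exists_path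
  refine ⟨π, hp, ho, hU, ⟨a1, hhead, ha1⟩, ⟨a2, hlast, ha2⟩, ?_⟩
  have hL : 3 * ((4 * N / M + 1) * (r * (3 * M + m))) ≤ 60 * r * N := by
    have h1 : (4 * N / M + 1) * M ≤ 5 * N := by
      rw [add_mul, one_mul]
      have := Nat.div_mul_le_self (4 * N) M
      omega
    have h2 : r * (3 * M + m) ≤ r * (4 * M) := Nat.mul_le_mul_left r (by omega)
    calc 3 * ((4 * N / M + 1) * (r * (3 * M + m)))
        ≤ 3 * ((4 * N / M + 1) * (r * (4 * M))) := by gcongr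
      _ = 12 * r * ((4 * N / M + 1) * M) := by ring
      _ ≤ 12 * r * (5 * N) := Nat.mul_le_mul_left _ h1
      _ = 60 * r * N := by ring
  have h3 : π.length ≤ 60 * r * N + 1 := by omega
  have h4 : (π.length : ℝ) ≤ 60 * r * N + 1 := by exact_mod_cast h3
  have h5 : 60 * (r : ℝ) * N ≤ Cstar * N := mul_le_mul_of_nonneg_right hC (by positivity)
  linarith

end Annulus

section Cells

variable {d : ℕ} {n r m M T N : ℕ} {o : ZVec d} {ω : Config d}

/-- If points of an open cluster lying in a common cell are joined by paths of length `ℓ`, then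
all its points are joined by paths of length at most `ℓ + 1` times the number of cells. -/
lemma openConn_of_cells {F : Type*} [Fintype F] (f : ZVec d → F) {U U' : Set (ZVec d)} {ℓ : ℕ}
    (hU : U ⊆ U') (hcell : ∀ u ∈ U, ∀ v ∈ U, Conn ω u v → f u = f v → OpenConn ω U' u v ℓ)
    {x y : ZVec d} {L : ℕ} (h : OpenConn ω U x y L) :
    OpenConn ω U' x y ((ℓ + 1) * Fintype.card F) := by
  let H : SimpleGraph F :=
    { Adj := fun a b => a ≠ b ∧ ∃ u ∈ U, ∃ v ∈ U, Conn ω x u ∧ EdgeOpen d ω u v ∧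
        ((f u = a ∧ f v = b) ∨ (f u = b ∧ f v = a))
      symm := ⟨fun a b ⟨h1, u, hu, v, hv, h2, h3, h4⟩ => ⟨h1.symm, u, hu, v, hv, h2, h3, h4.symm⟩⟩
      loopless := ⟨fun a h => h.1 rfl⟩ }
  have hreach : ∀ a b (w : (openGraph ω U).Walk a b), a ∈ U → Conn ω x a →
      H.Reachable (f a) (f b) := by
    intro a b w
    induction w with
    | nil => exact fun _ _ => SimpleGraph.Reachable.refl _
    | @cons a c b hac w ih =>
      intro ha hxa
      have hxc : Conn ω x c := hxa.trans (OpenConn.single hac.1 hac.2.1 hac.2.2).conn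
      refine SimpleGraph.Reachable.trans ?_ (ih hac.2.1 hxc)
      by_cases hf : f a = f c
      · rw [hf]
      · exact SimpleGraph.Adj.reachable
          (show H.Adj _ _ from ⟨hf, a, ha, c, hac.2.1, hxa, hac.2.2, Or.inl ⟨rfl, rfl⟩⟩)
  have hwalk : ∀ a b (w : H.Walk a b), ∀ u ∈ U, ∀ v ∈ U, Conn ω x u → Conn ω x v → f u = a →
      f v = b → OpenConn ω U' u v (ℓ + (ℓ + 1) * w.length) := by
    intro a b w
    induction w with
    | nil =>
      intro u hu v hv hxu hxv hfu hfv
      exact (hcell u hu v hv (hxu.symm.trans hxv) (hfu.trans hfv.symm)).mono le_rfl (by omega)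
    | @cons a c b hac w ih =>
      intro u hu v hv hxu hxv hfu hfv
      obtain ⟨s, hs, t, ht, hxs, hxt, hst, hfs, hft⟩ : ∃ s ∈ U, ∃ t ∈ U, Conn ω x s ∧ Conn ω x t ∧
          EdgeOpen d ω s t ∧ f s = a ∧ f t = c := by
        obtain ⟨-, s, hs, t, ht, hxs, hst, ⟨h1, h2⟩ | ⟨h1, h2⟩⟩ := hac
        · exact ⟨s, hs, t, ht, hxs, hxs.trans (OpenConn.single hs ht hst).conn, hst, h1, h2⟩
        · exact ⟨t, ht, s, hs, hxs.trans (OpenConn.single hs ht hst).conn, hxs, hst.symm, h2, h1⟩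
      have h1 := hcell u hu s hs (hxu.symm.trans hxs) (hfu.trans hfs.symm)
      have h2 := OpenConn.single (hU hs) (hU ht) hst
      have h3 := ih t ht v hv hxt hxv hft hfv
      refine ((h1.trans h2).trans h3).mono le_rfl ?_
      rw [SimpleGraph.Walk.length_cons]
      ring_nf
      omega
  obtain ⟨hx, w, -⟩ := id h
  obtain ⟨q, hq⟩ := (hreach x y w hx (Conn.refl x)).exists_isPath
  refine (hwalk _ _ q x hx y h.right_mem (Conn.refl x) h.conn rfl rfl).mono le_rfl ?_
  have h1 := Nat.mul_le_mul_left (ℓ + 1) hq.length_lt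
  rw [Nat.succ_eq_add_one, mul_add] at h1
  omega

/-- Good configurations satisfy `V2`. -/
theorem GoodAt.v2 {e : EdgeD d} {Cstar : ℝ}
    (h : GoodAt n r m M T N e.val.1 ω) (hs : ScaleOK r m M T N)
    (hC : (26 * (r : ℝ)) ^ d ≤ Cstar) : V2 d Cstar e N ω := by
  obtain ⟨e1, e2, e3, e4⟩ := hs.bounds
  have e5 := hs.le_N
  have e6 := hs.eq_M
  have e7 := hs.one_le_r
  set o := e.val.1 with ho
  have hrM : r ≤ r * M := Nat.le_mul_of_pos_right r e4
  have hM8 : 8 ≤ M := by have := hs.one_le_m; omega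
  have hrM8 : 8 * r ≤ r * M := by rw [mul_comm 8]; exact Nat.mul_le_mul_left r hM8
  set s := N / (2 * r) with hsdef
  have hs1 : N < 2 * (r * s) + 2 * r := by
    have := Nat.lt_mul_div_succ N (show 0 < 2 * r by omega)
    rw [← hsdef] at this
    have e : 2 * r * (s + 1) = 2 * (r * s) + 2 * r := by ring
    omega
  have hs2 : 2 * (r * s) ≤ N := by
    have := Nat.mul_div_le N (2 * r)
    rw [← hsdef, mul_assoc] at this
    exact this
  have hs0 : 0 < s := by
    rcases Nat.eq_zero_or_pos s with h0 | h0
    · rw [h0] at hs1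
      omega
    · exact h0
  have hQ : 6 * N / s < 26 * r := by
    rw [Nat.div_lt_iff_lt_mul hs0, mul_assoc]
    omega
  rintro x y hx hy ⟨γ, hγ, hγo, hγU, hhead, hlast⟩
  have hxy := OpenConn.of_chain hγ.1 hγo hγU hhead hlast
  let f : ZVec d → (Fin d → Fin (26 * r)) := fun u i =>
    ⟨min ((u i - (o i - 3 * N)).toNat / s) (26 * r - 1), by omega⟩
  have hcell : ∀ u ∈ boxZ d (3 * N) o, ∀ v ∈ boxZ d (3 * N) o, Conn ω u v → f u = f v →
      OpenConn ω (boxZ d (4 * N) o) u v (r * (s + m)) := by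
    intro u hu v hv huv hf
    have hle : normInf d (u - v) ≤ s := by
      rw [normInf_le_iff]
      intro i
      have h1 := (normInf_le_iff.1 hu) i
      have h2 := (normInf_le_iff.1 hv) i
      rw [Pi.sub_apply] at h1 h2 ⊢
      have h3 : min ((u i - (o i - 3 * N)).toNat / s) (26 * r - 1) =
          min ((v i - (o i - 3 * N)).toNat / s) (26 * r - 1) :=
        congrArg Fin.val (congrFun hf i)
      have h4 : (u i - (o i - 3 * N)).toNat / s ≤ 6 * N / s := Nat.div_le_div_right (by omega)
      have h5 : (v i - (o i - 3 * N)).toNat / s ≤ 6 * N / s := Nat.div_le_div_right (by omega)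
      rw [min_eq_left (by omega), min_eq_left (by omega)] at h3
      have h6 := Nat.div_add_mod (u i - (o i - 3 * N)).toNat s
      have h7 := Nat.div_add_mod (v i - (o i - 3 * N)).toNat s
      have h8 := Nat.mod_lt (u i - (o i - 3 * N)).toNat hs0
      have h9 := Nat.mod_lt (v i - (o i - 3 * N)).toNat hs0
      rw [h3] at h6
      omega
    rw [mem_boxZ] at hu hv
    refine ((h.dev u (mem_boxZ.2 (by omega)) v (mem_boxZ.2 (by omega)) huv).mono le_rfl
      (Nat.mul_le_mul_left r (Nat.add_le_add_right hle m))).of_box (boxZ_subset_boxZ ?_)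
    rw [mul_add]
    omega
  obtain ⟨π, hp, hpo, hU, hh, hl, hlen⟩ := (openConn_of_cells f
    (boxZ_subset_boxZ (by rw [sub_self, normInf_zero]; omega)) hcell hxy).exists_path
  refine ⟨π, hp, hpo, hU, hh, hl, ?_⟩
  rw [Fintype.card_fun, Fintype.card_fin, Fintype.card_fin] at hlen
  have h1 : r * (s + m) + 1 ≤ N := by
    rw [mul_add]
    omega
  have h2 : π.length ≤ N * (26 * r) ^ d + 1 :=
    hlen.trans (Nat.add_le_add_right (Nat.mul_le_mul_right _ h1) 1)
  have h3 : (π.length : ℝ) ≤ N * (26 * r) ^ d + 1 := by exact_mod_cast h2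
  have h4 : (N : ℝ) * (26 * r) ^ d ≤ N * Cstar := mul_le_mul_of_nonneg_left hC (by positivity)
  linarith

end Cells

section Tail

lemma measure_exists_mem_le {ι Ω : Type*} [MeasurableSpace Ω] (μ : Measure Ω) {s : Set ι}
    (hs : s.Finite) (S : ι → Set Ω) (a : ℝ≥0∞) (h : ∀ i, μ (S i) ≤ a) :
    μ {ω | ∃ i ∈ s, ω ∈ S i} ≤ s.ncard * a := by
  have h1 : {ω | ∃ i ∈ s, ω ∈ S i} = ⋃ i ∈ hs.toFinset, S i := by
    ext ω
    simp
  rw [h1, Set.ncard_eq_toFinset_card s hs]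
  refine (measure_biUnion_finset_le _ _).trans ((Finset.sum_le_card_nsmul _ _ a fun i _ => h i).trans
    (le_of_eq ?_))
  rw [nsmul_eq_mul]

lemma inv_mul_exp_le {c c' s s' : ℝ} (hc : 0 < c) (hcc : c ≤ c') (hs : 0 ≤ s) (hss : s ≤ s') :
    c'⁻¹ * Real.exp (-c' * s') ≤ c⁻¹ * Real.exp (-c * s) := by
  have h1 : c * s ≤ c' * s' := mul_le_mul hcc hss hs (hc.le.trans hcc)
  refine mul_le_mul (inv_anti₀ hc hcc) (Real.exp_le_exp.2 (by linarith)) (Real.exp_pos _).le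
    (inv_pos.2 hc).le

lemma exists_pow_le_exp (k : ℕ) {a : ℝ} (ha : 0 < a) :
    ∃ C : ℝ, 1 ≤ C ∧ ∀ N : ℕ, ((20 * N + 1 : ℕ) : ℝ) ^ k ≤ C * Real.exp (a * N) := by
  have hb : 0 < a / (k + 1) := by positivity
  have h20 : 0 ≤ 20 / (a / (k + 1)) := by positivity
  refine ⟨(20 / (a / (k + 1)) + 1) ^ k, one_le_pow₀ (by linarith), fun N => ?_⟩
  have hN : (0 : ℝ) ≤ N := N.cast_nonneg
  have h1 : a / (k + 1) * N ≤ Real.exp (a / (k + 1) * N) :=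
    (by linarith : _ ≤ a / (k + 1) * N + 1).trans (Real.add_one_le_exp _)
  have h2 : 1 ≤ Real.exp (a / (k + 1) * N) := Real.one_le_exp (by positivity)
  have h3 : ((20 * N + 1 : ℕ) : ℝ) ≤
      (20 / (a / (k + 1)) + 1) * Real.exp (a / (k + 1) * N) := by
    calc ((20 * N + 1 : ℕ) : ℝ) = 20 / (a / (k + 1)) * (a / (k + 1) * N) + 1 := by
          push_cast
          field_simp
      _ ≤ 20 / (a / (k + 1)) * Real.exp (a / (k + 1) * N) + Real.exp (a / (k + 1) * N) := by
          gcongr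
      _ = _ := by ring
  calc ((20 * N + 1 : ℕ) : ℝ) ^ k
      ≤ ((20 / (a / (k + 1)) + 1) * Real.exp (a / (k + 1) * N)) ^ k := by gcongr
    _ = (20 / (a / (k + 1)) + 1) ^ k * Real.exp (k * (a / (k + 1) * N)) := by
        rw [mul_pow, ← Real.exp_nat_mul]
    _ ≤ (20 / (a / (k + 1)) + 1) ^ k * Real.exp (a * N) := by
        refine mul_le_mul_of_nonneg_left (Real.exp_le_exp.2 ?_) (by positivity)
        rw [div_mul_eq_mul_div, mul_div_assoc', div_le_iff₀ (by positivity)]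
        nlinarith [mul_nonneg ha.le hN]

variable {d : ℕ} {p ρ cs : ℝ} {μ : Measure (Config d)}

theorem exists_not_goodAt_tail (hd : 2 ≤ d) (hμ : IsBernoulli d p μ) (hρ : GMprop d μ ρ)
    (hcs : CrossProp d μ cs) :
    ∃ c > 0, ∀ (n r m M T N : ℕ) (o : ZVec d), 2 ≤ n → ScaleOK r m M T N → ρ ≤ r → 1 / cs ≤ T →
      (M : ℝ) ≤ Real.exp (cs * Real.log n ^ 2) →
      μ {ω | ¬ GoodAt n r m M T N o ω} ≤
        ENNReal.ofReal (3 * ((20 * N + 1 : ℕ) : ℝ) ^ (2 * d) * (c⁻¹ * Real.exp (-c * m))) := by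
  obtain ⟨c₁, hc₁, h1⟩ := exists_hole_tail hd hμ hρ
  obtain ⟨c₂, hc₂, h2⟩ := exists_chemical_deviation hμ hρ
  have h0 := ae_unique_infinite_cluster (by omega) hμ hρ
  obtain ⟨hc₃, -, h3⟩ := hcs
  have hc : 0 < min (min c₁ c₂) cs := lt_min (lt_min hc₁ hc₂) hc₃
  have hcc₁ : min (min c₁ c₂) cs ≤ c₁ := (min_le_left _ _).trans (min_le_left _ _)
  have hcc₂ : min (min c₁ c₂) cs ≤ c₂ := (min_le_left _ _).trans (min_le_right _ _)
  have hcc₃ : min (min c₁ c₂) cs ≤ cs := min_le_right _ _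
  refine ⟨_, hc, ?_⟩
  intro n r m M T N o hn hs hr hT hM
  set c := min (min c₁ c₂) cs
  obtain ⟨e1, e2, e3, e4⟩ := hs.bounds
  set a := ENNReal.ofReal (c⁻¹ * Real.exp (-c * m)) with ha
  set K : ℕ := (20 * N + 1) ^ (2 * d) with hK
  have hm : (0 : ℝ) ≤ m := m.cast_nonneg
  have hK1 : ∀ t : ℕ, t ≤ 10 * N → (2 * t + 1) ^ d ≤ K := fun t ht => by
    rw [hK]
    exact (Nat.pow_le_pow_left (by omega) d).trans (Nat.pow_le_pow_right (by omega) (by omega))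
  have b0 : μ {ω | ¬ ∀ x y, InInfCluster d ω x → InInfCluster d ω y → Conn ω x y} = 0 := by
    rw [← ae_iff]
    exact h0.mono fun ω h => h.2
  have b1 : μ {ω | ∃ u ∈ boxZ d (5 * N) o, ω ∈ {ω | Hole m u ω}} ≤ K * a := by
    refine (measure_exists_mem_le μ (finite_boxZ _ _) _ a fun u => (h1 m u).trans
      (ENNReal.ofReal_le_ofReal (inv_mul_exp_le hc hcc₁ hm le_rfl))).trans ?_
    rw [ncard_boxZ]
    gcongr
    exact_mod_cast hK1 _ (by omega)
  have b2 : μ {ω | ∃ q ∈ boxZ d (10 * N) o ×ˢ boxZ d (10 * N) o, ω ∈ {ω | Conn ω q.1 q.2 ∧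
      ¬ OpenConn ω Set.univ q.1 q.2 (r * (normInf d (q.1 - q.2) + m))}} ≤ K * a := by
    refine (measure_exists_mem_le μ ((finite_boxZ _ _).prod (finite_boxZ _ _)) _ a fun q =>
      (h2 q.1 q.2 _ ?_).trans
      (ENNReal.ofReal_le_ofReal (inv_mul_exp_le hc hcc₂ hm ?_))).trans ?_
    · rw [normInf_sub_comm q.2 q.1]
      push_cast
      gcongr
      linarith
    · have : m ≤ r * (normInf d (q.1 - q.2) + m) :=
        (Nat.le_add_left _ _).trans (Nat.le_mul_of_pos_left _ hs.one_le_r)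
      exact_mod_cast this
    · rw [Set.ncard_prod, ncard_boxZ]
      gcongr
      rw [hK, two_mul d, pow_add, show 2 * (10 * N) = 20 * N by ring]
  have b3 : μ {ω | ∃ z ∈ boxZ d (4 * N) o, ω ∈ {ω | shiftCfg z ω ∈ ENevent d n T M}} ≤ K * a := by
    refine (measure_exists_mem_le μ (finite_boxZ _ _) _ a fun z =>
      (hμ.measure_shiftCfg_le z _).trans ((h3 n hn T hT M e4 hM).trans
      (ENNReal.ofReal_le_ofReal (inv_mul_exp_le hc hcc₃ hm ?_)))).trans ?_
    · have : m ≤ M := by omega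
      exact_mod_cast this
    · rw [ncard_boxZ]
      gcongr
      exact_mod_cast hK1 _ (by omega)
  have hsub : {ω | ¬ GoodAt n r m M T N o ω} ⊆
      {ω | ¬ ∀ x y, InInfCluster d ω x → InInfCluster d ω y → Conn ω x y} ∪
      ({ω | ∃ u ∈ boxZ d (5 * N) o, ω ∈ {ω | Hole m u ω}} ∪
      ({ω | ∃ q ∈ boxZ d (10 * N) o ×ˢ boxZ d (10 * N) o, ω ∈ {ω | Conn ω q.1 q.2 ∧
        ¬ OpenConn ω Set.univ q.1 q.2 (r * (normInf d (q.1 - q.2) + m))}} ∪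
      {ω | ∃ z ∈ boxZ d (4 * N) o, ω ∈ {ω | shiftCfg z ω ∈ ENevent d n T M}})) := by
    intro ω hω
    by_contra hcon
    simp only [Set.mem_union, Set.mem_ofPred_eq, not_or, not_not] at hcon
    obtain ⟨g1, g2, g3, g4⟩ := hcon
    refine hω ⟨g1, fun u hu hh => g2 ⟨u, hu, hh⟩, fun u hu v hv huv => ?_,
      fun z hz hh => g4 ⟨z, hz, hh⟩⟩
    by_contra hh
    exact g3 ⟨(u, v), ⟨hu, hv⟩, huv, hh⟩
  calc μ {ω | ¬ GoodAt n r m M T N o ω}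
      ≤ 0 + (K * a + (K * a + K * a)) := by
        refine (measure_mono hsub).trans ((measure_union_le _ _).trans (add_le_add b0.le ?_))
        refine (measure_union_le _ _).trans (add_le_add b1 ?_)
        exact (measure_union_le _ _).trans (add_le_add b2 b3)
    _ = ENNReal.ofReal (3 * (K : ℝ)) * a := by
        rw [ENNReal.ofReal_mul (by norm_num), ENNReal.ofReal_natCast, ENNReal.ofReal_ofNat]
        ring
    _ = _ := by
        rw [ha, ← ENNReal.ofReal_mul (by positivity), hK, Nat.cast_pow]

lemma constants_le (hd : 2 ≤ d) {Cstar : ℝ} {r : ℕ} (hρ : 1 ≤ ρ) (hcs : 0 < cs)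
    (hr : (r : ℝ) ≤ 2 * ρ) (hC : Cstar = 1 / cs + (100 * ρ ^ 2) ^ d) :
    10 ≤ Cstar ∧ 60 * (r : ℝ) ≤ Cstar ∧ (26 * (r : ℝ)) ^ d ≤ Cstar := by
  have h1 : 0 < 1 / cs := by positivity
  have h2 : 100 * ρ ≤ 100 * ρ ^ 2 := by nlinarith
  have h3 : 100 * (100 * ρ ^ 2) ≤ (100 * ρ ^ 2) ^ 2 := by nlinarith
  have h5 : (100 * ρ ^ 2) ^ 2 ≤ (100 * ρ ^ 2) ^ d :=
    pow_le_pow_right₀ (by linarith) hd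
  have h4 : (26 * (r : ℝ)) ^ d ≤ (100 * ρ ^ 2) ^ d := by
    refine pow_le_pow_left₀ (by positivity) ?_ d
    linarith
  exact ⟨by linarith, by linarith, by linarith⟩

/-- The effective radius is at most the scale of a good configuration. -/
lemma setOf_le_ReffENN_subset (hd : 2 ≤ d) {n r m M T N : ℕ} {Cstar : ℝ} {e : EdgeD d} {t : ℝ}
    (hn : 1 ≤ Real.log n ^ 2) (hs : ScaleOK r m M T N) (hN : 1 ≤ N) (ht : (N : ℝ) < t)
    (hC : 10 ≤ Cstar ∧ 60 * (r : ℝ) ≤ Cstar ∧ (26 * (r : ℝ)) ^ d ≤ Cstar) :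
    {ω | ENNReal.ofReal t ≤ ReffENN d Cstar n e ω} ⊆ {ω | ¬ GoodAt n r m M T N e.val.1 ω} := by
  intro ω hω h
  have h1 : ReffENN d Cstar n e ω ≤ N :=
    sInf_le ⟨N, rfl, hN, h.v1 hd hn hs hC.1 hC.2.1, h.v2 hs hC.2.2⟩
  have h2 := le_trans (show ENNReal.ofReal t ≤ _ from hω) h1
  rw [← ENNReal.ofReal_natCast, ENNReal.ofReal_le_ofReal_iff N.cast_nonneg] at h2
  exact absurd ht (not_lt.2 h2)

end Tail

/-- Proposition 2.4: exponential tail of the effective radius: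
there is `c > 0` such that for every edge `e` and every `1 ≤ t ≤ exp(c log² n)`,
`P(R_e ≥ t) ≤ c⁻¹ exp(−ct)`.  Here `C_* = 1/c_* + (100ρ²)^d` where `ρ` is the
Garet–Marchand moderate-deviation constant and `c_*` the crossing-cluster constant. -/
theorem effective_radius_exponential_tail
    (d : ℕ) (hd : 2 ≤ d) (p : ℝ) (hp : pc d < p) (hp1 : p < 1)
    (μ : Measure (Config d)) (hμ : IsBernoulli d p μ)
    (ρ cs Cstar : ℝ) (hρ : GMprop d μ ρ) (hcs : CrossProp d μ cs)
    (hC : Cstar = 1 / cs + (100 * ρ ^ 2) ^ d) :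
    ∃ c : ℝ, 0 < c ∧ ∀ n : ℕ, 2 ≤ n → ∀ e : EdgeD d, ∀ t : ℝ, 1 ≤ t →
      t ≤ Real.exp (c * (Real.log n) ^ 2) →
      μ {ω | ENNReal.ofReal t ≤ ReffENN d Cstar n e ω}
        ≤ ENNReal.ofReal (c⁻¹ * Real.exp (-c * t)) := by
  have : IsProbabilityMeasure μ := hμ.1
  have hρ1 := hρ.1
  have hcs0 := hcs.1
  obtain ⟨r, hr, hr2⟩ : ∃ r : ℕ, ρ ≤ r ∧ (r : ℝ) ≤ 2 * ρ :=
    ⟨⌈ρ⌉₊, Nat.le_ceil ρ, by linarith [Nat.ceil_lt_add_one (zero_le_one.trans hρ1)]⟩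
  have hr1 : 1 ≤ r := by exact_mod_cast hρ1.trans hr
  obtain ⟨T, hT, hTr⟩ : ∃ T : ℕ, 1 / cs ≤ T ∧ 4 * r + 4 ≤ T :=
    ⟨max ⌈1 / cs⌉₊ (4 * r + 4), (Nat.le_ceil _).trans (by exact_mod_cast le_max_left _ _),
      le_max_right _ _⟩
  have hconst := constants_le hd hρ1 hcs0 hr2 hC
  obtain ⟨c', hc', htail⟩ := exists_not_goodAt_tail hd hμ hρ hcs
  obtain ⟨q, hq⟩ : ∃ q, q = 8 * (r * T) := ⟨_, rfl⟩
  have hq8 : 8 ≤ q := by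
    have : 1 ≤ r * T := Nat.mul_pos hr1 (by omega)
    omega
  have hq8' : (8 : ℝ) ≤ q := by exact_mod_cast hq8
  obtain ⟨C, hC1, hCexp⟩ := exists_pow_le_exp (2 * d) (show 0 < c' / (4 * q) by positivity)
  have hD : 0 < 3 * C * c'⁻¹ := by positivity
  obtain ⟨c, hc, hca, hcD, hccs, hcq⟩ : ∃ c : ℝ, 0 < c ∧ c ≤ c' / (8 * q) ∧
      c ≤ (3 * C * c'⁻¹)⁻¹ ∧ c ≤ cs ∧ c ≤ 1 / (q + 2) :=
    ⟨min (min (c' / (8 * q)) (3 * C * c'⁻¹)⁻¹) (min cs (1 / (q + 2))),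
      lt_min (lt_min (by positivity) (by positivity)) (lt_min hcs0 (by positivity)),
      (min_le_left _ _).trans (min_le_left _ _), (min_le_left _ _).trans (min_le_right _ _),
      (min_le_right _ _).trans (min_le_left _ _), (min_le_right _ _).trans (min_le_right _ _)⟩
  rw [le_div_iff₀ (by positivity)] at hcq
  have hDc : 3 * C * c'⁻¹ ≤ c⁻¹ := (le_inv_comm₀ hc hD).1 hcD
  refine ⟨c, hc, fun n hn e t ht1 ht => ?_⟩
  rcases le_or_gt t (q + 1) with htq | htq
  · refine prob_le_one.trans ?_
    rw [← ENNReal.ofReal_one]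
    refine ENNReal.ofReal_le_ofReal ?_
    rw [inv_mul_eq_div, one_le_div hc]
    have h1 : c * t ≤ c * (q + 1) := mul_le_mul_of_nonneg_left htq hc.le
    linarith [Real.add_one_le_exp (-c * t)]
  have hN : ⌈t⌉₊ - 1 < ⌈t⌉₊ := Nat.sub_lt (Nat.ceil_pos.2 (by linarith)) one_pos
  have hNt := Nat.lt_ceil.1 hN
  have htN : t ≤ (⌈t⌉₊ - 1 : ℕ) + 1 := (Nat.le_ceil t).trans (by exact_mod_cast (by omega))
  set N := ⌈t⌉₊ - 1
  have hqN' : (q : ℝ) < N := by linarith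
  have hqN : q < N := by exact_mod_cast hqN'
  have hm1 : 1 ≤ N / q := (Nat.one_le_div_iff (by omega)).2 hqN.le
  have hTM : T * (8 * (r * (N / q))) ≤ N :=
    calc T * (8 * (r * (N / q))) = q * (N / q) := by rw [hq]; ring
      _ ≤ N := Nat.mul_div_le N q
  have hMN : 8 * (r * (N / q)) ≤ N := (Nat.le_mul_of_pos_left _ (by omega)).trans hTM
  have hs : ScaleOK r (N / q) (8 * (r * (N / q))) T N := ⟨hr1, hm1, rfl, hTr, hTM⟩
  have hlog : (0 : ℝ) ≤ Real.log n ^ 2 := sq_nonneg _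
  have hlog1 : 1 ≤ Real.log n ^ 2 := by
    have h1 : Real.exp 1 < Real.exp (c * Real.log n ^ 2) :=
      lt_of_lt_of_le (by linarith [Real.exp_one_lt_d9]) ht
    have h2 := Real.exp_lt_exp.1 h1
    have h3 : c ≤ 1 := by nlinarith
    nlinarith
  have hM : ((8 * (r * (N / q)) : ℕ) : ℝ) ≤ Real.exp (cs * Real.log n ^ 2) := by
    refine (Nat.cast_le.2 hMN).trans ((hNt.le.trans ht).trans (Real.exp_le_exp.2 ?_))
    exact mul_le_mul_of_nonneg_right hccs hlog
  refine (measure_mono (setOf_le_ReffENN_subset hd hlog1 hs (by omega) hNt hconst)).trans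
    ((htail n r _ _ T N _ hn hs hr hT hM).trans (ENNReal.ofReal_le_ofReal ?_))
  have hm2 : (N : ℝ) ≤ 2 * q * (N / q : ℕ) := by
    have h1 : N < q * (N / q + 1) := Nat.lt_mul_div_succ N (by omega)
    have h2 : q * 1 ≤ q * (N / q) := Nat.mul_le_mul_left q hm1
    have h3 : N ≤ 2 * q * (N / q) := by
      rw [mul_add] at h1
      rw [mul_assoc]
      omega
    exact_mod_cast h3
  have hexp : c' / (4 * q) * N + -c' * (N / q : ℕ) ≤ -c * t := by
    have h1 : c * t ≤ c' / (8 * q) * (2 * N) :=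
      mul_le_mul hca (by linarith) (by linarith) (by positivity)
    have h2 : c' / (2 * q) * N ≤ c' / (2 * q) * (2 * q * (N / q : ℕ)) :=
      mul_le_mul_of_nonneg_left hm2 (by positivity)
    have h3 : c' / (2 * q) * (2 * q * (N / q : ℕ)) = c' * (N / q : ℕ) := by field_simp
    have h4 : c' / (8 * q) * (2 * N) = c' / (4 * q) * N := by field_simp; ring
    have h5 : c' / (2 * q) * N = c' / (4 * q) * N + c' / (4 * q) * N := by field_simp; ring
    linarith
  calc 3 * ((20 * N + 1 : ℕ) : ℝ) ^ (2 * d) * (c'⁻¹ * Real.exp (-c' * (N / q : ℕ)))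
      ≤ 3 * (C * Real.exp (c' / (4 * q) * N)) * (c'⁻¹ * Real.exp (-c' * (N / q : ℕ))) := by
        refine mul_le_mul_of_nonneg_right ?_ (by positivity)
        exact mul_le_mul_of_nonneg_left (hCexp N) (by norm_num)
    _ = 3 * C * c'⁻¹ * Real.exp (c' / (4 * q) * N + -c' * (N / q : ℕ)) := by
        rw [Real.exp_add]
        ring
    _ ≤ c⁻¹ * Real.exp (-c * t) :=
        mul_le_mul hDc (Real.exp_le_exp.2 hexp) (Real.exp_pos _).le (inv_pos.2 hc).le

end Perco
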